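/- arXiv:1308.0423 — 2 statements merged into one kernel-verified Lean document; each statement's English description precedes it below -/
import Mathlib

section
/- Let k be a field of characteristic 0 containing √−7, and let G₁₆₈ = ⟨σ, τ⟩ ⊆ S₇ (with σ = (1 2 3 4 5 6 7), τ = (2 3)(4 7), so G₁₆₈ ≅ PSL₂(𝔽₇)) act on the rational function field k(x₁,...,x₇) by permuting the variables. Then k(x₁,...,x₇)^{G₁₆₈} is purely transcendental over k. -/
/-- An intermediate field `L` of `E/k` is purely transcendental (rational) over `k`
if `L = k(s)` for some set `s` of elements algebraically independent over `k`. -/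
def IsRationalExtension (k : Type*) {E : Type*} [Field k] [Field E] [Algebra k E]
    (L : IntermediateField k E) : Prop :=
  ∃ s : Set E, AlgebraicIndependent k ((↑) : s → E) ∧ IntermediateField.adjoin k s = L

/-- The 7-cycle `σ = (1 2 3 4 5 6 7)` (acting as `i ↦ i + 1` on `Fin 7`). -/
def sigma168 : Equiv.Perm (Fin 7) := finRotate 7

/-- The permutation `τ = (2 3)(4 7)` (in 0-indexed form `(1 2)(3 6)`). -/
def tau168 : Equiv.Perm (Fin 7) := Equiv.swap 1 2 * Equiv.swap 3 6

/-- The subgroup `G₁₆₈ = ⟨σ, τ⟩ ≅ PSL₂(𝔽₇)` of `S₇`. -/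
def G168 : Subgroup (Equiv.Perm (Fin 7)) := Subgroup.closure {sigma168, tau168}

/-- A scaled orbit of seven quadratic forms under Klein's three-dimensional representation,
for `a` a root of `a ^ 2 + a + 2`. -/
def kleinFrame {R : Type*} [CommRing R] (a : R) (v : Fin 3 → R) : Fin 7 → R :=
  ![4 * (v 0 ^ 2 + v 1 ^ 2 + v 2 ^ 2),
    (1 + a) * (v 0 ^ 2 + v 1 ^ 2) - (4 + 2 * a) * v 2 ^ 2 + (2 * a - 6) * (v 0 * v 1),
    (1 + a) * (v 0 ^ 2 + v 2 ^ 2) - (4 + 2 * a) * v 1 ^ 2 + (2 * a - 6) * (v 0 * v 2),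
    (1 + a) * (v 0 ^ 2 + v 1 ^ 2) - (4 + 2 * a) * v 2 ^ 2 - (2 * a - 6) * (v 0 * v 1),
    (1 + a) * (v 1 ^ 2 + v 2 ^ 2) - (4 + 2 * a) * v 0 ^ 2 - (2 * a - 6) * (v 1 * v 2),
    (1 + a) * (v 1 ^ 2 + v 2 ^ 2) - (4 + 2 * a) * v 0 ^ 2 + (2 * a - 6) * (v 1 * v 2),
    (1 + a) * (v 0 ^ 2 + v 2 ^ 2) - (4 + 2 * a) * v 1 ^ 2 - (2 * a - 6) * (v 0 * v 2)]

/-- The quartic invariant of Klein's representation, up to scaling. -/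
def kleinQuartic {R : Type*} [CommRing R] (a : R) (v : Fin 3 → R) : R :=
  ∑ i, kleinFrame a v i ^ 2

/-- The sextic invariant of Klein's representation, up to scaling. -/
def kleinSextic {R : Type*} [CommRing R] (a : R) (v : Fin 3 → R) : R :=
  ∑ i, kleinFrame a v i ^ 3

/-- The matrix of `σ` in Klein's three-dimensional representation. -/
def kleinSigma {K : Type*} [Field K] (a : K) : Matrix (Fin 3) (Fin 3) K :=
  !![-1 / 2, 1 / 2, -a / 2; (1 + a) / 2, (1 + a) / 2, 0; -1 / 2, 1 / 2, a / 2]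

/-- The matrix of `τ` in Klein's three-dimensional representation. -/
def kleinTau {K : Type*} [Field K] : Matrix (Fin 3) (Fin 3) K :=
  !![-1, 0, 0; 0, 0, -1; 0, -1, 0]

theorem kleinFrame_smul {R : Type*} [CommRing R] (a t : R) (v : Fin 3 → R) (i : Fin 7) :
    kleinFrame a (fun j => t * v j) i = t ^ 2 * kleinFrame a v i := by
  fin_cases i <;> simp [kleinFrame] <;> ring

theorem map_kleinFrame {R S : Type*} [CommRing R] [CommRing S] (f : R →+* S) (a : R)
    (v : Fin 3 → R) (i : Fin 7) :
    f (kleinFrame a v i) = kleinFrame (f a) (fun j => f (v j)) i := by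
  fin_cases i <;> simp [kleinFrame, map_ofNat]

theorem map_kleinQuartic {R S : Type*} [CommRing R] [CommRing S] (f : R →+* S) (a : R)
    (v : Fin 3 → R) : f (kleinQuartic a v) = kleinQuartic (f a) (fun j => f (v j)) := by
  simp only [kleinQuartic, map_sum, map_pow, map_kleinFrame]

theorem map_kleinSextic {R S : Type*} [CommRing R] [CommRing S] (f : R →+* S) (a : R)
    (v : Fin 3 → R) : f (kleinSextic a v) = kleinSextic (f a) (fun j => f (v j)) := by
  simp only [kleinSextic, map_sum, map_pow, map_kleinFrame]

theorem kleinFrame_sigma {K : Type*} [Field K] [CharZero K] {a : K} (ha : a ^ 2 + a + 2 = 0)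
    (v : Fin 3 → K) (i : Fin 7) :
    kleinFrame a ((kleinSigma a).mulVec v) i = kleinFrame a v (sigma168 i) := by
  obtain ⟨x, hx⟩ : ∃ x, v 0 = x := ⟨_, rfl⟩
  obtain ⟨y, hy⟩ : ∃ y, v 1 = y := ⟨_, rfl⟩
  obtain ⟨z, hz⟩ : ∃ z, v 2 = z := ⟨_, rfl⟩
  fin_cases i <;>
    simp [kleinFrame, sigma168, kleinSigma, Matrix.mulVec, dotProduct, Fin.sum_univ_three, hx, hy,
      hz]
  · linear_combination (x ^ 2 + 2 * x * y + y ^ 2 + 2 * z ^ 2) * ha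
  · linear_combination ((a / 4) * x ^ 2 + (1 + a / 2) * x * y + (3 - a / 2) * x * z + (1 + a / 4)
        * y ^ 2 - (a / 2) * y * z + (-1 / 2 - a / 4) * z ^ 2) * ha
  · linear_combination ((-3 / 2 - a / 2) * x ^ 2 + (-3 - a) * x * y + (-3 / 2 - a / 2) * y ^ 2 + 2
        * z ^ 2) * ha
  · linear_combination ((1 + a / 4) * x ^ 2 + (1 + a / 2) * x * y + (a / 2) * x * z + (a / 4) * y
        ^ 2 + (-3 + a / 2) * y * z + (-1 / 2 - a / 4) * z ^ 2) * ha
  · linear_combination ((1 + a / 4) * x ^ 2 + (1 + a / 2) * x * y - (a / 2) * x * z + (a / 4) * y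
        ^ 2 + (3 - a / 2) * y * z + (-1 / 2 - a / 4) * z ^ 2) * ha
  · linear_combination ((a / 4) * x ^ 2 + (1 + a / 2) * x * y + (-3 + a / 2) * x * z + (1 + a / 4)
        * y ^ 2 + (a / 2) * y * z + (-1 / 2 - a / 4) * z ^ 2) * ha
  · linear_combination ((-3 / 2 - a / 2) * x ^ 2 + (-3 - a) * x * y + (-3 / 2 - a / 2) * y ^ 2 +
        (-2 + a) * z ^ 2) * ha

theorem kleinFrame_tau {K : Type*} [Field K] (a : K)
    (v : Fin 3 → K) (i : Fin 7) :
    kleinFrame a (kleinTau.mulVec v) i = kleinFrame a v (tau168 i) := by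
  fin_cases i <;>
    simp [kleinFrame, tau168, kleinTau, Matrix.mulVec, dotProduct, Fin.sum_univ_three,
      Equiv.swap_apply_def, -mul_eq_mul_left_iff] <;> ring

theorem kleinQuartic_eq {R : Type*} [CommRing R] {a : R} (ha : a ^ 2 + a + 2 = 0)
    (v : Fin 3 → R) :
    kleinQuartic a v = 28 * ((1 + a) * (v 0 ^ 2 + v 1 ^ 2 + v 2 ^ 2) ^ 2 +
      (1 - 5 * a) * (v 0 ^ 2 * v 1 ^ 2 + v 0 ^ 2 * v 2 ^ 2 + v 1 ^ 2 * v 2 ^ 2)) := by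
  simp only [kleinQuartic, kleinFrame, Fin.sum_univ_seven]
  simp
  linear_combination (12 * v 0 ^ 4 - 4 * v 0 ^ 2 * v 1 ^ 2 - 4 * v 0 ^ 2 * v 2 ^ 2 + 12 * v 1 ^ 4 -
    4 * v 1 ^ 2 * v 2 ^ 2 + 12 * v 2 ^ 4) * ha

theorem kleinSextic_eq {R : Type*} [CommRing R] {a : R} (ha : a ^ 2 + a + 2 = 0)
    (v : Fin 3 → R) :
    kleinSextic a v = 84 * (1 - a) * (v 0 ^ 2 + v 1 ^ 2 + v 2 ^ 2) ^ 3 +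
      (378 + 462 * a) * (v 0 ^ 2 + v 1 ^ 2 + v 2 ^ 2) *
        (v 0 ^ 2 * v 1 ^ 2 + v 0 ^ 2 * v 2 ^ 2 + v 1 ^ 2 * v 2 ^ 2) -
      (4998 + 882 * a) * (v 0 ^ 2 * v 1 ^ 2 * v 2 ^ 2) := by
  obtain ⟨x, hx⟩ : ∃ x, v 0 = x := ⟨_, rfl⟩
  obtain ⟨y, hy⟩ : ∃ y, v 1 = y := ⟨_, rfl⟩
  obtain ⟨z, hz⟩ : ∃ z, v 2 = z := ⟨_, rfl⟩
  simp only [kleinSextic, kleinFrame, Fin.sum_univ_seven, hx, hy, hz]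
  simp
  linear_combination ((-72 - 12 * a) * (x ^ 6 + y ^ 6 + z ^ 6) + (42 * a - 72) *
    (x ^ 4 * y ^ 2 + x ^ 4 * z ^ 2 + x ^ 2 * y ^ 4 + x ^ 2 * z ^ 4 + y ^ 4 * z ^ 2 + y ^ 2 * z ^ 4) +
    (504 - 216 * a) * x ^ 2 * y ^ 2 * z ^ 2) * ha

/-- A polynomial in `T` taking the same value at all forms of the Klein frame, when `p` and `q`
are the quartic and the sextic invariant. -/
def frameValue {R : Type*} [CommRing R] (a p q T : R) : R :=
  7056 * T ^ 7 - 3528 * p * T ^ 5 - 2352 * q * T ^ 4 + 63 * (9 - a) * p ^ 2 * T ^ 3 +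
    84 * (7 + a) * p * q * T ^ 2 + (9 * (a - 3) * p ^ 3 + 28 * (5 - a) * q ^ 2) * T

theorem frameValue_kleinFrame_one {R : Type*} [CommRing R] {a : R} (ha : a ^ 2 + a + 2 = 0)
    (v : Fin 3 → R) :
    frameValue a (kleinQuartic a v) (kleinSextic a v) (kleinFrame a v 1) =
      frameValue a (kleinQuartic a v) (kleinSextic a v) (kleinFrame a v 0) := by
  obtain ⟨s, hs⟩ : ∃ s, v 0 ^ 2 + v 1 ^ 2 = s := ⟨_, rfl⟩
  obtain ⟨w, hw⟩ : ∃ w, v 0 * v 1 = w := ⟨_, rfl⟩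
  obtain ⟨Z, hZ⟩ : ∃ Z, v 2 ^ 2 = Z := ⟨_, rfl⟩
  have h4 : kleinQuartic a v = 28 * ((1 + a) * (s + Z) ^ 2 + (1 - 5 * a) * (w ^ 2 + s * Z)) := by
    rw [kleinQuartic_eq ha, ← hs, ← hw, ← hZ]
    ring
  have h6 : kleinSextic a v = 84 * (1 - a) * (s + Z) ^ 3 +
      (378 + 462 * a) * (s + Z) * (w ^ 2 + s * Z) - (4998 + 882 * a) * (w ^ 2 * Z) := by
    rw [kleinSextic_eq ha, ← hs, ← hw, ← hZ]
    ring
  have h0 : kleinFrame a v 0 = 4 * (s + Z) := by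
    rw [← hs, ← hZ]
    rfl
  have h1 : kleinFrame a v 1 = (1 + a) * s - (4 + 2 * a) * Z + (2 * a - 6) * w := by
    rw [← hs, ← hw, ← hZ]
    rfl
  rw [h4, h6, h0, h1, frameValue, frameValue]
  linear_combination (
    (-7048944 + 8192016 * a - 1312416 * a ^ 2 + 42336 * a ^ 3 - 105840 * a ^ 4 + 7056 * a ^ 5) *
    s ^ 7 + (-9779616 + 5630688 * a - 197568 * a ^ 2 + 2173248 * a ^ 3 - 1086624 * a ^ 4 + 98784
    * a ^ 5) * s ^ 6 * w + (10668672 - 26968032 * a + 12644352 * a ^ 2 - 592704 * a ^ 3 +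
    1185408 * a ^ 4 - 98784 * a ^ 5) * s ^ 6 * Z + (80607744 - 102142656 * a + 10273536 * a ^ 2
    + 13829760 * a ^ 3 - 4741632 * a ^ 4 + 592704 * a ^ 5) * s ^ 5 * w ^ 2 + (-100759680 +
    27659520 * a + 1975680 * a ^ 2 - 20151936 * a ^ 3 + 10273536 * a ^ 4 - 1185408 * a ^ 5) * s
    ^ 5 * w * Z + (12150432 - 12990096 * a - 36599472 * a ^ 2 + 2518992 * a ^ 3 - 5186160 * a ^
    4 + 592704 * a ^ 5) * s ^ 5 * Z ^ 2 + (54528768 - 44255232 * a - 32796288 * a ^ 2 + 32796288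
    * a ^ 3 - 12249216 * a ^ 4 + 1975680 * a ^ 5) * s ^ 4 * w ^ 3 + (-166154688 + 363821472 * a
    - 82484640 * a ^ 2 - 95524128 * a ^ 3 + 36846432 * a ^ 4 - 5927040 * a ^ 5) * s ^ 4 * w ^ 2
    * Z + (-27264384 - 118046880 * a + 26375328 * a ^ 2 + 60752160 * a ^ 3 - 36253728 * a ^ 4 +
    5927040 * a ^ 5) * s ^ 4 * w * Z ^ 2 + (-79422336 + 25189920 * a + 15015168 * a ^ 2 -
    4050144 * a ^ 3 + 10471104 * a ^ 4 - 1975680 * a ^ 5) * s ^ 4 * Z ^ 3 + (-304946208 +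
    388072944 * a - 110292336 * a ^ 2 + 38278800 * a ^ 3 - 22967280 * a ^ 4 + 3951360 * a ^ 5) *
    s ^ 3 * w ^ 4 + (284497920 + 183145536 * a + 76853952 * a ^ 2 - 143631936 * a ^ 3 + 76458816
    * a ^ 4 - 15805440 * a ^ 5) * s ^ 3 * w ^ 3 * Z + (447293952 + 133062048 * a + 233426592 * a
    ^ 2 + 177119712 * a ^ 3 - 101056032 * a ^ 4 + 23708160 * a ^ 5) * s ^ 3 * w ^ 2 * Z ^ 2 +
    (1160514432 + 237279168 * a - 115577280 * a ^ 2 - 49194432 * a ^ 3 + 53540928 * a ^ 4 -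
    15805440 * a ^ 5) * s ^ 3 * w * Z ^ 3 + (226314144 + 172328688 * a + 83126736 * a ^ 2 +
    4692240 * a ^ 3 - 6766704 * a ^ 4 + 3951360 * a ^ 5) * s ^ 3 * Z ^ 4 + (106686720 + 10372320
    * a - 7606368 * a ^ 2 + 55220256 * a ^ 3 - 33487776 * a ^ 4 + 4741632 * a ^ 5) * s ^ 2 * w ^
    5 + (-230561856 - 667977408 * a + 278669664 * a ^ 2 - 70729344 * a ^ 3 + 112119840 * a ^ 4 -
    23708160 * a ^ 5) * s ^ 2 * w ^ 4 * Z + (-1036046592 + 396914112 * a + 24300864 * a ^ 2 +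
    37735488 * a ^ 3 - 159437376 * a ^ 4 + 47416320 * a ^ 5) * s ^ 2 * w ^ 3 * Z ^ 2 +
    (-2326560768 - 674892288 * a - 161413056 * a ^ 2 + 57294720 * a ^ 3 + 102537792 * a ^ 4 -
    47416320 * a ^ 5) * s ^ 2 * w ^ 2 * Z ^ 3 + (-1230453504 - 593000352 * a - 11162592 * a ^ 2
    - 60554592 * a ^ 3 - 12545568 * a ^ 4 + 23708160 * a ^ 5) * s ^ 2 * w * Z ^ 4 + (-67370688 -
    112811328 * a - 117256608 * a ^ 2 - 18966528 * a ^ 3 - 9186912 * a ^ 4 - 4741632 * a ^ 5) *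
    s ^ 2 * Z ^ 5 + (392962752 - 308206080 * a - 44650368 * a ^ 2 + 102735360 * a ^ 3 - 32203584
    * a ^ 4 + 3161088 * a ^ 5) * s * w ^ 6 + (509725440 - 1460817792 * a + 250121088 * a ^ 2 -
    116565120 * a ^ 3 + 115774848 * a ^ 4 - 18966528 * a ^ 5) * s * w ^ 5 * Z + (-6886232640 +
    454011264 * a - 134346240 * a ^ 2 - 169513344 * a ^ 3 - 170896320 * a ^ 4 + 47416320 * a ^
    5) * s * w ^ 4 * Z ^ 2 + (-1488872448 - 1360058112 * a + 16595712 * a ^ 2 + 430698240 * a ^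
    3 + 113008896 * a ^ 4 - 63221760 * a ^ 5) * s * w ^ 3 * Z ^ 3 + (1220772672 + 850332672 * a
    - 379725696 * a ^ 2 - 383281920 * a ^ 3 + 2173248 * a ^ 4 + 47416320 * a ^ 5) * s * w ^ 2 *
    Z ^ 4 + (604558080 + 683980416 * a + 382886784 * a ^ 2 + 81002880 * a ^ 3 - 45440640 * a ^ 4
    - 18966528 * a ^ 5) * s * w * Z ^ 5 + (47218752 + 32006016 * a + 75866112 * a ^ 2 + 42279552
    * a ^ 3 + 17583552 * a ^ 4 + 3161088 * a ^ 5) * s * Z ^ 6 + (-649772928 + 574414848 * a -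
    243065088 * a ^ 2 + 74962944 * a ^ 3 - 13942656 * a ^ 4 + 903168 * a ^ 5) * w ^ 7 +
    (2249904384 - 2038506624 * a + 609694848 * a ^ 2 - 177416064 * a ^ 3 + 58084992 * a ^ 4 -
    6322176 * a ^ 5) * w ^ 6 * Z + (705317760 + 1911667968 * a - 448874496 * a ^ 2 + 35562240 *
    a ^ 3 - 98388864 * a ^ 4 + 18966528 * a ^ 5) * w ^ 5 * Z ^ 2 + (-2685344256 + 77051520 * a +
    224832384 * a ^ 2 + 264345984 * a ^ 3 + 77051520 * a ^ 4 - 31610880 * a ^ 5) * w ^ 4 * Z ^ 3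
    + (1625194368 + 972034560 * a - 185713920 * a ^ 2 - 377750016 * a ^ 3 - 4346496 * a ^ 4 +
    31610880 * a ^ 5) * w ^ 3 * Z ^ 4 + (-1519693056 - 510910848 * a + 534619008 * a ^ 2 +
    202704768 * a ^ 3 - 43860096 * a ^ 4 - 18966528 * a ^ 5) * w ^ 2 * Z ^ 5 + (-411336576 -
    568205568 * a - 259209216 * a ^ 2 + 7112448 * a ^ 3 + 33586560 * a ^ 4 + 6322176 * a ^ 5) *
    w * Z ^ 6 + (-44481024 - 52440192 * a - 55262592 * a ^ 2 - 29522304 * a ^ 3 - 8184960 * a ^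
    4 - 903168 * a ^ 5) * Z ^ 7) * ha

theorem intCast_add_intCast_mul_ne_zero {R : Type*} [CommRing R] [CharZero R] {a : R}
    (ha : a ^ 2 + a + 2 = 0) {m n : ℤ} (h : m ^ 2 - m * n + 2 * n ^ 2 ≠ 0) :
    (m : R) + n * a ≠ 0 := by
  intro h0
  have : ((m ^ 2 - m * n + 2 * n ^ 2 : ℤ) : R) = 0 := by
    push_cast
    linear_combination ((m : R) - n * (1 + a)) * h0 + (n : R) ^ 2 * ha
  exact h (by exact_mod_cast this)

open IntermediateField in
theorem finrank_le_mul_of_pow_eq_sum {k K : Type*} [Field k] [Field K] [Algebra k K]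
    (N : IntermediateField k K) (t : K) {d n : ℕ} (b : Fin d → K) (hb : ∀ i, b i ∈ N)
    (ht : t ^ d = ∑ i, b i * t ^ (i : ℕ))
    (h : FiniteDimensional ↥(N ⊔ k⟮t⟯) K ∧ Module.finrank ↥(N ⊔ k⟮t⟯) K ≤ n) :
    FiniteDimensional N K ∧ Module.finrank N K ≤ d * n := by
  rw [← restrictScalars_adjoin_eq_sup] at h
  have h1 : FiniteDimensional N⟮t⟯ K := h.1
  have h2 : Module.finrank N⟮t⟯ K ≤ n := h.2
  let P : Polynomial N := Polynomial.X ^ d -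
    ∑ i : Fin d, Polynomial.C (⟨b i, hb i⟩ : N) * Polynomial.X ^ (i : ℕ)
  have hdeg := Polynomial.degree_sum_fin_lt (fun i : Fin d => (⟨b i, hb i⟩ : N))
  have hP : P.Monic := Polynomial.monic_X_pow_sub hdeg
  have hroot : Polynomial.aeval t P = 0 := by
    simp only [P, map_sub, map_pow, Polynomial.aeval_X, map_sum, map_mul, Polynomial.aeval_C, ht,
      sub_eq_zero]
    rfl
  have hint : IsIntegral N t := ⟨P, hP, by simpa [Polynomial.aeval_def] using hroot⟩
  have hnat : P.natDegree ≤ d := by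
    refine Polynomial.natDegree_le_of_degree_le ?_
    refine (Polynomial.degree_sub_le _ _).trans (max_le ?_ hdeg.le)
    simp
  have h3 : Module.finrank N N⟮t⟯ ≤ d := by
    rw [adjoin.finrank hint]
    exact (Polynomial.natDegree_le_natDegree (minpoly.min N t hP hroot)).trans hnat
  have h4 : FiniteDimensional N N⟮t⟯ := adjoin.finiteDimensional hint
  have h5 : Module.Free N N⟮t⟯ := Module.Free.of_divisionRing N N⟮t⟯
  have h6 : Module.Free N⟮t⟯ K := Module.Free.of_divisionRing N⟮t⟯ K
  refine ⟨FiniteDimensional.trans N N⟮t⟯ K, ?_⟩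
  rw [← Module.finrank_mul_finrank N N⟮t⟯ K]
  exact Nat.mul_le_mul h3 h2

theorem finrank_le_one_of_eq_top {k K : Type*} [Field k] [Field K] [Algebra k K]
    {N : IntermediateField k K} (h : N = ⊤) :
    FiniteDimensional N K ∧ Module.finrank N K ≤ 1 := by
  subst h
  have h : Module.finrank (⊤ : IntermediateField k K) K = 1 := IntermediateField.finrank_top
  exact ⟨Module.finite_of_finrank_pos (by omega), h.le⟩

theorem mem_of_mulVec_mem {k K : Type*} [Field k] [Field K] [Algebra k K]
    (E : IntermediateField k K) {n : ℕ} {M : Matrix (Fin n) (Fin n) K} (hM : ∀ i j, M i j ∈ E)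
    (hdet : M.det ≠ 0) {c : Fin n → K} (hc : ∀ i, M.mulVec c i ∈ E) (i : Fin n) : c i ∈ E := by
  let M' : Matrix (Fin n) (Fin n) E := fun i j => ⟨M i j, hM i j⟩
  have hMM : M = (algebraMap E K).mapMatrix M' := rfl
  have hadj : ∀ i j, M.adjugate i j ∈ E := by
    intro i j
    rw [hMM, ← RingHom.map_adjugate]
    exact (M'.adjugate i j).2
  have hd : M.det ∈ E := by
    rw [hMM, ← RingHom.map_det]
    exact M'.det.2
  have h : M.det • c = M.adjugate.mulVec (M.mulVec c) := by
    rw [Matrix.mulVec_mulVec, Matrix.adjugate_mul, Matrix.smul_mulVec, Matrix.one_mulVec]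
  have hi : c i = M.det⁻¹ * (M.adjugate.mulVec (M.mulVec c)) i := by
    rw [← h, Pi.smul_apply, smul_eq_mul, inv_mul_cancel_left₀ hdet]
  rw [hi]
  have : ∑ j, M.adjugate i j * M.mulVec c j ∈ E := E.sum_mem fun j _ => E.mul_mem (hadj i j) (hc j)
  exact E.mul_mem (E.inv_mem hd) this

open scoped IntermediateField.algebraAdjoinAdjoin in
theorem algebraicIndependent_of_finite_over_adjoin {k K : Type*} [Field k] [Field K] [Algebra k K]
    {n : ℕ} {x : Fin n → K} (hx : AlgebraicIndependent k x) (y : Fin n → K)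
    (hy : Algebra.IsAlgebraic (IntermediateField.adjoin k (Set.range y)) K) :
    AlgebraicIndependent k y := by
  have : Algebra.IsAlgebraic (Algebra.adjoin k (Set.range y)) K := by
    refine ⟨fun z => ?_⟩
    have := hy.isAlgebraic z
    exact (IsFractionRing.isAlgebraic_iff (Algebra.adjoin k (Set.range y))
      (IntermediateField.adjoin k (Set.range y)) K).2 this
  exact (Algebra.IsAlgebraic.isTranscendenceBasis_of_lift_le_trdeg_of_finite k y
    hx.lift_cardinalMk_le_trdeg).1

theorem isRationalExtension_of_finrank_le {k K : Type*} [Field k] [Field K] [Algebra k K]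
    {n : ℕ} {x : Fin n → K} (hx : AlgebraicIndependent k x) (y : Fin n → K)
    (F : IntermediateField k K) (hyF : ∀ i, y i ∈ F)
    (hfin : FiniteDimensional (IntermediateField.adjoin k (Set.range y)) K)
    (hle : Module.finrank (IntermediateField.adjoin k (Set.range y)) K ≤ Module.finrank F K) :
    ∃ s : Set K, AlgebraicIndependent k ((↑) : s → K) ∧ IntermediateField.adjoin k s = F := by
  refine ⟨Set.range y, (algebraicIndependent_of_finite_over_adjoin hx y
    inferInstance).to_subtype_range, ?_⟩
  refine IntermediateField.eq_of_le_of_finrank_le' ?_ hle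
  rw [IntermediateField.adjoin_le_iff]
  rintro _ ⟨i, rfl⟩
  exact hyF i

theorem finrank_fixedField_range {k K G : Type*} [Field k] [Field K] [Algebra k K] [Group G]
    [Finite G] (ρ : G →* (K ≃ₐ[k] K)) (hρ : Function.Injective ρ) :
    Module.finrank (IntermediateField.fixedField ρ.range) K = Nat.card G := by
  have : Finite ρ.range := Finite.of_surjective ρ.rangeRestrict ρ.rangeRestrict_surjective
  have := Fintype.ofFinite ρ.range
  rw [Nat.card_congr (MonoidHom.ofInjective hρ).toEquiv, Nat.card_eq_fintype_card]
  exact FixedPoints.finrank_eq_card ρ.range K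

/-- A product decomposition of `G168` along subgroups of orders `7`, `3`, `4` and `2`. -/
def g168Element (c : Fin 7 × Fin 3 × Fin 4 × Fin 2) : Equiv.Perm (Fin 7) :=
  sigma168 ^ (c.1 : ℕ) * (sigma168 * tau168 * sigma168 ^ 3 * tau168) ^ (c.2.1 : ℕ) *
    (tau168 * sigma168 ^ 3 * tau168 * sigma168 ^ 4) ^ (c.2.2.1 : ℕ) * tau168 ^ (c.2.2.2 : ℕ)

theorem g168Element_mem (c : Fin 7 × Fin 3 × Fin 4 × Fin 2) : g168Element c ∈ G168 := by
  have hs : sigma168 ∈ G168 := Subgroup.subset_closure (by simp)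
  have ht : tau168 ∈ G168 := Subgroup.subset_closure (by simp)
  have hp (g) (hg : g ∈ G168) (n : ℕ) : g ^ n ∈ G168 := G168.pow_mem hg n
  exact G168.mul_mem (G168.mul_mem (G168.mul_mem (hp _ hs _)
    (hp _ (G168.mul_mem (G168.mul_mem (G168.mul_mem hs ht) (hp _ hs _)) ht) _))
    (hp _ (G168.mul_mem (G168.mul_mem (G168.mul_mem ht (hp _ hs _)) ht) (hp _ hs _)) _))
    (hp _ ht _)

theorem g168Element_injective : Function.Injective g168Element := by
  have h : Function.Injective fun c => (g168Element c 0, g168Element c 1, g168Element c 2) := by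
    decide +kernel
  intro c d hcd
  exact h (by simp only [hcd])

theorem le_card_G168 : 168 ≤ Nat.card G168 := by
  have h := Nat.card_le_card_of_injective
    (fun c => (⟨g168Element c, g168Element_mem c⟩ : G168))
    fun c d hcd => g168Element_injective (Subtype.ext_iff.1 hcd)
  simpa [Nat.card_eq_fintype_card] using h

/-- Coefficients of the `G168`-equivariant alternating tensor of `kleinTensor`: an entry
`(c, m, n)` stands for the coefficient `m + n * a` at the three-element set with binary code `c`. -/
def kleinTable : Fin 3 → List (ℕ × ℤ × ℤ) :=
  ![[(7, 4, 0), (19, -2, -1), (35, 2, 1), (67, -4, 0), (13, 4, 0), (21, 2, 1), (37, -2, -1), (25,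
      -2, -1), (41, 2, 1), (73, 4, 0), (81, -2, -1), (97, 2, 1), (14, -2, 1), (38, 0, -2), (70,
      -2, 1), (74, -2, 1), (50, 2, 3), (82, 0, -2), (28, 0, -2), (76, -2, 1), (52, -2, -3), (56,
      2, 3), (104, 0, 2), (112, -2, -3)],
    [(7, -2, -1), (19, 4, 0), (35, -4, 0), (67, 2, 1), (13, 2, 1), (21, -2, -1), (37, -2, -1),
      (25, -4, 0), (41, 4, 0), (73, 2, 1), (81, -2, -1), (97, -2, -1), (38, 0, -2), (70, 2, 3),
      (26, 2, -1), (42, -2, 1), (50, -2, 1), (82, 0, -2), (28, 0, 2), (76, -2, -3), (84, 2, 3),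
      (100, 2, 3), (56, 2, -1), (104, 0, -2)],
    [(7, -2, -1), (19, 2, 1), (35, 2, 1), (67, -2, -1), (13, -2, -1), (21, -4, 0), (37, 4, 0),
      (25, -2, -1), (41, -2, -1), (73, 2, 1), (81, -4, 0), (97, 4, 0), (14, 2, 3), (38, 0, -2),
      (26, 2, 3), (42, 2, 3), (74, -2, -3), (82, 0, 2), (28, 0, -2), (52, 2, -1), (84, 2, -1),
      (100, -2, 1), (104, 0, -2), (112, -2, 1)]]

/-- The sign of a sequence of three indices, zero if two of them agree. -/
def tripleSign (i : Fin 3 → Fin 7) : ℤ :=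
  Int.sign ((i 1 : ℤ) - i 0) * Int.sign ((i 2 : ℤ) - i 0) * Int.sign ((i 2 : ℤ) - i 1)

/-- The alternating tensor with values in `ℤ²` described by `kleinTable`. -/
def kleinPair (m : Fin 3) (i : Fin 3 → Fin 7) : ℤ × ℤ :=
  ((kleinTable m).lookup (2 ^ (i 0 : ℕ) + 2 ^ (i 1 : ℕ) + 2 ^ (i 2 : ℕ))).elim 0
    fun c => (tripleSign i * c.1, tripleSign i * c.2)

theorem kleinPair_sigma (i : Fin 3 → Fin 7) :
    (2 * (kleinPair 0 i).1 = -(kleinPair 0 (sigma168 ∘ i)).1 + (kleinPair 1 (sigma168 ∘ i)).1 +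
        2 * (kleinPair 2 (sigma168 ∘ i)).2 ∧
      2 * (kleinPair 0 i).2 = -(kleinPair 0 (sigma168 ∘ i)).2 + (kleinPair 1 (sigma168 ∘ i)).2 -
        (kleinPair 2 (sigma168 ∘ i)).1 + (kleinPair 2 (sigma168 ∘ i)).2) ∧
    (2 * (kleinPair 1 i).1 = (kleinPair 0 (sigma168 ∘ i)).1 + (kleinPair 1 (sigma168 ∘ i)).1 -
        2 * ((kleinPair 0 (sigma168 ∘ i)).2 + (kleinPair 1 (sigma168 ∘ i)).2) ∧
      2 * (kleinPair 1 i).2 = (kleinPair 0 (sigma168 ∘ i)).1 + (kleinPair 1 (sigma168 ∘ i)).1) ∧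
    2 * (kleinPair 2 i).1 = -(kleinPair 0 (sigma168 ∘ i)).1 + (kleinPair 1 (sigma168 ∘ i)).1 -
        2 * (kleinPair 2 (sigma168 ∘ i)).2 ∧
      2 * (kleinPair 2 i).2 = -(kleinPair 0 (sigma168 ∘ i)).2 + (kleinPair 1 (sigma168 ∘ i)).2 +
        (kleinPair 2 (sigma168 ∘ i)).1 - (kleinPair 2 (sigma168 ∘ i)).2 := by
  revert i
  decide +kernel

theorem kleinPair_tau (i : Fin 3 → Fin 7) :
    kleinPair 0 i = -kleinPair 0 (tau168 ∘ i) ∧ kleinPair 1 i = -kleinPair 2 (tau168 ∘ i) ∧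
      kleinPair 2 i = -kleinPair 1 (tau168 ∘ i) := by
  revert i
  decide +kernel

/-- A `G168`-equivariant family of alternating tensors over `K`. -/
def kleinTensor {K : Type*} [Field K] (a : K) (m : Fin 3) (i : Fin 3 → Fin 7) : K :=
  (kleinPair m i).1 + (kleinPair m i).2 * a

theorem kleinTensor_sigma {K : Type*} [Field K] [CharZero K] {a : K} (ha : a ^ 2 + a + 2 = 0)
    (m : Fin 3) (i : Fin 3 → Fin 7) :
    kleinTensor a m i = ∑ n, kleinSigma a m n * kleinTensor a n (sigma168 ∘ i) := by
  obtain ⟨⟨h1, h2⟩, ⟨h3, h4⟩, h5, h6⟩ := kleinPair_sigma i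
  replace h1 := congrArg (Int.cast : ℤ → K) h1
  replace h2 := congrArg (Int.cast : ℤ → K) h2
  replace h3 := congrArg (Int.cast : ℤ → K) h3
  replace h4 := congrArg (Int.cast : ℤ → K) h4
  replace h5 := congrArg (Int.cast : ℤ → K) h5
  replace h6 := congrArg (Int.cast : ℤ → K) h6
  push_cast at h1 h2 h3 h4 h5 h6
  fin_cases m <;> simp only [kleinTensor, Fin.sum_univ_three] <;> simp [kleinSigma]
  · linear_combination h1 / 2 + a * h2 / 2 + (kleinPair 2 (sigma168 ∘ i)).2 / 2 * ha
  · linear_combination h3 / 2 + a * h4 / 2 - ((kleinPair 0 (sigma168 ∘ i)).2 +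
      (kleinPair 1 (sigma168 ∘ i)).2) / 2 * ha
  · linear_combination h5 / 2 + a * h6 / 2 - (kleinPair 2 (sigma168 ∘ i)).2 / 2 * ha

theorem kleinTensor_tau {K : Type*} [Field K] (a : K) (m : Fin 3) (i : Fin 3 → Fin 7) :
    kleinTensor a m i = ∑ n, kleinTau m n * kleinTensor a n (tau168 ∘ i) := by
  obtain ⟨h0, h1, h2⟩ := kleinPair_tau i
  fin_cases m <;> simp [kleinTensor, Fin.sum_univ_three, kleinTau, h0, h1, h2] <;> ring

theorem eq_zero_of_sum_mul_kleinTensor {K : Type*} [Field K] [CharZero K] {a : K}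
    (ha : a ^ 2 + a + 2 = 0) {l : Fin 3 → K} (h : ∀ i, ∑ m, l m * kleinTensor a m i = 0) :
    l = 0 := by
  have h1 := h ![1, 3, 4]
  have h2 := h ![1, 3, 5]
  have h3 := h ![0, 1, 2]
  have e1 : (fun m => kleinPair m ![1, 3, 4]) = ![(0, 0), (2, -1), (2, 3)] := by decide +kernel
  have e2 : (fun m => kleinPair m ![1, 3, 5]) = ![(0, 0), (-2, 1), (2, 3)] := by decide +kernel
  have e3 : (fun m => kleinPair m ![0, 1, 2]) = ![(4, 0), (-2, -1), (-2, -1)] := by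
    decide +kernel
  rw [funext_iff] at e1 e2 e3
  simp [kleinTensor, Fin.sum_univ_three, e1, e2, e3] at h1 h2 h3
  have n1 := intCast_add_intCast_mul_ne_zero ha (m := 4) (n := 6) (by norm_num)
  have n2 := intCast_add_intCast_mul_ne_zero ha (m := 4) (n := -2) (by norm_num)
  push_cast at n1 n2
  have l2 : l 2 = 0 := (mul_eq_zero.1 (by linear_combination h1 + h2 :
    l 2 * (4 + 6 * a) = 0)).resolve_right n1
  have l1 : l 1 = 0 := (mul_eq_zero.1 (by linear_combination h1 - h2 :
    l 1 * (4 + -2 * a) = 0)).resolve_right n2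
  have l0 : l 0 = 0 := by simpa [l1, l2] using h3
  ext m
  fin_cases m <;> assumption

theorem eq_zero_of_forall_sum_mul_monomial_eq_zero {K : Type*} [Field K] {n d : ℕ} {u : Fin n → K}
    (hu : Function.Injective u) {T : (Fin d → Fin n) → K}
    (h : ∀ e : Fin d → Fin n, ∑ i, T i * ∏ b, u (i b) ^ (e b : ℕ) = 0) : T = 0 := by
  induction d with
  | zero => exact funext fun i => by simpa [Subsingleton.elim i default] using h default
  | succ d ih =>
    have h' (e : Fin d → Fin n) (e₀ : Fin n) :
        ∑ i₀, (∑ i, T (Fin.cons i₀ i) * ∏ b, u (i b) ^ (e b : ℕ)) * u i₀ ^ (e₀ : ℕ) = 0 := by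
      rw [← h (Fin.cons e₀ e), ← (Fin.consEquiv fun _ => Fin n).sum_comp, Fintype.sum_prod_type]
      refine Finset.sum_congr rfl fun i₀ _ => ?_
      rw [Finset.sum_mul]
      refine Finset.sum_congr rfl fun i _ => ?_
      simp [Fin.consEquiv, Fin.prod_univ_succ]
      ring
    have h₀ (i₀ : Fin n) : (fun i => T (Fin.cons i₀ i)) = 0 := ih fun e =>
      congrFun (Matrix.eq_zero_of_forall_pow_sum_mul_pow_eq_zero hu (h' e)) i₀
    ext i
    rw [← Fin.cons_self_tail i]
    exact congrFun (h₀ _) _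

/-- The covector in Klein's representation obtained from seven elements permuted by `G168`, by
contracting `kleinTensor` with the powers prescribed by `e`. -/
def kleinVector {K : Type*} [Field K] (a : K) (u : Fin 7 → K) (e : Fin 3 → Fin 7) (m : Fin 3) : K :=
  ∑ i, kleinTensor a m i * ∏ b, u (i b) ^ (e b : ℕ)

theorem map_kleinVector {k K : Type*} [Field k] [Field K] [Algebra k K] (φ : K ≃ₐ[k] K) {a : k}
    {u : Fin 7 → K} {g : Equiv.Perm (Fin 7)} (hu : ∀ i, φ (u i) = u (g i))
    {M : Matrix (Fin 3) (Fin 3) K}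
    (hM : ∀ m i, kleinTensor (algebraMap k K a) m i =
      ∑ n, M m n * kleinTensor (algebraMap k K a) n (g ∘ i))
    (e : Fin 3 → Fin 7) (m : Fin 3) :
    φ (kleinVector (algebraMap k K a) u e m) =
      ∑ n, M m n * kleinVector (algebraMap k K a) u e n := by
  have hφ (m i) : φ (kleinTensor (algebraMap k K a) m i) = kleinTensor (algebraMap k K a) m i := by
    simp [kleinTensor]
  simp only [kleinVector, map_sum, map_mul, map_prod, map_pow, hu, hφ, Finset.mul_sum]
  rw [Finset.sum_comm, ← (Equiv.arrowCongr (Equiv.refl (Fin 3)) g).sum_comp (fun i => ∑ n, _)]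
  refine Finset.sum_congr rfl fun i _ => ?_
  rw [hM, Finset.sum_mul]
  refine Finset.sum_congr rfl fun n _ => ?_
  rw [mul_assoc]
  rfl

theorem exists_det_kleinVector_ne_zero {K : Type*} [Field K] [CharZero K] {a : K}
    (ha : a ^ 2 + a + 2 = 0) {u : Fin 7 → K} (hu : Function.Injective u) :
    ∃ e : Fin 3 → Fin 3 → Fin 7,
      (Matrix.of fun m n => kleinVector a u (e n) m).det ≠ 0 := by
  have hspan : Submodule.span K (Set.range (kleinVector a u)) = ⊤ := by
    by_contra hne
    obtain ⟨f, hf, hle⟩ := Submodule.exists_le_ker_of_lt_top _ (lt_top_iff_ne_top.2 hne)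
    refine hf (LinearMap.pi_ext' fun m => LinearMap.ext_ring ?_)
    have hf' (w : Fin 3 → K) : f w = ∑ m, w m * f (Pi.single m 1) := by
      conv_lhs => rw [← Finset.univ_sum_single w]
      rw [map_sum]
      refine Finset.sum_congr rfl fun m _ => ?_
      rw [← smul_eq_mul, ← map_smul, ← Pi.single_smul, smul_eq_mul, mul_one]
    have hl : (fun m => f (Pi.single m 1)) = 0 := by
      refine eq_zero_of_sum_mul_kleinTensor ha (congrFun
        (eq_zero_of_forall_sum_mul_monomial_eq_zero hu fun e => ?_))
      have := hle (Submodule.subset_span ⟨e, rfl⟩)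
      rw [LinearMap.mem_ker, hf'] at this
      rw [← this]
      simp only [kleinVector, Finset.sum_mul]
      rw [Finset.sum_comm]
      exact Finset.sum_congr rfl fun _ _ => Finset.sum_congr rfl fun _ _ => by ring
    exact congrFun hl m
  obtain ⟨f, hf, -, hli⟩ := Submodule.exists_fun_fin_finrank_span_eq K (Set.range (kleinVector a u))
  have hr : Module.finrank K (Submodule.span K (Set.range (kleinVector a u))) = 3 := by
    rw [hspan, finrank_top, Module.finrank_fin_fun]
  choose e he using hf
  refine ⟨e ∘ Fin.cast hr.symm, ?_⟩
  have hli' : LinearIndependent K (Matrix.of fun m n =>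
      kleinVector a u ((e ∘ Fin.cast hr.symm) n) m).col := by
    have hcol : (Matrix.of fun m n => kleinVector a u ((e ∘ Fin.cast hr.symm) n) m).col =
        f ∘ Fin.cast hr.symm := funext fun n => he _
    rw [hcol]
    exact hli.comp _ (Fin.cast_injective hr.symm)
  rw [Matrix.linearIndependent_cols_iff_isUnit, Matrix.isUnit_iff_isUnit_det] at hli'
  exact hli'.ne_zero

theorem aeval_ne_zero_of_eval_ne_zero {k K ι : Type*} [Field k] [Field K] [Algebra k K] {x : ι → K}
    (hx : AlgebraicIndependent k x) (P : MvPolynomial ι k) (pt : ι → k)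
    (h : MvPolynomial.eval pt P ≠ 0) : MvPolynomial.aeval x P ≠ 0 := by
  intro h0
  have h1 : P = 0 := hx (h0.trans (map_zero _).symm)
  simp [h1] at h

/-- The deviations of `x` from its average. -/
def centered {K : Type*} [Field K] (x : Fin 7 → K) (i : Fin 7) : K := x i - (∑ j, x j) / 7

theorem sum_centered {K : Type*} [Field K] [CharZero K] (x : Fin 7 → K) :
    ∑ i, centered x i = 0 := by
  simp only [centered, Finset.sum_sub_distrib, Finset.sum_const, Finset.card_univ,
    Fintype.card_fin]
  simp
  ring

theorem map_sum_pow {k K : Type*} [Field k] [Field K] [Algebra k K] (φ : K ≃ₐ[k] K) {x : Fin 7 → K}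
    {g : Equiv.Perm (Fin 7)} (hx : ∀ i, φ (x i) = x (g i)) (d : ℕ) :
    φ (∑ i, x i ^ d) = ∑ i, x i ^ d := by
  simp only [map_sum, map_pow, hx]
  exact Equiv.sum_comp g fun i => x i ^ d

theorem map_centered {k K : Type*} [Field k] [Field K] [Algebra k K] (φ : K ≃ₐ[k] K) {x : Fin 7 → K}
    {g : Equiv.Perm (Fin 7)} (hx : ∀ i, φ (x i) = x (g i)) (i : Fin 7) :
    φ (centered x i) = centered x (g i) := by
  have h := map_sum_pow φ hx 1
  simp only [pow_one] at h
  rw [centered, map_sub, map_div₀, h, hx, map_ofNat, centered]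

/-- The power sum of degree `d` of the deviations from the average is nonzero; it is
specialized at `(7, 0, …, 0)`. -/
theorem sum_centered_pow_ne_zero {k K : Type*} [Field k] [CharZero k] [Field K] [Algebra k K]
    {x : Fin 7 → K} (hx : AlgebraicIndependent k x) {d : ℕ} (hd : (6 : ℤ) ^ d + 6 * (-1) ^ d ≠ 0) :
    ∑ i, centered x i ^ d ≠ 0 := by
  have := aeval_ne_zero_of_eval_ne_zero hx
    (∑ i, (MvPolynomial.X i - MvPolynomial.C (1 / 7) * ∑ j, MvPolynomial.X j) ^ d)
    ![7, 0, 0, 0, 0, 0, 0] (by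
      simp [Fin.sum_univ_seven]
      norm_num
      intro h
      apply hd
      have h' : (((6 : ℤ) ^ d + 6 * (-1) ^ d : ℤ) : k) = 0 := by
        push_cast
        rw [← h]
        ring
      exact_mod_cast h')
  convert this using 1
  simp only [centered, map_sum, map_pow, map_sub, map_mul, MvPolynomial.aeval_X,
    MvPolynomial.aeval_C, map_div₀, map_one, map_ofNat]
  exact Finset.sum_congr rfl fun i _ => by ring

theorem centered_ne_zero {k K : Type*} [Field k] [CharZero k] [Field K] [Algebra k K]
    {x : Fin 7 → K} (hx : AlgebraicIndependent k x) : centered x 0 ≠ 0 := by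
  have := aeval_ne_zero_of_eval_ne_zero hx
    (MvPolynomial.X 0 - MvPolynomial.C (1 / 7) * ∑ j, MvPolynomial.X j)
    ![7, 0, 0, 0, 0, 0, 0] (by simp [Fin.sum_univ_seven]; norm_num)
  convert this using 1
  simp only [centered, map_sum, map_sub, map_mul, MvPolynomial.aeval_X,
    MvPolynomial.aeval_C, map_div₀, map_one, map_ofNat]
  ring

theorem eq_top_of_range_subset {k K ι : Type*} [Field k] [Field K] [Algebra k K] {x : ι → K}
    (hgen : IntermediateField.adjoin k (Set.range x) = ⊤) {E : IntermediateField k K}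
    (h : ∀ i, x i ∈ E) : E = ⊤ := by
  rw [eq_top_iff, ← hgen, IntermediateField.adjoin_le_iff]
  rintro _ ⟨i, rfl⟩
  exact h i

theorem exists_kleinVector_generating {k K : Type*} [Field k] [CharZero k] [Field K] [Algebra k K]
    {a : k} (ha : a ^ 2 + a + 2 = 0) {x : Fin 7 → K} (hx : AlgebraicIndependent k x)
    (hgen : IntermediateField.adjoin k (Set.range x) = ⊤) :
    ∃ v : Fin 3 → K, (∃ j, v j ≠ 0) ∧
      (∀ (φ : K ≃ₐ[k] K) (g : Equiv.Perm (Fin 7)) (M : Matrix (Fin 3) (Fin 3) K),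
        (∀ i, φ (x i) = x (g i)) →
        (∀ m i, kleinTensor (algebraMap k K a) m i =
          ∑ n, M m n * kleinTensor (algebraMap k K a) n (g ∘ i)) →
        ∀ m, φ (v m) = M.mulVec v m) ∧
      ∀ (E : IntermediateField k K) (j : Fin 3), v j ≠ 0 → (∀ i, v i / v j ∈ E) →
        (∀ i, centered x i / centered x 0 ∈ E) → E = ⊤ := by
  have : CharZero K := charZero_of_injective_algebraMap (algebraMap k K).injective
  have ha' : algebraMap k K a ^ 2 + algebraMap k K a + 2 = 0 := by
    simpa [map_ofNat] using congrArg (algebraMap k K) ha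
  have hp2 : ∑ i, centered x i ^ 2 ≠ 0 := sum_centered_pow_ne_zero hx (by norm_num)
  have hp3 : ∑ i, centered x i ^ 3 ≠ 0 := sum_centered_pow_ne_zero hx (by norm_num)
  have hc0 : centered x 0 ≠ 0 := centered_ne_zero hx
  set t : K := (∑ i, centered x i ^ 3) / ∑ i, centered x i ^ 2 with ht
  have ht0 : t ≠ 0 := div_ne_zero hp3 hp2
  set u : Fin 7 → K := fun i => centered x i / t with hu
  have huinj : Function.Injective u := by
    intro i j hij
    refine hx.injective ?_
    simpa [hu, centered, div_left_inj' ht0] using hij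
  obtain ⟨e, he⟩ := exists_det_kleinVector_ne_zero ha' huinj
  set M := Matrix.of fun m n => kleinVector (algebraMap k K a) u (e n) m with hM
  set b : Fin 3 → K := ![∑ i, x i, t, 1] with hb
  refine ⟨M.mulVec b, ?_, fun φ g R hφ hR m => ?_, fun E j hj hE hcE => ?_⟩
  · by_contra! h
    have := congrFun (Matrix.eq_zero_of_mulVec_eq_zero he (funext h)) 2
    simp [hb] at this
  · have hφc := map_centered φ hφ
    have hφs : φ (∑ i, x i) = ∑ i, x i := by simpa using map_sum_pow φ hφ 1
    have hφt : φ t = t := by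
      rw [ht, map_div₀, map_sum_pow φ hφc, map_sum_pow φ hφc]
    have hφu (i) : φ (u i) = u (g i) := by
      simp only [hu, map_div₀, hφt, hφc]
    have hφb (n) : φ (b n) = b n := by
      fin_cases n
      · exact hφs
      · exact hφt
      · exact map_one φ
    have hφM (m n) : φ (M m n) = ∑ l, R m l * M l n := map_kleinVector φ hφu hR (e n) m
    rw [Matrix.mulVec_mulVec]
    simp only [Matrix.mulVec, dotProduct, map_sum, map_mul, hφb, hφM]
    rfl
  · have huE (i) : u i ∈ E := by
      have h : u i = centered x i / centered x 0 *
          ((∑ j, (centered x j / centered x 0) ^ 2) / ∑ j, (centered x j / centered x 0) ^ 3) := by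
        simp only [div_pow, ← Finset.sum_div, hu, ht]
        field_simp
      rw [h]
      exact E.mul_mem (hcE i) (E.div_mem (E.sum_mem fun j _ => pow_mem (hcE j) 2)
        (E.sum_mem fun j _ => pow_mem (hcE j) 3))
    have hME (m n) : M m n ∈ E := by
      rw [hM, Matrix.of_apply, kleinVector]
      refine E.sum_mem fun i _ => E.mul_mem ?_ (E.prod_mem fun b _ => pow_mem (huE _) _)
      exact E.add_mem (E.intCast_mem _) (E.mul_mem (E.intCast_mem _) (E.algebraMap_mem a))
    have hbE := mem_of_mulVec_mem E hME he (c := (M.mulVec b j)⁻¹ • b) fun i => by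
      rw [Matrix.mulVec_smul, Pi.smul_apply, smul_eq_mul, inv_mul_eq_div]
      exact hE i
    have hinv : (M.mulVec b j)⁻¹ ∈ E := by simpa [hb] using hbE 2
    have hbE' (i) : b i ∈ E := by
      have := E.mul_mem (E.inv_mem hinv) (hbE i)
      rwa [Pi.smul_apply, smul_eq_mul, inv_inv, mul_inv_cancel_left₀ hj] at this
    refine eq_top_of_range_subset hgen fun i => ?_
    have hi : x i = u i * t + (∑ j, x j) / 7 := by
      simp only [hu]
      rw [div_mul_cancel₀ _ ht0, centered]
      ring
    rw [hi]
    exact E.add_mem (E.mul_mem (huE i) (hbE' 1)) (E.div_mem (hbE' 0) (ofNat_mem E 7))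

/-- Affine coordinates built from a vector with three and a vector with seven entries. -/
def ratioCoords {K : Type*} [Field K] (v : Fin 3 → K) (c : Fin 7 → K) (j : Fin 3) : Fin 7 → K :=
  ![v (j + 1) / v j, v (j + 2) / v j, c 1 / c 0, c 2 / c 0, c 3 / c 0, c 4 / c 0, c 5 / c 0]

theorem algebraicIndependent_ratioCoords {k K : Type*} [Field k] [Field K]
    [Algebra k K] {x : Fin 7 → K} (hx : AlgebraicIndependent k x) {v : Fin 3 → K} {c : Fin 7 → K}
    (hc : ∑ i, c i = 0) (hc0 : c 0 ≠ 0) {j : Fin 3} (hj : v j ≠ 0)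
    (hgen : ∀ (E : IntermediateField k K), (∀ i, v i / v j ∈ E) → (∀ i, c i / c 0 ∈ E) → E = ⊤) :
    AlgebraicIndependent k (ratioCoords v c j) := by
  refine algebraicIndependent_of_finite_over_adjoin hx _ ?_
  have hmem (i) : ratioCoords v c j i ∈ IntermediateField.adjoin k (Set.range (ratioCoords v c j)) :=
    IntermediateField.subset_adjoin _ _ ⟨i, rfl⟩
  have htop : IntermediateField.adjoin k (Set.range (ratioCoords v c j)) = ⊤ := by
    refine hgen _ (fun i => ?_) fun i => ?_
    · obtain rfl | rfl | rfl : i = j ∨ i = j + 1 ∨ i = j + 2 := by omega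
      · rw [div_self hj]
        exact one_mem _
      · exact hmem 0
      · exact hmem 1
    · have h6 : c 6 / c 0 = -1 - ∑ i : Fin 5, ratioCoords v c j (i.natAdd 2) := by
        simp only [Fin.sum_univ_seven] at hc
        simp [Fin.sum_univ_five, ratioCoords]
        field_simp
        linear_combination hc
      fin_cases i
      · simp [div_self hc0, one_mem]
      · exact hmem 2
      · exact hmem 3
      · exact hmem 4
      · exact hmem 5
      · exact hmem 6
      · refine h6 ▸ ?_
        exact sub_mem (neg_mem (one_mem _)) (sum_mem fun i _ => hmem _)
  rw [htop]
  have := (finrank_le_one_of_eq_top (k := k) (K := K) rfl).1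
  infer_instance

theorem forall_ne_zero_of_algebraicIndependent_ratioCoords {k K : Type*} [Field k] [Field K]
    [Algebra k K] {v : Fin 3 → K} {c : Fin 7 → K} {j : Fin 3} (hj : v j ≠ 0)
    (h : AlgebraicIndependent k (ratioCoords v c j)) (i : Fin 3) : v i ≠ 0 := by
  obtain rfl | rfl | rfl : i = j ∨ i = j + 1 ∨ i = j + 2 := by omega
  · exact hj
  · exact (div_ne_zero_iff.1 (h.ne_zero 0 : v (j + 1) / v j ≠ 0)).1
  · exact (div_ne_zero_iff.1 (h.ne_zero 1 : v (j + 2) / v j ≠ 0)).1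

theorem kleinFrame_two_three_one {R : Type*} [CommRing R] (a : R) (i : Fin 7) :
    kleinFrame a ![2, 3, 1] i =
      ((![56, -27, -43, 45, 12, -24, -19] i : ℤ) : R) +
        ((![0, 23, -9, -1, -4, 8, -17] i : ℤ) : R) * a := by
  fin_cases i <;> simp [kleinFrame] <;> ring

/-- The vector of the first two variables and `1`. -/
noncomputable def affineVector (k : Type*) [Field k] : Fin 3 → MvPolynomial (Fin 7) k :=
  ![MvPolynomial.X 0, MvPolynomial.X 1, 1]

theorem eval_affineVector {k : Type*} [Field k] :
    (fun j => MvPolynomial.eval ![2, 3, 0, 0, 0, 0, 0] (affineVector k j)) = ![2, 3, 1] := by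
  ext j
  fin_cases j <;> simp [affineVector]

theorem aeval_affineVector {k K : Type*} [Field k] [Field K] [Algebra k K] {v : Fin 3 → K}
    (c : Fin 7 → K) (hv : v 2 ≠ 0) :
    (fun j => (MvPolynomial.aeval (ratioCoords v c 2)).toRingHom (affineVector k j)) =
      fun j => (v 2)⁻¹ * v j := by
  ext j
  fin_cases j
  · simp [affineVector, ratioCoords, div_eq_inv_mul]
  · simp [affineVector, ratioCoords, div_eq_inv_mul]
  · simp [affineVector, hv]

theorem aeval_kleinFrame_affineVector {k K : Type*} [Field k] [Field K] [Algebra k K] (a : k)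
    {v : Fin 3 → K} (c : Fin 7 → K) (hv : v 2 ≠ 0) (i : Fin 7) :
    MvPolynomial.aeval (ratioCoords v c 2) (kleinFrame (MvPolynomial.C a) (affineVector k) i) =
      (v 2)⁻¹ ^ 2 * kleinFrame (algebraMap k K a) v i := by
  rw [← kleinFrame_smul, ← aeval_affineVector (k := k) c hv,
    ← MvPolynomial.aeval_C (R := k) (ratioCoords v c 2) a]
  exact map_kleinFrame (MvPolynomial.aeval (R := k) (ratioCoords v c 2)).toRingHom _ _ _

theorem kleinFrame_injective {k K : Type*} [Field k] [CharZero k] [Field K] [Algebra k K]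
    {a : k} (ha : a ^ 2 + a + 2 = 0) {v : Fin 3 → K} {c : Fin 7 → K} (hv : v 2 ≠ 0)
    (h : AlgebraicIndependent k (ratioCoords v c 2)) :
    Function.Injective (kleinFrame (algebraMap k K a) v) := by
  intro i j hij
  by_contra hne
  refine aeval_ne_zero_of_eval_ne_zero h (kleinFrame (MvPolynomial.C a) (affineVector k) i -
    kleinFrame (MvPolynomial.C a) (affineVector k) j) ![2, 3, 0, 0, 0, 0, 0] ?_ ?_
  · have hn : ∀ i j : Fin 7, i ≠ j →
      (![56, -27, -43, 45, 12, -24, -19] i - ![56, -27, -43, 45, 12, -24, -19] j : ℤ) ^ 2 -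
      (![56, -27, -43, 45, 12, -24, -19] i - ![56, -27, -43, 45, 12, -24, -19] j) *
      (![0, 23, -9, -1, -4, 8, -17] i - ![0, 23, -9, -1, -4, 8, -17] j) +
      2 * (![0, 23, -9, -1, -4, 8, -17] i - ![0, 23, -9, -1, -4, 8, -17] j) ^ 2 ≠ 0 := by
      decide +kernel
    have := intCast_add_intCast_mul_ne_zero ha (hn i j hne)
    rw [map_sub, map_kleinFrame, map_kleinFrame, eval_affineVector, MvPolynomial.eval_C,
      kleinFrame_two_three_one, kleinFrame_two_three_one]
    push_cast at this
    convert this using 1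
    ring
  · have e := aeval_kleinFrame_affineVector (k := k) a c hv
    rw [map_sub, e, e, hij, sub_self]

theorem kleinQuartic_ne_zero {k K : Type*} [Field k] [CharZero k] [Field K] [Algebra k K]
    {a : k} (ha : a ^ 2 + a + 2 = 0) {v : Fin 3 → K} {c : Fin 7 → K} (hv : v 2 ≠ 0)
    (h : AlgebraicIndependent k (ratioCoords v c 2)) :
    kleinQuartic (algebraMap k K a) v ≠ 0 := by
  intro h0
  refine aeval_ne_zero_of_eval_ne_zero h (kleinQuartic (MvPolynomial.C a) (affineVector k))
    ![2, 3, 0, 0, 0, 0, 0] ?_ ?_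
  · rw [map_kleinQuartic, eval_affineVector, MvPolynomial.eval_C, kleinQuartic_eq ha]
    have := intCast_add_intCast_mul_ne_zero ha (m := 6860) (n := -1372) (by norm_num)
    convert this using 1
    simp
    ring
  · have e := map_kleinQuartic (MvPolynomial.aeval (ratioCoords v c 2)).toRingHom
      (MvPolynomial.C a) (affineVector k)
    rw [aeval_affineVector c hv] at e
    simp only [AlgHom.toRingHom_eq_coe, RingHom.coe_coe, MvPolynomial.aeval_C] at e
    simp only [kleinQuartic, kleinFrame_smul, mul_pow, ← Finset.mul_sum] at e h0 ⊢
    rw [e, h0, mul_zero]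

theorem kleinSextic_ne_zero {k K : Type*} [Field k] [CharZero k] [Field K] [Algebra k K]
    {a : k} (ha : a ^ 2 + a + 2 = 0) {v : Fin 3 → K} {c : Fin 7 → K} (hv : v 2 ≠ 0)
    (h : AlgebraicIndependent k (ratioCoords v c 2)) :
    kleinSextic (algebraMap k K a) v ≠ 0 := by
  intro h0
  refine aeval_ne_zero_of_eval_ne_zero h (kleinSextic (MvPolynomial.C a) (affineVector k))
    ![2, 3, 0, 0, 0, 0, 0] ?_ ?_
  · rw [map_kleinSextic, eval_affineVector, MvPolynomial.eval_C, kleinSextic_eq ha]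
    have := intCast_add_intCast_mul_ne_zero ha (m := 309876) (n := 54684) (by norm_num)
    convert this using 1
    simp
    ring
  · have e := map_kleinSextic (MvPolynomial.aeval (ratioCoords v c 2)).toRingHom
      (MvPolynomial.C a) (affineVector k)
    rw [aeval_affineVector c hv] at e
    simp only [AlgHom.toRingHom_eq_coe, RingHom.coe_coe, MvPolynomial.aeval_C] at e
    simp only [kleinSextic, kleinFrame_smul, mul_pow, ← Finset.mul_sum] at e h0 ⊢
    rw [e, h0, mul_zero]

theorem sum_kleinFrame_mul_ne_zero {k K : Type*} [Field k] [CharZero k] [Field K] [Algebra k K]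
    {a : k} (ha : a ^ 2 + a + 2 = 0) {v : Fin 3 → K} {c : Fin 7 → K} (hv : v 2 ≠ 0)
    (h : AlgebraicIndependent k (ratioCoords v c 2))
    (hc : ∑ i, c i = 0) (hc0 : c 0 ≠ 0) :
    ∑ i, kleinFrame (algebraMap k K a) v i * c i ≠ 0 := by
  intro h0
  let W : Fin 7 → MvPolynomial (Fin 7) k := ![1, .X 2, .X 3, .X 4, .X 5, .X 6,
    -(1 + .X 2 + .X 3 + .X 4 + .X 5 + .X 6)]
  refine aeval_ne_zero_of_eval_ne_zero h
    (∑ i, kleinFrame (MvPolynomial.C a) (affineVector k) i * W i)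
    ![2, 3, 0, 0, 0, 0, 0] ?_ ?_
  · have := intCast_add_intCast_mul_ne_zero ha (m := 75) (n := 17) (by norm_num)
    convert this using 1
    simp only [map_sum, map_mul, map_kleinFrame, eval_affineVector, MvPolynomial.eval_C,
      kleinFrame_two_three_one]
    simp [Fin.sum_univ_seven, W]
    ring
  · have e := aeval_kleinFrame_affineVector (k := k) a c hv
    have eW (i) : MvPolynomial.aeval (ratioCoords v c 2) (W i) = (c 0)⁻¹ * c i := by
      fin_cases i <;> simp [W, ratioCoords, div_eq_inv_mul, hc0]
      simp only [Fin.sum_univ_seven] at hc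
      field_simp
      linear_combination -hc
    simp only [map_sum, map_mul, e, eW, mul_mul_mul_comm, ← Finset.mul_sum, h0, mul_zero]

/-- The Klein frame, scaled to be homogeneous of degree zero in `v`. -/
def scaledFrame {K : Type*} [Field K] (a : K) (v : Fin 3 → K) (i : Fin 7) : K :=
  kleinFrame a v i * (kleinQuartic a v / kleinSextic a v)

/-- The basic invariant of degree zero in Klein's representation. -/
def kleinRatio {K : Type*} [Field K] (a : K) (v : Fin 3 → K) : K :=
  kleinQuartic a v ^ 3 / kleinSextic a v ^ 2

/-- The power moments of `c` with respect to the scaled Klein frame. -/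
def frameMoment {K : Type*} [Field K] (a : K) (v : Fin 3 → K) (c : Fin 7 → K) (d : ℕ) : K :=
  ∑ i, scaledFrame a v i ^ d * c i

/-- Generators of the field of `G168`-invariants. -/
def kleinGenerators {K : Type*} [Field K] (a : K) (v : Fin 3 → K) (c : Fin 7 → K) : Fin 7 → K :=
  ![kleinRatio a v, frameValue a (kleinRatio a v) (kleinRatio a v) (scaledFrame a v 0),
    frameMoment a v c 2 / frameMoment a v c 1, frameMoment a v c 3 / frameMoment a v c 1,
    frameMoment a v c 4 / frameMoment a v c 1, frameMoment a v c 5 / frameMoment a v c 1,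
    frameMoment a v c 6 / frameMoment a v c 1]

theorem frameValue_mul {R : Type*} [CommRing R] (a p q T s : R) :
    frameValue a (p * s ^ 2) (q * s ^ 3) (T * s) = frameValue a p q T * s ^ 7 := by
  simp only [frameValue]
  ring

theorem frameValue_kleinRatio_scaledFrame_one {K : Type*} [Field K] {a : K}
    (ha : a ^ 2 + a + 2 = 0) {v : Fin 3 → K} (h6 : kleinSextic a v ≠ 0) :
    frameValue a (kleinRatio a v) (kleinRatio a v) (scaledFrame a v 1) =
      frameValue a (kleinRatio a v) (kleinRatio a v) (scaledFrame a v 0) := by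
  have e4 : kleinRatio a v =
      kleinQuartic a v * (kleinQuartic a v / kleinSextic a v) ^ 2 := by
    rw [kleinRatio]
    field_simp
  have e6 : kleinRatio a v = kleinSextic a v * (kleinQuartic a v / kleinSextic a v) ^ 3 := by
    rw [kleinRatio]
    field_simp
  have e (T) : frameValue a (kleinRatio a v) (kleinRatio a v) T = frameValue a
      (kleinQuartic a v * (kleinQuartic a v / kleinSextic a v) ^ 2)
      (kleinSextic a v * (kleinQuartic a v / kleinSextic a v) ^ 3) T := by
    rw [← e4, ← e6]
  rw [e, e, scaledFrame, scaledFrame, frameValue_mul, frameValue_mul, frameValue_kleinFrame_one ha]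

theorem map_kleinGenerators {k K : Type*} [Field k] [Field K] [Algebra k K] (φ : K ≃ₐ[k] K) {a : k}
    (ha : a ^ 2 + a + 2 = 0) {v : Fin 3 → K} {c : Fin 7 → K}
    (h6 : kleinSextic (algebraMap k K a) v ≠ 0) {g : Equiv.Perm (Fin 7)} (hg : g 0 = 0 ∨ g 0 = 1)
    (hφc : ∀ i, φ (c i) = c (g i))
    (hφ : ∀ i, kleinFrame (algebraMap k K a) (fun j => φ (v j)) i =
      kleinFrame (algebraMap k K a) v (g i)) (i : Fin 7) :
    φ (kleinGenerators (algebraMap k K a) v c i) = kleinGenerators (algebraMap k K a) v c i := by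
  have ha' : algebraMap k K a ^ 2 + algebraMap k K a + 2 = 0 := by
    simpa [map_ofNat] using congrArg (algebraMap k K) ha
  have hφa : φ (algebraMap k K a) = algebraMap k K a := φ.commutes a
  set α := algebraMap k K a
  have hq (i) : φ (kleinFrame α v i) = kleinFrame α v (g i) := by
    rw [← hφ]
    exact (map_kleinFrame (φ : K →+* K) α v i).trans (by rw [RingHom.coe_coe, hφa])
  have h4 : φ (kleinQuartic α v) = kleinQuartic α v := by
    simp only [kleinQuartic, map_sum, map_pow, hq]
    exact Equiv.sum_comp g fun i => kleinFrame α v i ^ 2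
  have h6' : φ (kleinSextic α v) = kleinSextic α v := by
    simp only [kleinSextic, map_sum, map_pow, hq]
    exact Equiv.sum_comp g fun i => kleinFrame α v i ^ 3
  have hθ (i) : φ (scaledFrame α v i) = scaledFrame α v (g i) := by
    simp only [scaledFrame, map_mul, map_div₀, h4, h6', hq]
  have hr : φ (kleinRatio α v) = kleinRatio α v := by
    simp only [kleinRatio, map_div₀, map_pow, h4, h6']
  have hz (d) : φ (frameMoment α v c d) = frameMoment α v c d := by
    simp only [frameMoment, map_sum, map_mul, map_pow, hθ, hφc]
    exact Equiv.sum_comp g fun i => scaledFrame α v i ^ d * c i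
  have hf (T) : φ (frameValue α (kleinRatio α v) (kleinRatio α v) T) =
      frameValue α (kleinRatio α v) (kleinRatio α v) (φ T) := by
    simp only [frameValue, map_add, map_sub, map_mul, map_pow, map_ofNat, hr, hφa]
  have hf0 : φ (frameValue α (kleinRatio α v) (kleinRatio α v) (scaledFrame α v 0)) =
      frameValue α (kleinRatio α v) (kleinRatio α v) (scaledFrame α v 0) := by
    rw [hf, hθ]
    obtain h | h := hg
    · rw [h]
    · rw [h, frameValue_kleinRatio_scaledFrame_one ha' h6]
  fin_cases i <;> simp only [kleinGenerators]
  · exact hr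
  · exact hf0
  all_goals exact (map_div₀ φ _ _).trans (by rw [hz, hz]; rfl)

theorem kleinFrame_mem {k K : Type*} [Field k] [Field K] [Algebra k K] (E : IntermediateField k K)
    (a : k) {v : Fin 3 → K} (hv : ∀ j, v j ∈ E) (i : Fin 7) :
    kleinFrame (algebraMap k K a) v i ∈ E := by
  have := map_kleinFrame E.val.toRingHom (algebraMap k E a) (fun j => ⟨v j, hv j⟩) i
  have h : kleinFrame (algebraMap k K a) v i =
      E.val (kleinFrame (algebraMap k E a) (fun j => ⟨v j, hv j⟩) i) := this.symm
  rw [h]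
  exact Subtype.property _

/-- An intermediate field containing the Klein generators and the coordinates of the point of the
plane defined by `v`, together with one scaled square, is `⊤`. -/
theorem eq_top_of_kleinGenerators_mem {k K : Type*} [Field k] [Field K] [Algebra k K]
    {a : k} {v : Fin 3 → K} {c : Fin 7 → K} (hv : ∀ j, v j ≠ 0) (hc : ∑ i, c i = 0)
    (h4 : kleinQuartic (algebraMap k K a) v ≠ 0)
    (h6 : kleinSextic (algebraMap k K a) v ≠ 0)
    (hinj : Function.Injective (kleinFrame (algebraMap k K a) v))
    (hz : frameMoment (algebraMap k K a) v c 1 ≠ 0)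
    (hgen : ∀ (E : IntermediateField k K), (∀ i, v i / v 2 ∈ E) → (∀ i, c i / c 0 ∈ E) → E = ⊤)
    (E : IntermediateField k K) (hE : ∀ i, kleinGenerators (algebraMap k K a) v c i ∈ E)
    (hZ : v 2 ^ 2 * (kleinQuartic (algebraMap k K a) v / kleinSextic (algebraMap k K a) v) ∈ E)
    (hr : ∀ j, v j / v 2 ∈ E) : E = ⊤ := by
  refine hgen E hr fun i => ?_
  set α := algebraMap k K a
  have hθ (i) : scaledFrame α v i ∈ E := by
    have e : scaledFrame α v i = kleinFrame α (fun j => (v 2)⁻¹ * v j) i *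
        (v 2 ^ 2 * (kleinQuartic α v / kleinSextic α v)) := by
      rw [kleinFrame_smul, scaledFrame]
      have := hv 2
      field_simp
    rw [e]
    exact E.mul_mem (kleinFrame_mem E a (fun j => by simpa only [inv_mul_eq_div] using hr j) i) hZ
  have hθinj : Function.Injective (scaledFrame α v) := fun i j hij =>
    hinj (mul_right_cancel₀ (div_ne_zero h4 h6) hij)
  have hdet : (Matrix.vandermonde (scaledFrame α v)).transpose.det ≠ 0 := by
    rw [Matrix.det_transpose]
    exact Matrix.det_vandermonde_ne_zero_iff.2 hθinj
  have hmem := mem_of_mulVec_mem E (M := (Matrix.vandermonde (scaledFrame α v)).transpose)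
    (fun d i => pow_mem (hθ i) d) hdet (c := fun i => c i / frameMoment α v c 1) fun d => by
      have e : (Matrix.vandermonde (scaledFrame α v)).transpose.mulVec
          (fun i => c i / frameMoment α v c 1) d = frameMoment α v c d / frameMoment α v c 1 := by
        rw [show frameMoment α v c d = ∑ i, scaledFrame α v i ^ (d : ℕ) * c i from rfl,
          Finset.sum_div]
        simp only [mul_div_assoc]
        rfl
      rw [e]
      fin_cases d
      · simp [frameMoment, hc]
      · simp [div_self hz]
      · exact hE 2
      · exact hE 3
      · exact hE 4
      · exact hE 5
      · exact hE 6
  rw [← div_div_div_cancel_right₀ hz]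
  exact E.div_mem (hmem i) (hmem 0)

open IntermediateField in
/-- A version of `finrank_le_mul_of_pow_eq_sum` quantified over extensions containing `t`. -/
theorem finrank_le_mul_of_forall_le {k K : Type*} [Field k] [Field K] [Algebra k K]
    (N : IntermediateField k K) (t : K) {d n : ℕ} (b : Fin d → K) (hb : ∀ i, b i ∈ N)
    (ht : t ^ d = ∑ i, b i * t ^ (i : ℕ))
    (h : ∀ E : IntermediateField k K, N ≤ E → t ∈ E →
      FiniteDimensional E K ∧ Module.finrank E K ≤ n) :
    FiniteDimensional N K ∧ Module.finrank N K ≤ d * n :=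
  finrank_le_mul_of_pow_eq_sum N t b hb ht
    (h _ le_sup_left ((le_sup_right : k⟮t⟯ ≤ N ⊔ k⟮t⟯) (mem_adjoin_simple_self k t)))

theorem finrank_adjoin_kleinGenerators {k K : Type*} [Field k] [CharZero k] [Field K] [Algebra k K]
    {a : k} (ha : a ^ 2 + a + 2 = 0) {v : Fin 3 → K} {c : Fin 7 → K} (hv : ∀ j, v j ≠ 0)
    (hc : ∑ i, c i = 0) (h4 : kleinQuartic (algebraMap k K a) v ≠ 0)
    (h6 : kleinSextic (algebraMap k K a) v ≠ 0)
    (hinj : Function.Injective (kleinFrame (algebraMap k K a) v))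
    (hz : frameMoment (algebraMap k K a) v c 1 ≠ 0)
    (hgen : ∀ (E : IntermediateField k K), (∀ i, v i / v 2 ∈ E) → (∀ i, c i / c 0 ∈ E) → E = ⊤)
    (N : IntermediateField k K) (hN : ∀ i, kleinGenerators (algebraMap k K a) v c i ∈ N) :
    FiniteDimensional N K ∧ Module.finrank N K ≤ 168 := by
  have : CharZero K := charZero_of_injective_algebraMap (algebraMap k K).injective
  have htop := eq_top_of_kleinGenerators_mem hv hc h4 h6 hinj hz hgen
  have ha' : algebraMap k K a ^ 2 + algebraMap k K a + 2 = 0 := by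
    simpa [map_ofNat] using congrArg (algebraMap k K) ha
  have haN (E : IntermediateField k K) : algebraMap k K a ∈ E := E.algebraMap_mem a
  set α := algebraMap k K a
  set e := kleinQuartic α v / kleinSextic α v with he
  have he0 : e ≠ 0 := div_ne_zero h4 h6
  have n1 : (1 - 5 * α : K) ≠ 0 := by
    have := intCast_add_intCast_mul_ne_zero ha' (m := 1) (n := -5) (by norm_num)
    convert this using 1
    push_cast
    ring
  have n2 : (4998 + 882 * α : K) ≠ 0 := by
    simpa using intCast_add_intCast_mul_ne_zero ha' (m := 4998) (n := 882) (by norm_num)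
  have hH : kleinRatio α v ∈ N := hN 0
  have hG : frameValue α (kleinRatio α v) (kleinRatio α v) (scaledFrame α v 0) ∈ N := hN 1
  have e4 : kleinRatio α v = kleinQuartic α v * e ^ 2 := by
    rw [kleinRatio, he]
    field_simp
  have e6 : kleinRatio α v = kleinSextic α v * e ^ 3 := by
    rw [kleinRatio, he]
    field_simp
  rw [kleinQuartic_eq ha'] at e4
  rw [kleinSextic_eq ha'] at e6
  have hθ : scaledFrame α v 0 = 4 * (v 0 ^ 2 + v 1 ^ 2 + v 2 ^ 2) * e := rfl
  set H := kleinRatio α v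
  set G := frameValue α H H (scaledFrame α v 0) with hGdef
  set θ := scaledFrame α v 0
  have hnat (E : IntermediateField k K) (n : ℕ) [n.AtLeastTwo] : (OfNat.ofNat n : K) ∈ E :=
    ofNat_mem E n
  let q := (H / 28 - (1 + α) * (θ / 4) ^ 2) / (1 - 5 * α)
  let r := (84 * (1 - α) * (θ / 4) ^ 3 + (378 + 462 * α) * (θ / 4) * q - H) / (4998 + 882 * α)
  have hq : q = (v 0 ^ 2 * v 1 ^ 2 + v 0 ^ 2 * v 2 ^ 2 + v 1 ^ 2 * v 2 ^ 2) * e ^ 2 := by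
    simp only [q]
    rw [div_eq_iff n1, e4, hθ]
    ring
  have hr : r = v 0 ^ 2 * v 1 ^ 2 * v 2 ^ 2 * e ^ 3 := by
    simp only [r]
    rw [div_eq_iff n2, hq, e6, hθ]
    ring
  refine finrank_le_mul_of_forall_le (n := 24) N θ
    ![G / 7056, -(9 * (α - 3) * H ^ 3 + 28 * (5 - α) * H ^ 2) / 7056,
      -(84 * (7 + α) * H * H) / 7056, -(63 * (9 - α) * H ^ 2) / 7056, 2352 * H / 7056,
      3528 * H / 7056, 0] (fun i => ?_) ?_ fun N₁ hN₁ hθ₁ => ?_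
  · fin_cases i <;> dsimp
    all_goals
      repeat' first
        | exact hG | exact hH | exact haN N | exact hnat N _ | exact zero_mem N
        | apply neg_mem | apply div_mem | apply add_mem | apply sub_mem | apply mul_mem
        | apply pow_mem
  · simp only [Fin.sum_univ_seven, hGdef, frameValue]
    simp
    ring
  have hp₁ : θ / 4 ∈ N₁ := N₁.div_mem hθ₁ (hnat N₁ 4)
  have hq₁ : q ∈ N₁ := by
    simp only [q]
    repeat' first
      | exact hp₁ | exact hN₁ hH | exact haN N₁ | exact hnat N₁ _ | exact one_mem N₁
      | apply div_mem | apply add_mem | apply sub_mem | apply mul_mem | apply pow_mem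
  have hr₁ : r ∈ N₁ := by
    simp only [r]
    repeat' first
      | exact hp₁ | exact hq₁ | exact hN₁ hH | exact haN N₁ | exact hnat N₁ _ | exact one_mem N₁
      | apply div_mem | apply add_mem | apply sub_mem | apply mul_mem | apply pow_mem
  refine finrank_le_mul_of_forall_le (d := 3) (n := 8) N₁ (v 0 ^ 2 * e) ![r, -q, θ / 4]
    (fun i => ?_) ?_ fun N₂ hN₂ hX₂ => ?_
  · fin_cases i
    exacts [hr₁, N₁.neg_mem hq₁, hp₁]
  · simp only [Fin.sum_univ_three, hq, hr, hθ]
    simp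
    ring
  refine finrank_le_mul_of_forall_le (d := 2) (n := 4) N₂ (v 1 ^ 2 * e)
    ![-(q - v 0 ^ 2 * e * (θ / 4 - v 0 ^ 2 * e)), θ / 4 - v 0 ^ 2 * e]
    (fun i => ?_) ?_ fun N₃ hN₃ hY₃ => ?_
  · have h1 : θ / 4 - v 0 ^ 2 * e ∈ N₂ := N₂.sub_mem (hN₂ hp₁) hX₂
    fin_cases i
    exacts [N₂.neg_mem (N₂.sub_mem (hN₂ hq₁) (N₂.mul_mem hX₂ h1)), h1]
  · simp only [Fin.sum_univ_two, hq, hθ]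
    simp
    ring
  have hZ₃ : v 2 ^ 2 * e ∈ N₃ := by
    have h1 : v 2 ^ 2 * e = θ / 4 - v 0 ^ 2 * e - v 1 ^ 2 * e := by
      rw [hθ]
      ring
    rw [h1]
    exact N₃.sub_mem (N₃.sub_mem (hN₃ (hN₂ hp₁)) (hN₃ hX₂)) hY₃
  have hv2 := hv 2
  refine finrank_le_mul_of_forall_le (d := 2) (n := 2) N₃ (v 0 / v 2)
    ![v 0 ^ 2 * e / (v 2 ^ 2 * e), 0] (fun i => ?_) ?_ fun N₄ hN₄ h0₄ => ?_
  · fin_cases i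
    exacts [N₃.div_mem (hN₃ hX₂) hZ₃, N₃.zero_mem]
  · simp only [Fin.sum_univ_two]
    simp
    field_simp
  refine finrank_le_mul_of_forall_le (d := 2) (n := 1) N₄ (v 1 / v 2)
    ![v 1 ^ 2 * e / (v 2 ^ 2 * e), 0] (fun i => ?_) ?_ fun E hE h1 => ?_
  · fin_cases i
    exacts [N₄.div_mem (hN₄ hY₃) (hN₄ hZ₃), N₄.zero_mem]
  · simp only [Fin.sum_univ_two]
    simp
    field_simp
  refine finrank_le_one_of_eq_top (htop E
    (fun i => hE (hN₄ (hN₃ (hN₂ (hN₁ (hN i)))))) (hE (hN₄ hZ₃)) fun j => ?_)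
  fin_cases j
  exacts [hE h0₄, h1, by simp [hv2, E.one_mem]]

/-- Let `k` be a field of characteristic `0` containing `√−7`.  Then the fixed field
of `G₁₆₈ ≅ PSL₂(𝔽₇)` acting on the rational function field in 7 variables over `k`
by permuting the variables is purely transcendental over `k`. -/
theorem fixed_field_G168_rational
    (k K : Type*) [Field k] [CharZero k] [Field K] [Algebra k K]
    (hsqrt : ∃ r : k, r ^ 2 = -7)
    (x : Fin 7 → K) (hx : AlgebraicIndependent k x)
    (hgen : IntermediateField.adjoin k (Set.range x) = ⊤)
    (ρ : G168 →* (K ≃ₐ[k] K)) (hρ : ∀ (g : G168) (i : Fin 7), ρ g (x i) = x (g.1 i)) :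
    IsRationalExtension k (IntermediateField.fixedField ρ.range) := by
  have : CharZero K := charZero_of_injective_algebraMap (algebraMap k K).injective
  obtain ⟨a, ha⟩ : ∃ a : k, a ^ 2 + a + 2 = 0 := by
    obtain ⟨r, hr⟩ := hsqrt
    exact ⟨(r - 1) / 2, by linear_combination hr / 4⟩
  have ha' : algebraMap k K a ^ 2 + algebraMap k K a + 2 = 0 := by
    simpa [map_ofNat] using congrArg (algebraMap k K) ha
  obtain ⟨v, ⟨j, hj⟩, hφv, htop⟩ := exists_kleinVector_generating ha hx hgen
  have hc := sum_centered x
  have hc0 := centered_ne_zero hx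
  have hv := forall_ne_zero_of_algebraicIndependent_ratioCoords hj
    (algebraicIndependent_ratioCoords hx hc hc0 hj fun E => htop E j hj)
  have htop2 := fun E => htop E 2 (hv 2)
  have h := algebraicIndependent_ratioCoords hx hc hc0 (hv 2) htop2
  have h4 := kleinQuartic_ne_zero ha (hv 2) h
  have h6 := kleinSextic_ne_zero ha (hv 2) h
  have hz : frameMoment (algebraMap k K a) v (centered x) 1 ≠ 0 := by
    have e : frameMoment (algebraMap k K a) v (centered x) 1 =
        (∑ i, kleinFrame (algebraMap k K a) v i * centered x i) *
          (kleinQuartic (algebraMap k K a) v / kleinSextic (algebraMap k K a) v) := by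
      rw [frameMoment, Finset.sum_mul]
      exact Finset.sum_congr rfl fun i _ => by rw [scaledFrame, pow_one, mul_right_comm]
    rw [e]
    exact mul_ne_zero (sum_kleinFrame_mul_ne_zero ha (hv 2) h hc hc0) (div_ne_zero h4 h6)
  obtain ⟨hfin, hle⟩ := finrank_adjoin_kleinGenerators ha hv hc h4 h6
    (kleinFrame_injective ha (hv 2) h) hz htop2
    (IntermediateField.adjoin k (Set.range (kleinGenerators (algebraMap k K a) v (centered x))))
    fun i => IntermediateField.subset_adjoin _ _ ⟨i, rfl⟩
  have hinj : Function.Injective ρ := fun g g' hg => Subtype.ext <| Equiv.ext fun i =>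
    hx.injective (by rw [← hρ, ← hρ, hg])
  have hgenerator (g : G168) (M : Matrix (Fin 3) (Fin 3) K) (hg : g.1 0 = 0 ∨ g.1 0 = 1)
      (hT : ∀ m i, kleinTensor (algebraMap k K a) m i =
        ∑ n, M m n * kleinTensor (algebraMap k K a) n (g.1 ∘ i))
      (hF : ∀ i, kleinFrame (algebraMap k K a) (M.mulVec v) i =
        kleinFrame (algebraMap k K a) v (g.1 i)) (i : Fin 7) :
      ρ g (kleinGenerators (algebraMap k K a) v (centered x) i) =
        kleinGenerators (algebraMap k K a) v (centered x) i := by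
    refine map_kleinGenerators (ρ g) ha h6 hg (map_centered (ρ g) (hρ g)) (fun i => ?_) i
    rw [← hF, ← funext (hφv (ρ g) g.1 M (hρ g) hT)]
  have hfix (i : Fin 7) (g : Equiv.Perm (Fin 7)) (hg : g ∈ G168) :
      ρ ⟨g, hg⟩ (kleinGenerators (algebraMap k K a) v (centered x) i) =
        kleinGenerators (algebraMap k K a) v (centered x) i := by
    induction hg using Subgroup.closure_induction with
    | mem g hg =>
      obtain rfl | rfl := hg
      · exact hgenerator ⟨sigma168, _⟩ _ (Or.inr (by decide)) (kleinTensor_sigma ha')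
          (kleinFrame_sigma ha' v) i
      · exact hgenerator ⟨tau168, _⟩ _ (Or.inl (by decide)) (kleinTensor_tau _)
          (kleinFrame_tau _ v) i
    | one =>
      have e : ρ 1 = 1 := map_one ρ
      exact DFunLike.congr_fun e _
    | mul g g' hg hg' h h' =>
      have e := map_mul ρ ⟨g, hg⟩ ⟨g', hg'⟩
      refine (DFunLike.congr_fun e _).trans ?_
      rw [AlgEquiv.mul_apply, h', h]
    | inv g hg h =>
      have e := map_inv ρ ⟨g, hg⟩
      refine (DFunLike.congr_fun e _).trans ?_
      exact ((ρ ⟨g, hg⟩).symm_apply_eq).2 h.symm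
  refine isRationalExtension_of_finrank_le hx (kleinGenerators (algebraMap k K a) v (centered x)) _
    (fun i => ?_) hfin ?_
  · rintro ⟨_, g, rfl⟩
    exact hfix i g.1 g.2
  · have : Finite G168 := inferInstance
    rw [finrank_fixedField_range ρ hinj]
    exact hle.trans le_card_G168
end

section
/- Let k be any field and let G be a transitive solvable subgroup of S₁₁ acting on the rational function field k(x₁,...,x₁₁) by permuting the variables. Then k(x₁,...,x₁₁)^G is purely transcendental over k. -/
open IntermediateField in
theorem mem_of_natDegree_le_card_conj {k Ω Γ ι : Type*} [Field k] [Field Ω] [Algebra k Ω]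
    [Group Γ] [MulSemiringAction Γ Ω] [Fintype ι] {L : IntermediateField k Ω} {θ : Ω}
    {f : Polynomial L} (hf : f.Monic) (hroot : Polynomial.aeval θ f = 0) (c : ι → Γ)
    (hc : ∀ i, ∀ a ∈ L, c i • a = a) (hinj : Function.Injective fun i => c i • θ)
    (hcard : f.natDegree ≤ Fintype.card ι) {u : Ω} (hu : u ∈ L ⊔ adjoin k {θ})
    (hfix : ∀ g : Γ, g • u = u) : u ∈ L := by
  have hint : IsIntegral L θ := ⟨f, hf, hroot⟩
  have hu' : u ∈ adjoin L {θ} := by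
    have : L ⊔ adjoin k {θ} ≤ (adjoin L {θ}).restrictScalars k := by
      refine sup_le (fun a ha => ?_) (adjoin_le_iff.mpr ?_)
      · exact (adjoin L {θ}).algebraMap_mem ⟨a, ha⟩
      · rintro _ rfl
        exact mem_adjoin_simple_self L _
    exact this hu
  rw [← mem_toSubalgebra, adjoin_simple_toSubalgebra_of_isAlgebraic hint.isAlgebraic,
    Algebra.adjoin_singleton_eq_range_aeval] at hu'
  obtain ⟨g₀, hg₀⟩ := hu'
  set g := g₀ %ₘ f with hg
  have hgu : Polynomial.aeval θ g = u := by
    rw [hg, Polynomial.aeval_modByMonic_eq_self_of_root hroot]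
    exact hg₀
  have hf1 : f ≠ 1 := by
    rintro rfl
    simp at hroot
  have hdeg : g.natDegree < f.natDegree := Polynomial.natDegree_modByMonic_lt _ hf hf1
  have hz : g.map (algebraMap L Ω) - Polynomial.C u = 0 := by
    refine Polynomial.eq_zero_of_natDegree_lt_card_of_eval_eq_zero _ hinj (fun i => ?_) ?_
    · have h1 : c i • Polynomial.aeval θ g = Polynomial.aeval (c i • θ) g := by
        simp only [Polynomial.aeval_eq_sum_range, Algebra.smul_def, Finset.smul_sum, smul_mul',
          smul_pow']
        refine Finset.sum_congr rfl fun j _ => ?_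
        rw [show algebraMap L Ω (g.coeff j) = (g.coeff j : Ω) from rfl, hc i _ (g.coeff j).2]
      rw [hgu, hfix] at h1
      simp [Polynomial.eval_map_algebraMap, ← h1]
    · refine lt_of_lt_of_le (lt_of_le_of_lt ?_ hdeg) hcard
      refine (Polynomial.natDegree_sub_C).le.trans Polynomial.natDegree_map_le
  have h0 := congrArg (fun q => Polynomial.coeff q 0) hz
  simp only [Polynomial.coeff_sub, Polynomial.coeff_map, Polynomial.coeff_C_zero,
    Polynomial.coeff_zero, sub_eq_zero] at h0
  rw [← h0]
  exact (g.coeff 0).2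

open IntermediateField in
theorem mem_of_mem_sup_of_smul_eq {k Ω Γ : Type*} [Field k] [Field Ω] [Algebra k Ω]
    [Group Γ] [Finite Γ] [MulSemiringAction Γ Ω] {L M : IntermediateField k Ω}
    (hL : ∀ g : Γ, ∀ a ∈ L, g • a ∈ L) (hM : ∀ g : Γ, ∀ a ∈ M, g • a = a)
    (hLM : ∀ a ∈ L, (∀ g : Γ, g • a = a) → a ∈ M) {u : Ω} (hu : u ∈ M ⊔ L)
    (hfix : ∀ g : Γ, g • u = u) : u ∈ M := by
  have := Fintype.ofFinite Γ
  classical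
  let S : Subfield Ω := L.toSubfield
  have : IsInvariantSubfield Γ S := ⟨fun g x hx => hL g x hx⟩
  let L₀ := FixedPoints.subfield Γ S
  obtain ⟨θ, hθ⟩ := Field.exists_primitive_element L₀ S
  let j : L₀ →+* M :=
    { toFun := fun a => ⟨a.1.1, hLM _ a.1.2 fun g => congrArg Subtype.val (a.2 g)⟩
      map_one' := rfl
      map_mul' := fun _ _ => rfl
      map_zero' := rfl
      map_add' := fun _ _ => rfl }
  let f₀ := FixedPoints.minpoly Γ S θ
  have hf₀ : f₀.Monic := FixedPoints.minpoly.monic Γ S θ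
  have hcomp : (algebraMap M Ω).comp j = S.subtype.comp (algebraMap L₀ S) := rfl
  have hroot : Polynomial.aeval (θ : Ω) (f₀.map j) = 0 := by
    have h := FixedPoints.minpoly.eval₂' Γ S θ
    rw [Polynomial.aeval_def, Polynomial.eval₂_map, hcomp]
    exact (Polynomial.hom_eval₂ f₀ (algebraMap L₀ S) S.subtype θ).symm.trans
      (congrArg S.subtype h)
  have hdeg : f₀.natDegree = Nat.card (Γ ⧸ MulAction.stabilizer Γ θ) := by
    have : f₀.natDegree = (prodXSubSMul Γ S θ).natDegree := Polynomial.natDegree_toSubring _ _ _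
    rw [this, prodXSubSMul, Polynomial.natDegree_prod_of_monic _ _ fun i _ =>
      Polynomial.monic_X_sub_C _]
    simp only [Polynomial.natDegree_X_sub_C, Finset.sum_const, Finset.card_univ, smul_eq_mul,
      mul_one]
    exact @Fintype.card_eq_nat_card _ _
  refine mem_of_natDegree_le_card_conj (ι := Γ ⧸ MulAction.stabilizer Γ θ) (hf₀.map j) hroot
    (fun q => q.out) (fun i a ha => hM _ a ha) ?_ ?_ ?_ hfix
  · intro p q hpq
    have h : p.out • θ = q.out • θ := Subtype.ext hpq
    rw [← QuotientGroup.out_eq' p, ← QuotientGroup.out_eq' q, QuotientGroup.eq,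
      MulAction.mem_stabilizer_iff, mul_smul, ← h, inv_smul_smul]
  · rw [hf₀.natDegree_map, hdeg, Nat.card_eq_fintype_card]
  · refine (sup_le le_sup_left ?_ : M ⊔ L ≤ M ⊔ adjoin k {(θ : Ω)}) hu
    intro a ha
    have h : (⟨a, ha⟩ : S) ∈ (⊤ : IntermediateField L₀ S) := trivial
    rw [← hθ, ← mem_toSubalgebra, adjoin_simple_toSubalgebra_of_isAlgebraic
      (FixedPoints.isIntegral Γ S θ).isAlgebraic, Algebra.adjoin_singleton_eq_range_aeval] at h
    obtain ⟨q, hq⟩ := h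
    have hq' : a = Polynomial.aeval (θ : Ω) (q.map j) := by
      rw [Polynomial.aeval_def, Polynomial.eval₂_map, hcomp]
      exact (congrArg S.subtype hq).symm.trans
        (Polynomial.hom_eval₂ q (algebraMap L₀ S) S.subtype θ)
    rw [hq', Polynomial.aeval_eq_sum_range]
    refine sum_mem fun i _ => ?_
    rw [Algebra.smul_def]
    exact mul_mem ((le_sup_left : M ≤ _) ((q.map j).coeff i).2)
      (pow_mem ((le_sup_right : _ ≤ M ⊔ adjoin k {(θ : Ω)}) (mem_adjoin_simple_self k _)) _)

theorem mem_span_fixed_of_mem {k Ω Γ : Type*} [Field k] [Field Ω] [Algebra k Ω]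
    [Group Γ] [Finite Γ] [MulSemiringAction Γ Ω] {L : IntermediateField k Ω}
    (hL : ∀ g : Γ, ∀ a ∈ L, g • a ∈ L) {V : Submodule L Ω} (hV : ∀ g : Γ, ∀ v ∈ V, g • v ∈ V)
    (hker : ∀ g : Γ, (∀ a ∈ L, g • a = a) → ∀ v ∈ V, g • v = v) {v : Ω} (hv : v ∈ V) :
    v ∈ Submodule.span L {w | w ∈ V ∧ ∀ g : Γ, g • w = w} := by
  classical
  by_contra hv'
  obtain ⟨φ, hφv, hφ⟩ := Submodule.exists_le_ker_of_notMem hv'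
  let r : Γ → (L →* L) := fun g =>
    { toFun := fun a => ⟨g • (a : Ω), hL g _ a.2⟩
      map_one' := Subtype.ext (smul_one g)
      map_mul' := fun a b => Subtype.ext (smul_mul' g (a : Ω) b) }
  have hr : ∀ g (a : L), ((r g a : L) : Ω) = g • (a : Ω) := fun _ _ => rfl
  have hrV : ∀ g h : Γ, r g = r h → ∀ w ∈ V, g • w = h • w := by
    intro g h hgh w hw
    have := hker (h⁻¹ * g) (fun a ha => by
      have h1 := congrArg Subtype.val (DFunLike.congr_fun hgh ⟨a, ha⟩)
      simp only [hr] at h1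
      rw [mul_smul, h1, inv_smul_smul]) w hw
    rw [mul_smul, inv_smul_eq_iff] at this
    exact this
  have : Fintype (Set.range r) := Fintype.ofFinite _
  let q : Set.range r → Γ := fun f => f.2.choose
  have hq : ∀ f : Set.range r, r (q f) = f := fun f => f.2.choose_spec
  have hTmem : ∀ c : L, ∑ f : Set.range r, q f • (c • v) ∈ {w | w ∈ V ∧ ∀ g : Γ, g • w = w} := by
    intro c
    refine ⟨sum_mem fun f _ => hV _ _ (V.smul_mem c hv), fun g => ?_⟩
    have hmap : ∀ f : Set.range r, ∀ g : Γ, r (g * q f) ∈ Set.range r := fun f g => ⟨_, rfl⟩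
    rw [Finset.smul_sum]
    let e : Set.range r → Set.range r := fun f => ⟨_, hmap f g⟩
    have he : Function.Injective e := by
      intro f f' hff
      have h1 : r (g * q f) = r (g * q f') := congrArg Subtype.val hff
      apply Subtype.ext
      rw [← hq f, ← hq f']
      ext a
      have h3 := congrArg Subtype.val (DFunLike.congr_fun h1 a)
      simp only [hr, mul_smul] at h3 ⊢
      exact smul_left_cancel g h3
    refine Fintype.sum_bijective e (Finite.injective_iff_bijective.mp he) _ _ fun f => ?_
    rw [← mul_smul]
    exact (hrV _ _ (hq (e f)) _ (V.smul_mem c hv)).symm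
  have hsum : ∀ c : L, ∑ f : Set.range r, φ (q f • v) * (f : L →* L) c = 0 := by
    intro c
    have h1 : φ (∑ f : Set.range r, q f • (c • v)) = 0 := hφ (Submodule.subset_span (hTmem c))
    rw [map_sum] at h1
    rw [← h1]
    refine Finset.sum_congr rfl fun f _ => ?_
    have h2 : q f • (c • v) = (r (q f) c) • (q f • v) := by
      rw [Algebra.smul_def, smul_mul', Algebra.smul_def]
      rfl
    rw [h2, LinearMap.map_smul, hq, smul_eq_mul, mul_comm]
  have hind := (linearIndependent_monoidHom L L).comp ((↑) : Set.range r → (L →* L))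
    Subtype.val_injective
  have h0 := Fintype.linearIndependent_iff.mp hind (fun f => φ (q f • v)) (by
    ext c
    simpa using congrArg Subtype.val (hsum c)) ⟨r 1, 1, rfl⟩
  have h1 : q ⟨r 1, 1, rfl⟩ • v = v := by
    rw [hrV _ 1 (hq ⟨r 1, 1, rfl⟩) v hv, one_smul]
  exact hφv (h1 ▸ h0)

/-- The elements of `L` fixed by `Γ` lie in a subfield of the fixed field generated over `k` by
at most `n` elements. -/
def FixedGenBy (Γ : Type*) {k Ω : Type*} [Field k] [Field Ω] [Algebra k Ω] [Group Γ]
    [MulSemiringAction Γ Ω] (L : IntermediateField k Ω) (n : ℕ) : Prop :=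
  ∃ s : Finset Ω, s.card ≤ n ∧ (∀ t ∈ s, ∀ g : Γ, g • t = t) ∧
    ∀ u ∈ L, (∀ g : Γ, g • u = u) → u ∈ IntermediateField.adjoin k (s : Set Ω)

namespace FixedGenBy

variable {k Ω Γ : Type*} [Field k] [Field Ω] [Algebra k Ω] [Group Γ] [MulSemiringAction Γ Ω]
  {L M : IntermediateField k Ω} {m n : ℕ}

theorem anti (h : FixedGenBy Γ L n) (hML : M ≤ L) : FixedGenBy Γ M n := by
  obtain ⟨s, hs, hfix, hgen⟩ := h
  exact ⟨s, hs, hfix, fun u hu => hgen u (hML hu)⟩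

open IntermediateField in
theorem sup_simple {ι : Type*} [Fintype ι] (h : FixedGenBy Γ L n) {θ : Ω} {f : Polynomial L}
    (hf : f.Monic) (hroot : Polynomial.aeval θ f = 0) (c : ι → Γ)
    (hc : ∀ i, ∀ a ∈ L, c i • a = a) (hinj : Function.Injective fun i => c i • θ)
    (hcard : f.natDegree ≤ Fintype.card ι) : FixedGenBy Γ (L ⊔ adjoin k {θ}) n := by
  obtain ⟨s, hs, hfix, hgen⟩ := h
  exact ⟨s, hs, hfix, fun u hu hu' =>
    hgen u (mem_of_natDegree_le_card_conj hf hroot c hc hinj hcard hu hu') hu'⟩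

open IntermediateField in
theorem sup_adjoin [Finite Γ] [SMulCommClass Γ k Ω] (h : FixedGenBy Γ L m)
    (hL : ∀ g : Γ, ∀ a ∈ L, g • a ∈ L) (x : Fin n → Ω)
    (hx : ∀ (g : Γ) i, g • x i ∈ Submodule.span L (insert 1 (Set.range x)))
    (hker : ∀ g : Γ, (∀ a ∈ L, g • a = a) → ∀ i, g • x i = x i) :
    FixedGenBy Γ (L ⊔ adjoin k (Set.range x)) (m + n) := by
  classical
  obtain ⟨s, hs, hfix, hgen⟩ := h
  set V := Submodule.span L (insert 1 (Set.range x)) with hVdef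
  have hV : ∀ g : Γ, ∀ v ∈ V, g • v ∈ V := by
    intro g v hv
    induction hv using Submodule.span_induction with
    | mem v hv =>
      obtain rfl | ⟨i, rfl⟩ := hv
      · rw [smul_one]
        exact Submodule.subset_span (Set.mem_insert _ _)
      · exact hx g i
    | zero => simp
    | add a b _ _ ha hb => rw [smul_add]; exact add_mem ha hb
    | smul c a _ ha =>
      have : g • (c • a) = (⟨g • (c : Ω), hL g _ c.2⟩ : L) • (g • a) := by
        rw [Algebra.smul_def, smul_mul', Algebra.smul_def]
        rfl
      rw [this]
      exact V.smul_mem _ ha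
  have hkerV : ∀ g : Γ, (∀ a ∈ L, g • a = a) → ∀ v ∈ V, g • v = v := by
    intro g hg v hv
    induction hv using Submodule.span_induction with
    | mem v hv =>
      obtain rfl | ⟨i, rfl⟩ := hv
      · exact smul_one g
      · exact hker g hg i
    | zero => simp
    | add a b _ _ ha hb => rw [smul_add, ha, hb]
    | smul c a _ ha =>
      rw [Algebra.smul_def, smul_mul', ha]
      congr 1
      exact hg _ c.2
  set W := {w | w ∈ V ∧ ∀ g : Γ, g • w = w}
  have h1W : ({1} : Set Ω) ⊆ W := by
    rintro _ rfl
    exact ⟨Submodule.subset_span (Set.mem_insert _ _), fun g => smul_one g⟩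
  obtain ⟨b, hbW, h1b, hWb, hb⟩ := exists_linearIndepOn_id_extension (K := L) (s := {1}) (t := W)
    (LinearIndepOn.singleton (by simp)) h1W
  have hVb : V ≤ Submodule.span L b := fun v hv =>
    Submodule.span_le.mpr hWb (mem_span_fixed_of_mem hL hV hkerV hv)
  have hVfin : Module.Finite L V := Module.Finite.span_of_finite L ((Set.finite_range x).insert 1)
  have hVrank : Module.finrank L V ≤ n + 1 := by
    have h1 := finrank_span_finset_le_card (R := L) (insert 1 (Finset.univ.image x))
    have h2 : (insert 1 (Finset.univ.image x)).card ≤ n + 1 :=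
      (Finset.card_insert_le _ _).trans
        (Nat.add_le_add_right (Finset.card_image_le.trans (by simp)) 1)
    refine le_trans (le_of_eq ?_) (h1.trans h2)
    rw [hVdef, Set.finrank]
    congr 3 <;> simp
  have hbV : b ⊆ V := fun w hw => (hbW hw).1
  have hb' : LinearIndependent L (fun w : b => (⟨w, hbV w.2⟩ : V)) := by
    refine LinearIndependent.of_comp V.subtype ?_
    exact hb
  have hbfin : Finite b := hb'.finite
  have := Fintype.ofFinite b
  have hbcard : b.toFinset.card ≤ n + 1 := by
    rw [Set.toFinset_card]
    exact hb'.fintype_card_le_finrank.trans hVrank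
  let t := b.toFinset.erase 1
  have ht : t.card ≤ n := by
    rw [Finset.card_erase_of_mem (by simpa using h1b)]
    omega
  have htfix : ∀ w ∈ t, ∀ g : Γ, g • w = w := by
    intro w hw
    have : w ∈ b := by simpa using Finset.mem_of_mem_erase hw
    exact (hbW this).2
  refine ⟨s ∪ t, (Finset.card_union_le _ _).trans (Nat.add_le_add hs ht), ?_, ?_⟩
  · intro w hw
    rcases Finset.mem_union.mp hw with hw | hw
    exacts [hfix w hw, htfix w hw]
  set F := adjoin k ((s ∪ t : Finset Ω) : Set Ω) with hF
  have hFfix : ∀ g : Γ, ∀ a ∈ F, g • a = a := by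
    have : F ≤ FixedPoints.intermediateField Γ := by
      rw [hF, adjoin_le_iff]
      intro w hw g
      rcases Finset.mem_union.mp (Finset.mem_coe.mp hw) with hw | hw
      exacts [hfix w hw g, htfix w hw g]
    exact fun g a ha => this ha g
  intro u hu hufix
  refine mem_of_mem_sup_of_smul_eq hL hFfix (fun a ha hafix => ?_) (?_ : u ∈ F ⊔ L) hufix
  · exact adjoin.mono k _ _ (by simp) (hgen a ha hafix)
  · refine (sup_le le_sup_right (adjoin_le_iff.mpr ?_) : L ⊔ adjoin k (Set.range x) ≤ F ⊔ L) hu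
    rintro _ ⟨i, rfl⟩
    have hxi : x i ∈ Submodule.span L b :=
      hVb (Submodule.subset_span (Set.mem_insert_of_mem _ ⟨i, rfl⟩))
    have hspan : Submodule.span L b ≤ (extendScalars (le_sup_right : L ≤ F ⊔ L)).toSubmodule := by
      rw [Submodule.span_le]
      intro w hw
      by_cases hw1 : w = 1
      · rw [hw1]
        exact one_mem (F ⊔ L)
      · exact (le_sup_left : F ≤ F ⊔ L) (subset_adjoin k _ (by simp [t, hw, hw1]))
    exact hspan hxi

end FixedGenBy

theorem exists_isMulCommutative_normal_ne_bot (G : Type*) [Group G] [Nontrivial G]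
    [Group.IsSolvable G] :
    ∃ A : Subgroup G, A.Normal ∧ IsMulCommutative A ∧ A ≠ ⊥ := by
  classical
  have h := (Group.isSolvable_def G).mp inferInstance
  have h0 : Nat.find h ≠ 0 := fun h0 => by
    have := Nat.find_spec h
    rw [h0, derivedSeries_zero] at this
    exact top_ne_bot this
  obtain ⟨m, hm⟩ := Nat.exists_eq_succ_of_ne_zero h0
  refine ⟨derivedSeries G m, derivedSeries_normal G m, ?_, Nat.find_min h (by omega)⟩
  rw [← Subgroup.le_centralizer_iff_isMulCommutative,
    ← Subgroup.commutator_eq_bot_iff_le_centralizer, ← derivedSeries_succ]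
  have := Nat.find_spec h
  rwa [hm] at this

theorem exists_equiv_zmod_affine {p : ℕ} [hp : Fact p.Prime] {α : Type*} (hα : Nat.card α = p)
    (G : Subgroup (Equiv.Perm α)) (htrans : ∀ i j : α, ∃ g ∈ G, g i = j)
    (hsolv : Group.IsSolvable G) :
    ∃ e : ZMod p ≃ α, (∃ σ ∈ G, ∀ j, σ (e j) = e (j + 1)) ∧
      ∀ g ∈ G, ∃ (a : (ZMod p)ˣ) (b : ZMod p), ∀ j, g (e j) = e (a * j + b) := by
  have hfin : Finite α := Nat.finite_of_card_ne_zero (hα ▸ hp.out.ne_zero)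
  have hnt : Nontrivial α := Finite.one_lt_card_iff_nontrivial.mp (hα ▸ hp.out.one_lt)
  obtain ⟨o, o', ho⟩ := exists_pair_ne α
  have hG : Nontrivial G := by
    obtain ⟨g, hg, hgo⟩ := htrans o o'
    refine ⟨⟨g, hg⟩, 1, fun h => ho ?_⟩
    rw [← hgo, show g = 1 from congrArg Subtype.val h]
    rfl
  obtain ⟨A, hA, hcomm, hbot⟩ := exists_isMulCommutative_normal_ne_bot G
  have hpre : MulAction.IsPretransitive G α :=
    ⟨fun x y => (htrans x y).elim fun g hg => ⟨⟨g, hg.1⟩, hg.2⟩⟩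
  have hprim : MulAction.IsPreprimitive G α := .of_prime_card (hα ▸ hp.out)
  obtain ⟨σ, hσA, hσ1⟩ := Subgroup.ne_bot_iff_exists_ne_one.mp hbot |>.elim
    fun a ha => (⟨a.1, a.2, fun h => ha (Subtype.ext h)⟩ : ∃ σ : G, σ ∈ A ∧ σ ≠ 1)
  have hAtrans : MulAction.IsPretransitive A α := by
    refine MulAction.IsQuasiPreprimitive.isPretransitive_of_normal (G := G) fun h => hσ1 ?_
    apply Subtype.ext
    ext x
    have : x ∈ MulAction.fixedPoints A α := h ▸ Set.mem_univ x
    exact this ⟨σ, hσA⟩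
  have hfree : ∀ a b : A, a • o = b • o → a = b := by
    intro a b hab
    apply Subtype.ext
    apply Subtype.ext
    ext x
    obtain ⟨c, rfl⟩ := MulAction.exists_smul_eq A o x
    have : a • c • o = b • c • o := by
      rw [smul_smul, mul_comm' a c, mul_smul, hab, smul_smul, mul_comm' c b, mul_smul]
    exact this
  have hcard : Nat.card A = p := by
    rw [← hα]
    refine Nat.card_eq_of_bijective (fun a : A => a • o) ⟨fun a b => hfree a b, fun x => ?_⟩
    exact MulAction.exists_smul_eq A o x
  let s : A := ⟨σ, hσA⟩
  have hs1 : s ≠ 1 := fun h => hσ1 (congrArg Subtype.val h)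
  have hs : orderOf s = p := orderOf_eq_prime (hcard ▸ pow_card_eq_one') hs1
  have hpow : ∀ a : A, ∃ n : ℕ, s ^ n = a := by
    intro a
    have : a ∈ Subgroup.zpowers s := by
      rw [Subgroup.eq_top_of_card_eq (Subgroup.zpowers s) (by rw [Nat.card_zpowers, hs, hcard])]
      trivial
    have := mem_powers_iff_mem_zpowers.mpr this
    exact this
  let f : ZMod p → α := fun j => s ^ j.val • o
  have hf : ∀ n : ℕ, f n = s ^ n • o := by
    intro n
    simp only [f, ZMod.val_natCast]
    rw [← hs, pow_mod_orderOf]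
  have hfbij : Function.Bijective f := by
    refine (Nat.bijective_iff_surjective_and_card f).mpr ⟨fun x => ?_, by simp [hα]⟩
    obtain ⟨a, rfl⟩ := MulAction.exists_smul_eq A o x
    obtain ⟨n, rfl⟩ := hpow a
    exact ⟨n, hf n⟩
  refine ⟨Equiv.ofBijective f hfbij, ⟨σ, σ.2, fun j => ?_⟩, fun g hg => ?_⟩
  · obtain ⟨n, rfl⟩ := ZMod.natCast_zmod_surjective j
    have := hf (n + 1)
    rw [pow_succ', mul_smul, ← hf] at this
    exact (by simpa using this.symm : s • f n = f (n + 1))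
  · let γ : G := ⟨g, hg⟩
    obtain ⟨m, hm⟩ := hpow ⟨γ * σ * γ⁻¹, hA.conj_mem σ hσA γ⟩
    have hm' : σ ^ m = γ * σ * γ⁻¹ := congrArg Subtype.val hm
    have hconj : ∀ n : ℕ, γ * σ ^ n = σ ^ (m * n) * γ := by
      intro n
      rw [pow_mul, hm', conj_pow]
      group
    have hm0 : (m : ZMod p) ≠ 0 := by
      intro h0
      rw [ZMod.natCast_eq_zero_iff, ← hs, orderOf_dvd_iff_pow_eq_one] at h0
      have : σ ^ m = 1 := congrArg Subtype.val h0
      rw [hm', mul_inv_eq_one] at this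
      exact hσ1 (by simpa using this)
    obtain ⟨b, hb⟩ := hfbij.2 (g o)
    obtain ⟨b, rfl⟩ := ZMod.natCast_zmod_surjective b
    refine ⟨Units.mk0 (m : ZMod p) hm0, b, fun j => ?_⟩
    obtain ⟨n, rfl⟩ := ZMod.natCast_zmod_surjective j
    have h1 : g (s ^ n • o) = (s ^ (m * n)) • g o := by
      have := congrArg (fun x : G => x • o) (hconj n)
      simp only [mul_smul] at this
      exact this
    simp only [Equiv.ofBijective_apply, Units.val_mk0]
    rw [hf, h1, ← hb, hf, smul_smul, ← pow_add, ← hf]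
    push_cast
    rfl

open IntermediateField in
theorem AlgebraicIndependent.of_forall_isAlgebraic_adjoin {k Ω ι κ : Type*} [Field k] [Field Ω]
    [Algebra k Ω] [Finite ι] [Finite κ] {x : ι → Ω} (hx : AlgebraicIndependent k x) {y : κ → Ω}
    (hcard : Nat.card κ ≤ Nat.card ι) (hy : ∀ i, IsAlgebraic (adjoin k (Set.range y)) (x i)) :
    AlgebraicIndependent k y := by
  let M := AlgebraicIndependent.matroid k Ω
  have hxM : M.Indep (Set.range x) := matroid_indep_iff.mpr hx.to_subtype_range
  have hcl : Set.range x ⊆ M.closure (Set.range y) := by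
    rintro _ ⟨i, rfl⟩
    rw [matroid_closure_eq]
    exact isAlgebraic_adjoin_iff.mp (hy i)
  have h1 : (Set.range x).encard ≤ M.eRk (Set.range y) := by
    rw [← hxM.eRk_eq_encard, ← M.eRk_closure_eq (Set.range y)]
    exact M.eRk_mono hcl
  have h2 : (Set.range x).encard = Nat.card ι := by
    rw [← Set.image_univ, hx.injective.encard_image, Set.encard_univ,
      ENat.card_eq_coe_natCard]
  have h3 : (Nat.card κ : ℕ∞) ≤ (Set.range y).encard :=
    (Nat.cast_le.mpr hcard).trans ((h2.symm.le.trans h1).trans (M.eRk_le_encard _))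
  have h4 : (Set.range y).encard ≤ Nat.card κ := by
    rw [← Set.image_univ]
    refine (Set.encard_image_le _ _).trans ?_
    rw [Set.encard_univ, ENat.card_eq_coe_natCard]
  have hinj : Function.Injective y := by
    refine Set.injOn_univ.mp (Set.finite_univ.injOn_of_encard_image_eq ?_)
    rw [Set.image_univ, Set.encard_univ, ENat.card_eq_coe_natCard]
    exact le_antisymm h4 h3
  have hind : M.Indep (Set.range y) := by
    rw [Matroid.indep_iff_eRk_eq_encard_of_finite (Set.finite_range y)]
    exact le_antisymm (M.eRk_le_encard _)
      (h4.trans ((Nat.cast_le.mpr hcard).trans (h2.symm.le.trans h1)))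
  exact (algebraicIndependent_subtype_range hinj).mp (matroid_indep_iff.mp hind)

section Resolvents

open Finset

theorem sum_addChar_mul_sum {p : ℕ} [NeZero p] {Ω : Type*} [Field Ω] {ε : AddChar (ZMod p) Ω}
    (hε : ε.IsPrimitive) (X : ZMod p → Ω) (j : ZMod p) :
    ∑ i, ε (-(i * j)) * ∑ l, ε (i * l) * X l = p * X j := by
  simp_rw [mul_sum, ← mul_assoc, ← AddChar.map_add_eq_mul]
  rw [sum_comm]
  have : ∀ l, ∑ i, ε (-(i * j) + i * l) * X l = if l = j then (p : Ω) * X l else 0 := by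
    intro l
    rw [← sum_mul]
    have h := AddChar.sum_mulShift (l - j) hε
    simp_rw [show ∀ i, -(i * j) + i * l = i * (l - j) from fun i => by ring, h, sub_eq_zero,
      ZMod.card]
    split_ifs <;> simp
  simp_rw [this]
  simp

theorem fourier_mem {p : ℕ} [NeZero p] {Ω S : Type*} [Field Ω] [SetLike S Ω] [SubfieldClass S Ω]
    {ε : AddChar (ZMod p) Ω} (hε : ε.IsPrimitive) (hp : (p : Ω) ≠ 0) (X : ZMod p → Ω) (M : S)
    (hεM : ∀ i, ε i ∈ M) (hM : ∀ i, ∑ l, ε (i * l) * X l ∈ M) (j : ZMod p) : X j ∈ M := by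
  rw [← mul_div_cancel_left₀ (X j) hp, ← sum_addChar_mul_sum hε]
  exact div_mem (sum_mem fun i _ => mul_mem (hεM _) (hM i)) (natCast_mem M p)

theorem AddChar.isAlgebraic_apply {p : ℕ} [NeZero p] (k : Type*) {Ω : Type*} [Field k] [Field Ω]
    [Algebra k Ω] (ε : AddChar (ZMod p) Ω) (i : ZMod p) : IsAlgebraic k (ε i) := by
  refine IsIntegral.isAlgebraic (.of_pow (n := p) (Nat.pos_of_neZero p) ?_)
  rw [← AddChar.map_nsmul_eq_pow, nsmul_eq_mul, CharP.cast_eq_zero, zero_mul,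
    AddChar.map_zero_eq_one]
  exact isIntegral_one

open IntermediateField in
theorem AlgebraicIndependent.fourier {p : ℕ} [NeZero p] {k Ω : Type*} [Field k] [Field Ω]
    [Algebra k Ω] {ε : AddChar (ZMod p) Ω} (hε : ε.IsPrimitive) (hp : (p : Ω) ≠ 0)
    {X : ZMod p → Ω} (hX : AlgebraicIndependent k X) :
    AlgebraicIndependent k fun i => ∑ l, ε (i * l) * X l := by
  refine hX.of_forall_isAlgebraic_adjoin le_rfl fun j => ?_
  rw [← mem_algebraicClosure_iff]
  refine fourier_mem hε hp X _ (fun i => ?_) (fun i => ?_) j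
  · exact mem_algebraicClosure_iff.mpr (ε.isAlgebraic_apply _ i)
  · exact (algebraicClosure (adjoin k (Set.range fun i => ∑ l, ε (i * l) * X l)) Ω).algebraMap_mem
      ⟨_, subset_adjoin k _ ⟨i, rfl⟩⟩

theorem smul_fourier {p : ℕ} [Fact p.Prime] {Ω Γ : Type*} [Field Ω] [Group Γ]
    [MulSemiringAction Γ Ω] {ε : AddChar (ZMod p) Ω} {X : ZMod p → Ω} {γ : Γ} {a b d : ZMod p}
    (ha : a ≠ 0) (hγX : ∀ j, γ • X j = X (a * j + b)) (hγε : ∀ i, γ • ε i = ε (d * a * i))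
    (i : ZMod p) :
    γ • ∑ l, ε (i * l) * X l = ε (-(b * d * i)) * ∑ l, ε (d * i * l) * X l := by
  rw [smul_sum, mul_sum]
  refine Fintype.sum_bijective (fun l => a * l + b)
    ((AddGroup.addRight_bijective b).comp (mulLeft_bijective₀ a ha)) _ _ fun l => ?_
  simp only [smul_mul', hγX, hγε]
  rw [← mul_assoc (ε _), ← AddChar.map_add_eq_mul]
  congr 2
  ring

theorem AddChar.apply_sum {A M ι : Type*} [AddCommMonoid A] [CommMonoid M] (ε : AddChar A M)
    (s : Finset ι) (f : ι → A) : ε (∑ i ∈ s, f i) = ∏ i ∈ s, ε (f i) := by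
  induction s using Finset.cons_induction with
  | empty => simp
  | cons a s ha ih => rw [sum_cons, prod_cons, AddChar.map_add_eq_mul, ih]

theorem prod_zpow_convolution {A Ω : Type*} [AddCommGroup A] [Fintype A] [Field Ω] {w : A → Ω}
    (hw : ∀ i, w i ≠ 0) (α β : A → ℤ) :
    ∏ i, (∏ j, w (j + i) ^ α j) ^ β i = ∏ l, w l ^ ∑ j, α j * β (l - j) := by
  simp_rw [← prod_zpow, ← zpow_mul]
  have : ∀ l, w l ^ ∑ j, α j * β (l - j) = ∏ j, w l ^ (α j * β (l - j)) := by
    intro l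
    induction (univ : Finset A) using Finset.cons_induction with
    | empty => simp
    | cons a s ha ih => rw [sum_cons, prod_cons, zpow_add₀ (hw l), ih]
  simp_rw [this]
  rw [prod_comm, prod_comm (s := univ) (t := univ) (f := fun l j => w l ^ (α j * β (l - j)))]
  refine prod_congr rfl fun j _ => ?_
  exact Fintype.prod_equiv (Equiv.addLeft j) _ _ fun i => by simp

theorem exists_monomial_resolvents {p n : ℕ} [Fact p.Prime] [NeZero n] (k : Type*)
    {Ω : Type*} (Γ : Type*) [Field k] [Field Ω] [Algebra k Ω] [Group Γ] [MulSemiringAction Γ Ω]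
    (E : ZMod n → ZMod p) (hE : ∀ i j, E (i + j) = E i * E j) (hE0 : E 0 = 1)
    (hsurj : ∀ c ≠ 0, ∃ m, E m = c) (α β β' : ZMod n → ℤ) (h : ℤ)
    (hα : ∑ j, (α j : ZMod p) * E j = 0)
    (hβ : ∀ l, ∑ j, α j * β (l - j) = if l = 0 then (p : ℤ) else 0)
    (hβ' : ∀ l, ∑ j, α j * β' (l - j) = (if l = 1 then 1 else 0) + (if l = 0 then h else 0))
    {ε : AddChar (ZMod p) Ω} (hε : ε.IsPrimitive) (hp : (p : Ω) ≠ 0)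
    {X : ZMod p → Ω} (hX : AlgebraicIndependent k X) :
    ∃ (z : ZMod n → Ω) (θ : Ω), θ ≠ 0 ∧
      (∀ (γ : Γ) (a b c : ZMod p), a ≠ 0 → c ≠ 0 → (∀ j, γ • X j = X (a * j + b)) →
        (∀ i, γ • ε i = ε (c * i)) → ∃ m, ∀ i, γ • z i = z (i + m)) ∧
      (∀ (γ : Γ) (b : ZMod p), (∀ j, γ • X j = X (j + b)) → (∀ i, γ • ε i = ε i) →
        (∀ i, γ • z i = z i) ∧ γ • θ = ε (-b) * θ) ∧
      θ ^ p ∈ IntermediateField.adjoin k (Set.range z) ∧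
      ∀ M : IntermediateField k Ω, (∀ i, ε i ∈ M) → ∑ j, X j ∈ M → (∀ i, z i ∈ M) → θ ∈ M →
        ∀ j, X j ∈ M := by
  have hy0 : ∀ i, ∑ l, ε (i * l) * X l ≠ 0 := fun i => (hX.fourier hε hp).ne_zero i
  set y : ZMod p → Ω := fun i => ∑ l, ε (i * l) * X l with hy
  let w : ZMod n → Ω := fun i => y (E i)
  have hw : ∀ i, w i ≠ 0 := fun i => hy0 _
  let z : ZMod n → Ω := fun i => ∏ j, w (j + i) ^ α j
  have hconv : ∀ (s : ZMod n) (β : ZMod n → ℤ),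
      ∏ i, z (i + s) ^ β i = ∏ l, w (l + s) ^ ∑ j, α j * β (l - j) := by
    intro s β
    rw [← prod_zpow_convolution (fun i => hw (i + s))]
    simp only [z, add_assoc]
  have hzp : ∏ i, z i ^ β i = w 0 ^ p := by
    have := hconv 0 β
    simp only [add_zero, hβ] at this
    rw [this, prod_eq_single 0 (fun l _ hl => by simp [hl]) (by simp)]
    simp
  have hstep : ∀ s, ∏ i, z (i + s) ^ β' i = w (1 + s) * w s ^ h := by
    intro s
    rw [hconv]
    simp_rw [hβ', zpow_add₀ (hw _), prod_mul_distrib]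
    congr 1
    · rw [prod_eq_single 1 (fun l _ hl => by simp [hl]) (by simp)]
      simp
    · rw [prod_eq_single 0 (fun l _ hl => by simp [hl]) (by simp)]
      simp
  have hγz : ∀ (γ : Γ) (a b : ZMod p) (m : ZMod n), a ≠ 0 → (∀ j, γ • X j = X (a * j + b)) →
      (∀ i, γ • ε i = ε (E m * a * i)) → ∀ i, γ • z i = z (i + m) := by
    intro γ a b m ha hγX hγε i
    have hγw : ∀ j, γ • w j = ε (-(b * E m * E j)) * w (j + m) := by
      intro j
      simp only [w, hy, smul_fourier ha hγX hγε, hE, mul_comm (E m)]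
    have : ∀ j, γ • (w (j + i) ^ α j) =
        ε (-(b * E m * E i) * (α j * E j)) * w (j + (i + m)) ^ α j := by
      intro j
      have h1 : γ • (w (j + i) ^ α j) = (γ • w (j + i)) ^ α j :=
        map_zpow₀ (MulSemiringAction.toRingHom Γ Ω γ) _ _
      rw [h1, hγw, mul_zpow, ← AddChar.map_zsmul_eq_zpow, add_assoc, hE j i, zsmul_eq_mul]
      congr 2
      ring
    simp only [z, smul_prod', this, prod_mul_distrib]
    rw [← AddChar.apply_sum, ← mul_sum, hα, mul_zero, AddChar.map_zero_eq_one, one_mul]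
  refine ⟨z, w 0, hw 0, ?_, ?_, ?_, ?_⟩
  · intro γ a b c ha hc hγX hγε
    obtain ⟨m, hm⟩ := hsurj (c * a⁻¹) (mul_ne_zero hc (inv_ne_zero ha))
    exact ⟨m, hγz γ a b m ha hγX fun i => by rw [hγε, hm, inv_mul_cancel_right₀ ha]⟩
  · intro γ b hγX hγε
    refine ⟨fun i => ?_, ?_⟩
    · simpa using hγz γ 1 b 0 one_ne_zero (by simpa using hγX) (by simpa [hE0] using hγε) i
    have := smul_fourier (a := 1) (b := b) (d := 1) one_ne_zero (by simpa using hγX)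
      (by simpa using hγε) 1
    simpa [w, hy, hE0] using this
  · rw [← hzp]
    exact prod_mem fun i _ =>
      zpow_mem (IntermediateField.subset_adjoin k (Set.range z) (Set.mem_range_self i)) _
  · intro M hεM hS hz hθ
    have hwM : ∀ i : ℕ, w i ∈ M := by
      intro i
      induction i with
      | zero => simpa using hθ
      | succ i ih =>
        have : w (i + 1 : ℕ) = (∏ l, z (l + i) ^ β' l) / w i ^ h := by
          rw [hstep, mul_div_cancel_right₀ _ (zpow_ne_zero _ (hw _))]
          push_cast
          rw [add_comm]
        rw [this]
        exact div_mem (prod_mem fun l _ => zpow_mem (hz _) _) (zpow_mem ih _)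
    refine fourier_mem hε hp X M hεM fun i => ?_
    by_cases hi : i = 0
    · simpa [hi] using hS
    · obtain ⟨m, rfl⟩ := hsurj i hi
      have := hwM m.val
      rwa [ZMod.natCast_zmod_val] at this

instance : Fact (Nat.Prime 5) := ⟨by norm_num⟩

instance : Fact (Nat.Prime 11) := ⟨by norm_num⟩

variable (k : Type*) {Ω : Type*} (Γ : Type*) [Field k] [Field Ω] [Algebra k Ω] [Group Γ]
  [MulSemiringAction Γ Ω]

theorem exists_monomial_resolvents_five {ε : AddChar (ZMod 5) Ω} (hε : ε.IsPrimitive)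
    (h5 : (5 : Ω) ≠ 0) {X : ZMod 5 → Ω} (hX : AlgebraicIndependent k X) :
    ∃ (z : ZMod 4 → Ω) (θ : Ω), θ ≠ 0 ∧
      (∀ (γ : Γ) (a b c : ZMod 5), a ≠ 0 → c ≠ 0 → (∀ j, γ • X j = X (a * j + b)) →
        (∀ i, γ • ε i = ε (c * i)) → ∃ m, ∀ i, γ • z i = z (i + m)) ∧
      (∀ (γ : Γ) (b : ZMod 5), (∀ j, γ • X j = X (j + b)) → (∀ i, γ • ε i = ε i) →
        (∀ i, γ • z i = z i) ∧ γ • θ = ε (-b) * θ) ∧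
      θ ^ 5 ∈ IntermediateField.adjoin k (Set.range z) ∧
      ∀ M : IntermediateField k Ω, (∀ i, ε i ∈ M) → ∑ j, X j ∈ M → (∀ i, z i ∈ M) → θ ∈ M →
        ∀ j, X j ∈ M :=
  exists_monomial_resolvents k Γ (fun j : ZMod 4 => (2 : ZMod 5) ^ j.val) (by decide) (by decide)
    (by decide) ![0, 1, -1, -1] ![-2, -1, -3, 1] ![1, 0, 1, -1] (-2) (by decide) (by decide)
    (by decide) hε (by simpa using h5) hX

theorem exists_monomial_resolvents_eleven {ε : AddChar (ZMod 11) Ω} (hε : ε.IsPrimitive)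
    (h11 : (11 : Ω) ≠ 0) {X : ZMod 11 → Ω} (hX : AlgebraicIndependent k X) :
    ∃ (z : ZMod 10 → Ω) (θ : Ω), θ ≠ 0 ∧
      (∀ (γ : Γ) (a b c : ZMod 11), a ≠ 0 → c ≠ 0 → (∀ j, γ • X j = X (a * j + b)) →
        (∀ i, γ • ε i = ε (c * i)) → ∃ m, ∀ i, γ • z i = z (i + m)) ∧
      (∀ (γ : Γ) (b : ZMod 11), (∀ j, γ • X j = X (j + b)) → (∀ i, γ • ε i = ε i) →
        (∀ i, γ • z i = z i) ∧ γ • θ = ε (-b) * θ) ∧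
      θ ^ 11 ∈ IntermediateField.adjoin k (Set.range z) ∧
      ∀ M : IntermediateField k Ω, (∀ i, ε i ∈ M) → ∑ j, X j ∈ M → (∀ i, z i ∈ M) → θ ∈ M →
        ∀ j, X j ∈ M :=
  exists_monomial_resolvents k Γ (fun j : ZMod 10 => (2 : ZMod 11) ^ j.val) (by decide) (by decide)
    (by decide) ![0, 0, 0, 0, 0, 0, 1, 0, -1, -1] ![-4, -2, -1, -6, 8, -7, 2, 1, -5, 3]
    ![1, 0, 0, 1, -2, 2, -1, 0, 1, -1] (-2) (by decide) (by decide) (by decide) hε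
    (by simpa using h11) hX

end Resolvents

section FixedGenerators

open Finset IntermediateField

section Stability

variable {k Ω Γ : Type*} [Field k] [Field Ω] [Algebra k Ω] [Group Γ] [MulSemiringAction Γ Ω]
  [SMulCommClass Γ k Ω] {L : IntermediateField k Ω} {s : Set Ω}

theorem IntermediateField.smul_mem_sup_adjoin (g : Γ) (hL : ∀ a ∈ L, g • a ∈ L ⊔ adjoin k s)
    (hs : ∀ a ∈ s, g • a ∈ L ⊔ adjoin k s) : ∀ a ∈ L ⊔ adjoin k s, g • a ∈ L ⊔ adjoin k s := by
  suffices L ⊔ adjoin k s ≤ (L ⊔ adjoin k s).comap (MulSemiringAction.toAlgHom k Ω g) from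
    fun a ha => this ha
  exact sup_le hL (adjoin_le_iff.mpr hs)

theorem IntermediateField.smul_eq_of_mem_sup_adjoin (g : Γ) (hL : ∀ a ∈ L, g • a = a)
    (hs : ∀ a ∈ s, g • a = a) : ∀ a ∈ L ⊔ adjoin k s, g • a = a := by
  suffices L ⊔ adjoin k s ≤ FixedPoints.intermediateField (Subgroup.zpowers g) by
    intro a ha
    exact this ha ⟨g, Subgroup.mem_zpowers g⟩
  have key : ∀ a : Ω, g • a = a → ∀ h : Subgroup.zpowers g, h • a = a := by
    rintro a ha ⟨h, hh⟩
    have : Subgroup.zpowers g ≤ MulAction.stabilizer Γ a := by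
      rw [Subgroup.zpowers_le]
      exact ha
    exact this hh
  exact sup_le (fun a ha => key a (hL a ha)) (adjoin_le_iff.mpr fun a ha => key a (hs a ha))

end Stability

namespace FixedGenBy

variable {k Ω Γ : Type*} [Field k] [Field Ω] [Algebra k Ω] [Group Γ] [MulSemiringAction Γ Ω]
  {L M : IntermediateField k Ω} {m n : ℕ}

theorem sup_kummer (h : FixedGenBy Γ L n) {p : ℕ} (hp : 0 < p) {η θ : Ω} (hη : IsPrimitiveRoot η p)
    (hηL : η ∈ L) (hθ : θ ≠ 0) (hθL : θ ^ p ∈ L) (γ : Γ) (hγ : ∀ a ∈ L, γ • a = a)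
    (hγθ : γ • θ = η * θ) : FixedGenBy Γ (L ⊔ adjoin k {θ}) n := by
  have hpow : ∀ i : ℕ, γ ^ i • θ = η ^ i * θ := by
    intro i
    induction i with
    | zero => simp
    | succ i ih =>
      rw [pow_succ', mul_smul, ih, smul_mul', smul_pow', hγ η hηL, hγθ]
      ring
  have hγpow : ∀ i : ℕ, ∀ a ∈ L, γ ^ i • a = a :=
    fun i a ha => pow_mem (show γ ∈ MulAction.stabilizer Γ a from hγ a ha) i
  refine h.sup_simple (ι := Fin p) (f := Polynomial.X ^ p - Polynomial.C ⟨θ ^ p, hθL⟩)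
    (Polynomial.monic_X_pow_sub_C _ hp.ne') ?_ (fun i => γ ^ (i : ℕ)) (fun i => hγpow i) ?_ ?_
  · simp
  · intro i j hij
    simp only [hpow] at hij
    exact Fin.ext (hη.pow_inj i.2 j.2 (mul_right_cancel₀ hθ hij))
  · simp

theorem sup_artinSchreier (h : FixedGenBy Γ L n) (p : ℕ) [hp : Fact p.Prime] [CharP Ω p] {r t : Ω}
    (hrL : r ∈ L) (hr : r ≠ 0) (htL : t ^ p - t ∈ L) (γ : Γ) (hγ : ∀ a ∈ L, γ • a = a)
    (hγt : γ • t = t + r) : FixedGenBy Γ (L ⊔ adjoin k {t}) n := by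
  have hpow : ∀ i : ℕ, γ ^ i • t = t + i * r := by
    intro i
    induction i with
    | zero => simp
    | succ i ih =>
      rw [pow_succ', mul_smul, ih, smul_add, smul_mul', hγ r hrL, hγt,
        hγ _ (_root_.natCast_mem L i)]
      push_cast
      ring
  have hγpow : ∀ i : ℕ, ∀ a ∈ L, γ ^ i • a = a :=
    fun i a ha => pow_mem (show γ ∈ MulAction.stabilizer Γ a from hγ a ha) i
  have hmonic := Polynomial.monic_X_pow_sub (p := Polynomial.X + Polynomial.C (⟨_, htL⟩ : L))
    (n := p) (by rw [Polynomial.degree_X_add_C]; exact_mod_cast hp.out.one_lt)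
  refine h.sup_simple (ι := Fin p) hmonic ?_ (fun i => γ ^ (i : ℕ)) (fun i => hγpow i) ?_ ?_
  · simp
  · intro i j hij
    simp only [hpow, add_right_inj] at hij
    exact Fin.ext (CharP.natCast_injOn_Iio Ω p i.2 j.2 (mul_right_cancel₀ hr hij))
  · rw [Polynomial.natDegree_sub_eq_left_of_natDegree_lt] <;>
    simp [hp.out.one_lt]

end FixedGenBy

theorem AddChar.IsPrimitive.isPrimitiveRoot {p : ℕ} [hp : Fact p.Prime] {Ω : Type*} [Field Ω]
    {ε : AddChar (ZMod p) Ω} (hε : ε.IsPrimitive) {b : ZMod p} (hb : b ≠ 0) :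
    IsPrimitiveRoot (ε b) p := by
  rw [IsPrimitiveRoot.iff_orderOf]
  refine orderOf_eq_prime ?_ fun h => hε hb ?_
  · rw [← AddChar.map_nsmul_eq_pow, nsmul_eq_mul, CharP.cast_eq_zero, zero_mul,
      AddChar.map_zero_eq_one]
  · ext x
    obtain ⟨n, rfl⟩ := ZMod.natCast_zmod_surjective x
    rw [AddChar.mulShift_apply, mul_comm, ← nsmul_eq_mul, AddChar.map_nsmul_eq_pow, h, one_pow,
      AddChar.one_apply]

theorem AlgebraicIndependent.sum_ne_zero {k Ω ι : Type*} [Fintype ι] [Nonempty ι] [Field k]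
    [Field Ω] [Algebra k Ω] {X : ι → Ω} (hX : AlgebraicIndependent k X) : ∑ i, X i ≠ 0 := by
  intro h
  have := Fintype.linearIndependent_iff.mp hX.linearIndependent (fun _ => 1) (by simpa using h)
  simpa using this (Classical.arbitrary ι)

theorem pow_smul_apply_of_smul_apply {Γ Ω A : Type*} [Monoid Γ] [MulAction Γ Ω] [AddGroup A]
    {X : A → Ω} {γ : Γ} {m : A} (h : ∀ j, γ • X j = X (j + m)) (n : ℕ) (j : A) :
    γ ^ n • X j = X (j + n • m) := by
  induction n generalizing j with
  | zero => simp
  | succ n ih => rw [pow_succ, mul_smul, h, ih, succ_nsmul', add_assoc]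

namespace FixedGenBy

variable {k Ω Γ : Type*} [Field k] [Field Ω] [Algebra k Ω] [Group Γ] [MulSemiringAction Γ Ω]
  [Finite Γ] [SMulCommClass Γ k Ω] {L : IntermediateField k Ω} {n : ℕ}

theorem sup_adjoin_of_charP_five [CharP Ω 5] (h : FixedGenBy Γ L n)
    (hL : ∀ g : Γ, ∀ a ∈ L, g • a ∈ L) {P : ZMod 5 → Ω} (hP : AlgebraicIndependent k P)
    (hact : ∀ g : Γ, ∃ m, ∀ j, g • P j = P (j + m)) (γ : Γ) (hγL : ∀ a ∈ L, γ • a = a)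
    {m : ZMod 5} (hm : m ≠ 0) (hγ : ∀ j, γ • P j = P (j + m)) :
    FixedGenBy Γ (L ⊔ adjoin k (Set.range P)) (n + 5) := by
  let ι : ZMod 5 →+* Ω := ZMod.castHom (dvd_refl 5) Ω
  have hι : Function.Injective ι := ι.injective
  set A := ∑ j, P j with hA
  set B := ∑ j, ι j * P j with hB
  have hA0 : A ≠ 0 := hP.sum_ne_zero
  have hιg : ∀ (g : Γ) j, g • ι j = ι j := by
    intro g j
    obtain ⟨j, rfl⟩ := ZMod.natCast_zmod_surjective j
    rw [map_natCast]
    exact map_natCast (MulSemiringAction.toRingHom Γ Ω g) j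
  have hgA : ∀ g : Γ, g • A = A := by
    intro g
    obtain ⟨m, hm⟩ := hact g
    rw [hA, smul_sum]
    exact Fintype.sum_equiv (Equiv.addRight m) _ _ hm
  have hgB : ∀ (g : Γ) m, (∀ j, g • P j = P (j + m)) → g • B = B - ι m * A := by
    intro g m hm
    rw [hB, smul_sum, eq_sub_iff_add_eq, hA, mul_sum,
      ← Equiv.sum_comp (Equiv.addRight m) (fun j => ι m * P j), ← sum_add_distrib]
    refine Fintype.sum_equiv (Equiv.addRight m) _ _ fun j => ?_
    rw [smul_mul', hιg, hm, Equiv.coe_addRight, map_add]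
    ring
  set t := B / A with ht
  have hgt : ∀ (g : Γ) m, (∀ j, g • P j = P (j + m)) → g • t = t - ι m := by
    intro g m hm
    have : g • (B / A) = g • B / g • A := map_div₀ (MulSemiringAction.toRingHom Γ Ω g) B A
    rw [ht, this, hgB g m hm, hgA, sub_div, mul_div_cancel_right₀ _ hA0]
  have hgf : ∀ g : Γ, g • (t ^ 5 - t) = t ^ 5 - t := by
    intro g
    obtain ⟨m, hm⟩ := hact g
    have hm5 : ι m ^ 5 = ι m := by rw [← map_pow, ZMod.pow_card]
    rw [smul_sub, smul_pow', hgt g m hm, sub_pow_char, hm5]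
    ring
  have hfix1 : ∀ (g : Γ) i, g • ![A, t ^ 5 - t] i = ![A, t ^ 5 - t] i := by
    intro g i
    fin_cases i
    exacts [hgA g, hgf g]
  have h1 := h.sup_adjoin hL ![A, t ^ 5 - t]
    (fun g i => by
      rw [hfix1]
      exact Submodule.subset_span (Set.mem_insert_of_mem _ ⟨i, rfl⟩))
    (fun g _ => hfix1 g)
  set L₁ := L ⊔ adjoin k (Set.range ![A, t ^ 5 - t]) with hL₁
  have hAL₁ : A ∈ L₁ := (le_sup_right : _ ≤ L₁) (subset_adjoin k _ ⟨0, rfl⟩)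
  have htL₁ : t ^ 5 - t ∈ L₁ := (le_sup_right : _ ≤ L₁) (subset_adjoin k _ ⟨1, rfl⟩)
  have hγL₁ : ∀ a ∈ L₁, γ • a = a := by
    refine smul_eq_of_mem_sup_adjoin γ hγL ?_
    rintro _ ⟨i, rfl⟩
    exact hfix1 γ i
  have hι1 : ∀ j, ι j ∈ L₁ := by
    intro j
    obtain ⟨j, rfl⟩ := ZMod.natCast_zmod_surjective j
    rw [map_natCast]
    exact _root_.natCast_mem L₁ j
  have h2 := h1.sup_artinSchreier 5 (r := -ι m) (neg_mem (hι1 m))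
    (neg_ne_zero.mpr ((map_ne_zero_iff ι hι).mpr hm)) htL₁ γ hγL₁
    (by rw [hgt γ m hγ, sub_eq_add_neg])
  set L₂ := L₁ ⊔ adjoin k {t} with hL₂
  have htL₂ : t ∈ L₂ := (le_sup_right : _ ≤ L₂) (mem_adjoin_simple_self k t)
  have hAL₂ : A ∈ L₂ := (le_sup_left : _ ≤ L₂) hAL₁
  have hBL₂ : B ∈ L₂ := by
    rw [← div_mul_cancel₀ B hA0]
    exact mul_mem htL₂ hAL₂
  have hstab₁ : ∀ g : Γ, ∀ a ∈ L₁, g • a ∈ L₁ := by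
    intro g
    refine smul_mem_sup_adjoin g (fun a ha => (le_sup_left : _ ≤ L₁) (hL g a ha)) ?_
    rintro _ ⟨i, rfl⟩
    rw [hfix1]
    exact (le_sup_right : _ ≤ L₁) (subset_adjoin k _ ⟨i, rfl⟩)
  have hstab : ∀ g : Γ, ∀ a ∈ L₂, g • a ∈ L₂ := by
    intro g
    refine smul_mem_sup_adjoin g (fun a ha => (le_sup_left : _ ≤ L₂) (hstab₁ g a ha)) ?_
    rintro _ rfl
    obtain ⟨m, hm⟩ := hact g
    rw [hgt g m hm]
    exact sub_mem htL₂ ((le_sup_left : _ ≤ L₂) (hι1 m))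
  have hAsum : A = P 0 + P 1 + P 2 + P 3 + P 4 := Fin.sum_univ_five P
  have hBsum : B = P 1 + 2 * P 2 + 3 * P 3 + 4 * P 4 := by
    have h5 : B = ι 0 * P 0 + ι 1 * P 1 + ι 2 * P 2 + ι 3 * P 3 + ι 4 * P 4 :=
      Fin.sum_univ_five fun j : ZMod 5 => ι j * P j
    rw [h5, map_zero, map_one, map_ofNat, map_ofNat, map_ofNat]
    ring
  have h4 : P 4 = B - 3 * A + 3 * P 0 + 2 * P 1 + P 2 := by
    rw [hAsum, hBsum]
    ring
  have h3 : P 3 = 4 * A - B - 4 * P 0 - 3 * P 1 - 2 * P 2 := by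
    rw [hAsum, hBsum]
    ring
  set V := Submodule.span L₂ (insert 1 (Set.range ![P 0, P 1, P 2])) with hV
  have hLV : ∀ a ∈ L₂, a ∈ V := by
    intro a ha
    have := V.smul_mem ⟨a, ha⟩ (Submodule.subset_span (Set.mem_insert 1 _))
    rwa [Algebra.smul_def, mul_one] at this
  have hPV : ∀ i, ![P 0, P 1, P 2] i ∈ V := fun i =>
    Submodule.subset_span (Set.mem_insert_of_mem _ ⟨i, rfl⟩)
  have hnV : ∀ (n : ℕ), ∀ v ∈ V, n * v ∈ V := fun n v hv => by
    rw [← nsmul_eq_mul]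
    exact V.nsmul_mem hv n
  have hV' : ∀ j, P j ∈ V := by
    have h0 : P 0 ∈ V := hPV 0
    have h1 : P 1 ∈ V := hPV 1
    have h2 : P 2 ∈ V := hPV 2
    intro j
    fin_cases j
    · exact h0
    · exact h1
    · exact h2
    · refine h3 ▸ sub_mem (sub_mem (sub_mem (sub_mem ?_ ?_) ?_) ?_) ?_
      exacts [hnV 4 _ (hLV A hAL₂), hLV B hBL₂, hnV 4 _ h0, hnV 3 _ h1, hnV 2 _ h2]
    · refine h4 ▸ add_mem (add_mem (add_mem (sub_mem ?_ ?_) ?_) ?_) ?_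
      exacts [hLV B hBL₂, hnV 3 _ (hLV A hAL₂), hnV 3 _ h0, hnV 2 _ h1, h2]
  have h5 := h2.sup_adjoin hstab ![P 0, P 1, P 2] (fun g i => ?_) (fun g hg i => ?_)
  · refine h5.anti (sup_le ((le_sup_left.trans le_sup_left).trans le_sup_left)
      (adjoin_le_iff.mpr ?_))
    set L₃ := L₂ ⊔ adjoin k (Set.range ![P 0, P 1, P 2]) with hL₃
    have hL₂₃ : ∀ a ∈ L₂, a ∈ L₃ := fun a ha => (le_sup_left : _ ≤ L₃) ha
    have hV₃ : V ≤ (extendScalars (le_sup_left : L₂ ≤ L₃)).toSubmodule := by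
      rw [hV, Submodule.span_le]
      rintro _ (rfl | ⟨i, rfl⟩)
      · exact one_mem L₃
      · exact (le_sup_right : _ ≤ L₃) (subset_adjoin k _ ⟨i, rfl⟩)
    rintro _ ⟨j, rfl⟩
    exact hV₃ (hV' j)
  · obtain ⟨m, hm⟩ := hact g
    fin_cases i
    exacts [(hm 0).symm ▸ hV' _, (hm 1).symm ▸ hV' _, (hm 2).symm ▸ hV' _]
  · obtain ⟨m, hm⟩ := hact g
    have hm0 : m = 0 := by
      have := hg t htL₂
      rw [hgt g m hm, sub_eq_self, map_eq_zero_iff ι hι] at this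
      exact this
    subst hm0
    have hm' : ∀ j, g • P j = P j := fun j => by simpa using hm j
    fin_cases i
    exacts [hm' 0, hm' 1, hm' 2]

theorem sup_adjoin_of_primitive_five {ε : AddChar (ZMod 5) Ω} (hε : ε.IsPrimitive)
    (h5 : (5 : Ω) ≠ 0) (hεL : ∀ i, ε i ∈ L)
    (hεact : ∀ g : Γ, ∃ c ≠ 0, ∀ i, g • ε i = ε (c * i)) (h : FixedGenBy Γ L n)
    (hL : ∀ g : Γ, ∀ a ∈ L, g • a ∈ L) {P : ZMod 5 → Ω} (hP : AlgebraicIndependent k P)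
    (hact : ∀ g : Γ, ∃ m, ∀ j, g • P j = P (j + m)) (γ : Γ) (hγL : ∀ a ∈ L, γ • a = a)
    {m : ZMod 5} (hm : m ≠ 0) (hγ : ∀ j, γ • P j = P (j + m)) :
    FixedGenBy Γ (L ⊔ adjoin k (Set.range P)) (n + 5) := by
  obtain ⟨w, θ, hθ, hw, hwθ, hθw, hgen⟩ := exists_monomial_resolvents_five k Γ hε h5 hP
  have hS : ∀ g : Γ, g • ∑ j, P j = ∑ j, P j := by
    intro g
    obtain ⟨m, hm⟩ := hact g
    rw [smul_sum]
    exact Fintype.sum_equiv (Equiv.addRight m) _ _ hm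
  let x : Fin 5 → Ω := Fin.cons (∑ j, P j) (fun i : Fin 4 => w i)
  have hwx : ∀ i, w i ∈ Set.range x := fun i => ⟨Fin.succ i, rfl⟩
  have hfix : ∀ g : Γ, (∀ a ∈ L, g • a = a) → ∀ i, g • x i = x i := by
    intro g hg i
    obtain ⟨m, hm⟩ := hact g
    refine Fin.cases (hS g) (fun i => ?_) i
    exact (hwθ g m hm fun i => hg _ (hεL i)).1 i
  have h1 := h.sup_adjoin hL x (fun g i => ?_) hfix
  · set L₁ := L ⊔ adjoin k (Set.range x) with hL₁
    have hxL₁ : ∀ a ∈ Set.range x, a ∈ L₁ := fun a ha =>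
      (le_sup_right : _ ≤ L₁) (subset_adjoin k _ ha)
    have hεL₁ : ∀ i, ε i ∈ L₁ := fun i => (le_sup_left : _ ≤ L₁) (hεL i)
    have h2 := h1.sup_kummer (by norm_num) (hε.isPrimitiveRoot (neg_ne_zero.mpr hm)) (hεL₁ _) hθ
      ((le_sup_right : _ ≤ L₁) (adjoin.mono k _ _ (Set.range_subset_iff.mpr hwx) hθw)) γ
      (smul_eq_of_mem_sup_adjoin γ hγL (Set.forall_mem_range.mpr (hfix γ hγL)))
      (hwθ γ m hγ fun i => hγL _ (hεL i)).2
    refine h2.anti (sup_le (le_sup_left.trans le_sup_left) (adjoin_le_iff.mpr ?_))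
    rintro _ ⟨j, rfl⟩
    have hle : ∀ a ∈ L₁, a ∈ L₁ ⊔ adjoin k {θ} := fun a ha => (le_sup_left : L₁ ≤ _) ha
    exact hgen _ (fun i => hle _ (hεL₁ i)) (hle _ (hxL₁ _ ⟨0, rfl⟩))
      (fun i => hle _ (hxL₁ _ (hwx i))) ((le_sup_right : _ ≤ L₁ ⊔ _) (mem_adjoin_simple_self k θ)) j
  · refine Submodule.subset_span (Set.mem_insert_of_mem _ ?_)
    refine Fin.cases ?_ (fun i => ?_) i
    · exact ⟨0, (hS g).symm⟩
    · obtain ⟨m, hm⟩ := hact g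
      obtain ⟨c, hc, hεc⟩ := hεact g
      obtain ⟨l, hl⟩ := hw g 1 m c one_ne_zero hc (by simpa using hm) hεc
      exact (hl i).symm ▸ hwx _

/-- The case of a cyclic action of order dividing five. -/
theorem sup_adjoin_zmod_five
    (hΩ : (5 : Ω) = 0 ∨ ∃ ε : AddChar (ZMod 5) Ω, ε.IsPrimitive ∧ (∀ i, ε i ∈ L) ∧
      ∀ g : Γ, ∃ c ≠ 0, ∀ i, g • ε i = ε (c * i)) (h : FixedGenBy Γ L n)
    (hL : ∀ g : Γ, ∀ a ∈ L, g • a ∈ L) {P : ZMod 5 → Ω} (hP : AlgebraicIndependent k P)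
    (hact : ∀ g : Γ, ∃ m, ∀ j, g • P j = P (j + m)) :
    FixedGenBy Γ (L ⊔ adjoin k (Set.range P)) (n + 5) := by
  by_cases hker : ∀ g : Γ, (∀ a ∈ L, g • a = a) → ∀ i, g • P i = P i
  · refine h.sup_adjoin hL (P : Fin 5 → Ω) (fun g i => ?_) hker
    obtain ⟨m, hm⟩ := hact g
    exact Submodule.subset_span (Set.mem_insert_of_mem _ ⟨_, (hm i).symm⟩)
  · push Not at hker
    obtain ⟨γ, hγL, i, hi⟩ := hker
    obtain ⟨m, hm⟩ := hact γ
    have hm0 : m ≠ 0 := by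
      rintro rfl
      exact hi (by simpa using hm i)
    by_cases h5 : (5 : Ω) = 0
    · have : CharP Ω 5 :=
        ringChar.of_eq (CharP.ringChar_of_prime_eq_zero (by norm_num) (by simpa using h5))
      exact h.sup_adjoin_of_charP_five hL hP hact γ hγL hm0 hm
    · obtain ⟨ε, hε, hεL, hεact⟩ := hΩ.resolve_left h5
      exact h.sup_adjoin_of_primitive_five hε h5 hεL hεact hL hP hact γ hγL hm0 hm

end FixedGenBy

namespace FixedGenBy

variable {k Ω Γ : Type*} [Field k] [Field Ω] [Algebra k Ω] [Group Γ] [MulSemiringAction Γ Ω]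
  [Finite Γ] [SMulCommClass Γ k Ω] {L : IntermediateField k Ω} {n : ℕ}

/-- The case of an action of order at most two. -/
theorem sup_adjoin_zmod_two (h : FixedGenBy Γ L n) (hL : ∀ g : Γ, ∀ a ∈ L, g • a ∈ L)
    {V : ZMod 2 → Ω} (hV : V 0 + V 1 ∈ L) (hact : ∀ g : Γ, ∃ m, ∀ j, g • V j = V (j + m)) :
    FixedGenBy Γ (L ⊔ adjoin k {V 0}) (n + 1) := by
  have hrange : Set.range ![V 0] = {V 0} := by simp
  by_cases hker : ∀ g : Γ, (∀ a ∈ L, g • a = a) → g • V 0 = V 0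
  · rw [← hrange]
    refine h.sup_adjoin hL ![V 0] (fun g i => ?_) (fun g hg i => ?_)
    · obtain ⟨m, hm⟩ := hact g
      have h0 : V 0 ∈ Submodule.span L (insert 1 (Set.range ![V 0])) :=
        Submodule.subset_span (by simp)
      have h1 : V 1 ∈ Submodule.span L (insert 1 (Set.range ![V 0])) := by
        have := Submodule.smul_mem _ (⟨_, hV⟩ : L)
          (Submodule.subset_span (R := L) (Set.mem_insert 1 (Set.range ![V 0])))
        rw [Algebra.smul_def, mul_one] at this
        have := sub_mem this h0
        rwa [show algebraMap L Ω ⟨_, hV⟩ = V 0 + V 1 from rfl, add_sub_cancel_left] at this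
      fin_cases i
      refine (hm 0).symm ▸ ?_
      fin_cases m
      exacts [h0, h1]
    · fin_cases i
      exact hker g hg
  · push Not at hker
    obtain ⟨γ, hγL, hγ⟩ := hker
    have hγ1 : γ • V 0 = V 1 := by
      obtain ⟨m, hm⟩ := hact γ
      fin_cases m
      · exact absurd (hm 0) hγ
      · exact hm 0
    have hfix : ∀ g : Γ, g • (V 0 * V 1) = V 0 * V 1 := by
      intro g
      obtain ⟨m, hm⟩ := hact g
      rw [smul_mul', hm, hm]
      fin_cases m
      · rfl
      · exact mul_comm _ _
    have hfix' : ∀ (g : Γ) i, g • ![V 0 * V 1] i = ![V 0 * V 1] i := by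
      intro g i
      fin_cases i
      exact hfix g
    have h1 := h.sup_adjoin hL ![V 0 * V 1]
      (fun g i => (hfix' g i).symm ▸ Submodule.subset_span (Set.mem_insert_of_mem _ ⟨i, rfl⟩))
      (fun g _ => hfix' g)
    set L₁ := L ⊔ adjoin k (Set.range ![V 0 * V 1]) with hL₁
    have hd : V 0 * V 1 ∈ L₁ := (le_sup_right : _ ≤ L₁) (subset_adjoin k _ ⟨0, rfl⟩)
    have hγL₁ : ∀ a ∈ L₁, γ • a = a :=
      smul_eq_of_mem_sup_adjoin γ hγL (Set.forall_mem_range.mpr (hfix' γ))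
    have hT : V 0 + V 1 ∈ L₁ := (le_sup_left : _ ≤ L₁) hV
    let f : Polynomial L₁ := Polynomial.X ^ 2 -
      (Polynomial.C ⟨_, hT⟩ * Polynomial.X - Polynomial.C ⟨_, hd⟩)
    have hdeg : (Polynomial.C (⟨_, hT⟩ : L₁) * Polynomial.X -
        Polynomial.C (⟨_, hd⟩ : L₁)).degree < 2 := by
      rw [sub_eq_add_neg, ← Polynomial.C_neg]
      exact Polynomial.degree_linear_le.trans_lt (by norm_num)
    refine (h1.sup_simple (ι := Fin 2) (f := f) (Polynomial.monic_X_pow_sub hdeg) ?_ ![1, γ]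
      ?_ ?_ ?_).anti (sup_le_sup_right le_sup_left _)
    · simp only [f, map_sub, map_pow, Polynomial.aeval_X, map_mul, Polynomial.aeval_C]
      rw [show algebraMap L₁ Ω ⟨_, hT⟩ = V 0 + V 1 from rfl,
        show algebraMap L₁ Ω ⟨_, hd⟩ = V 0 * V 1 from rfl]
      ring
    · intro i
      fin_cases i
      exacts [fun a _ => one_smul Γ a, hγL₁]
    · intro i j hij
      have h10 : V 1 ≠ V 0 := hγ1 ▸ hγ
      fin_cases i <;> fin_cases j
      · rfl
      · exact absurd (by simpa [hγ1] using hij.symm) h10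
      · exact absurd (by simpa [hγ1] using hij) h10
      · rfl
    · rw [Polynomial.natDegree_sub_eq_left_of_natDegree_lt]
      · simp
      · rw [Polynomial.natDegree_X_pow, sub_eq_add_neg, ← Polynomial.C_neg]
        exact Polynomial.natDegree_linear_le.trans_lt one_lt_two

/-- The case of a cyclic action of order dividing ten. -/
theorem sup_adjoin_zmod_two_prod_zmod_five
    (hΩ : (5 : Ω) = 0 ∨ ∃ ε : AddChar (ZMod 5) Ω, ε.IsPrimitive ∧ (∀ i, ε i ∈ L) ∧
      ∀ g : Γ, ∃ c ≠ 0, ∀ i, g • ε i = ε (c * i)) (h : FixedGenBy Γ L n)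
    (hL : ∀ g : Γ, ∀ a ∈ L, g • a ∈ L) {Z : ZMod 2 × ZMod 5 → Ω} (hZ : AlgebraicIndependent k Z)
    (hact : ∀ g : Γ, ∃ m, ∀ q, g • Z q = Z (q + m)) :
    FixedGenBy Γ (L ⊔ adjoin k (Set.range Z)) (n + 10) := by
  let P : ZMod 5 → Ω := fun j => ∑ a, Z (a, j)
  let V : ZMod 2 → Ω := fun a => ∑ j, Z (a, j)
  have hP2 : ∀ j, P j = Z (0, j) + Z (1, j) := fun j => Fin.sum_univ_two fun a : ZMod 2 => Z (a, j)
  have hP : AlgebraicIndependent k P := by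
    suffices AlgebraicIndependent k (Sum.elim P fun j => Z (0, j)) from
      this.comp Sum.inl Sum.inl_injective
    refine hZ.of_forall_isAlgebraic_adjoin (by simp) fun q => ?_
    set M := adjoin k (Set.range (Sum.elim P fun j => Z (0, j))) with hM
    have h0 : ∀ j, Z (0, j) ∈ M := fun j => subset_adjoin k _ ⟨Sum.inr j, rfl⟩
    have h1 : ∀ j, Z (1, j) ∈ M := fun j => by
      have : P j ∈ M := subset_adjoin k _ ⟨Sum.inl j, rfl⟩
      rw [eq_sub_of_add_eq' (hP2 j).symm]
      exact sub_mem this (h0 j)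
    have : Z q ∈ M := by
      obtain ⟨a, j⟩ := q
      fin_cases a
      exacts [h0 j, h1 j]
    exact isAlgebraic_algebraMap (⟨_, this⟩ : M)
  have hV01 : V 0 ≠ V 1 := by
    intro hV
    have hV' : ∑ q : ZMod 2 × ZMod 5, (if q.1 = 0 then (1 : k) else -1) • Z q = 0 := by
      rw [Fintype.sum_prod_type]
      refine (Fin.sum_univ_two fun a : ZMod 2 =>
        ∑ j, (if a = 0 then (1 : k) else -1) • Z (a, j)).trans ?_
      have h0 : ∑ j, (if (0 : ZMod 2) = 0 then (1 : k) else -1) • Z (0, j) = V 0 := by simp [V]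
      have h1 : ∑ j, (if (1 : ZMod 2) = 0 then (1 : k) else -1) • Z (1, j) = -V 1 := by simp [V]
      exact (congrArg₂ (· + ·) h0 h1).trans (by rw [hV, add_neg_cancel])
    simpa using Fintype.linearIndependent_iff.mp hZ.linearIndependent _ hV' (0, 0)
  have hgP : ∀ (g : Γ) m, (∀ q, g • Z q = Z (q + m)) → ∀ j, g • P j = P (j + m.2) := by
    intro g m hm j
    simp only [P, smul_sum, hm]
    exact Fintype.sum_equiv (Equiv.addRight m.1) _ _ fun _ => rfl
  have hgV : ∀ (g : Γ) m, (∀ q, g • Z q = Z (q + m)) → ∀ a, g • V a = V (a + m.1) := by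
    intro g m hm j
    simp only [V, smul_sum, hm]
    exact Fintype.sum_equiv (Equiv.addRight m.2) _ _ fun _ => rfl
  have hPact : ∀ g : Γ, ∃ m, ∀ j, g • P j = P (j + m) := fun g =>
    (hact g).elim fun m hm => ⟨m.2, hgP g m hm⟩
  have h5 := h.sup_adjoin_zmod_five hΩ hL hP hPact
  set L₅ := L ⊔ adjoin k (Set.range P) with hL₅
  have hPL₅ : ∀ j, P j ∈ L₅ := fun j => (le_sup_right : _ ≤ L₅) (subset_adjoin k _ ⟨j, rfl⟩)
  have hstab₅ : ∀ g : Γ, ∀ a ∈ L₅, g • a ∈ L₅ := by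
    intro g
    refine smul_mem_sup_adjoin g (fun a ha => (le_sup_left : _ ≤ L₅) (hL g a ha)) ?_
    rintro _ ⟨j, rfl⟩
    obtain ⟨m, hm⟩ := hPact g
    exact (hm j).symm ▸ hPL₅ _
  have hVL₅ : V 0 + V 1 ∈ L₅ := by
    have : V 0 + V 1 = ∑ j, P j := by
      simp only [V, hP2, sum_add_distrib]
    exact this ▸ sum_mem fun j _ => hPL₅ j
  have h6 := h5.sup_adjoin_zmod_two hstab₅ hVL₅ fun g =>
    (hact g).elim fun m hm => ⟨m.1, hgV g m hm⟩
  set L₆ := L₅ ⊔ adjoin k {V 0} with hL₆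
  have hV0 : V 0 ∈ L₆ := (le_sup_right : _ ≤ L₆) (mem_adjoin_simple_self k _)
  have hPL₆ : ∀ j, P j ∈ L₆ := fun j => (le_sup_left : _ ≤ L₆) (hPL₅ j)
  have hstab₆ : ∀ g : Γ, ∀ a ∈ L₆, g • a ∈ L₆ := by
    intro g
    refine smul_mem_sup_adjoin g (fun a ha => (le_sup_left : _ ≤ L₆) (hstab₅ g a ha)) ?_
    rintro _ rfl
    obtain ⟨m, hm⟩ := hact g
    rw [hgV g m hm]
    have : V 1 ∈ L₆ := by
      rw [← add_sub_cancel_left (V 0) (V 1)]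
      exact sub_mem ((le_sup_left : _ ≤ L₆) hVL₅) hV0
    obtain ⟨a, j⟩ := m
    fin_cases a
    exacts [hV0, this]
  let x : Fin 4 → Ω := ![Z (0, 0), Z (0, 1), Z (0, 2), Z (0, 3)]
  set W := Submodule.span L₆ (insert 1 (Set.range x)) with hW
  have hLW : ∀ a ∈ L₆, a ∈ W := by
    intro a ha
    have := W.smul_mem ⟨a, ha⟩ (Submodule.subset_span (Set.mem_insert 1 _))
    rwa [Algebra.smul_def, mul_one] at this
  have hxW : ∀ i, x i ∈ W := fun i => Submodule.subset_span (Set.mem_insert_of_mem _ ⟨i, rfl⟩)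
  have hZ4 : Z (0, 4) = V 0 - (Z (0, 0) + Z (0, 1) + Z (0, 2) + Z (0, 3)) := by
    rw [show V 0 = Z (0, 0) + Z (0, 1) + Z (0, 2) + Z (0, 3) + Z (0, 4) from
      Fin.sum_univ_five fun j : ZMod 5 => Z (0, j), add_sub_cancel_left]
  have hZ0W : ∀ j, Z (0, j) ∈ W := by
    intro j
    fin_cases j
    · exact hxW 0
    · exact hxW 1
    · exact hxW 2
    · exact hxW 3
    · exact hZ4 ▸ sub_mem (hLW _ hV0) (add_mem (add_mem (add_mem (hxW 0) (hxW 1)) (hxW 2)) (hxW 3))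
  have hZW : ∀ q, Z q ∈ W := by
    rintro ⟨a, j⟩
    fin_cases a
    · exact hZ0W j
    · exact eq_sub_of_add_eq' (hP2 j).symm ▸ sub_mem (hLW _ (hPL₆ j)) (hZ0W j)
  have hx : ∀ i, ∃ q, x i = Z q := by
    intro i
    fin_cases i
    exacts [⟨_, rfl⟩, ⟨_, rfl⟩, ⟨_, rfl⟩, ⟨_, rfl⟩]
  have h10 := h6.sup_adjoin hstab₆ x (fun g i => ?_) (fun g hg i => ?_)
  · refine h10.anti (sup_le ((le_sup_left.trans le_sup_left).trans le_sup_left)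
      (adjoin_le_iff.mpr ?_))
    have hWle :
        W ≤ (extendScalars (le_sup_left : L₆ ≤ L₆ ⊔ adjoin k (Set.range x))).toSubmodule := by
      rw [hW, Submodule.span_le]
      rintro _ (rfl | ⟨i, rfl⟩)
      · exact one_mem (L₆ ⊔ adjoin k (Set.range x))
      · exact (le_sup_right : _ ≤ L₆ ⊔ adjoin k (Set.range x)) (subset_adjoin k _ ⟨i, rfl⟩)
    rintro _ ⟨q, rfl⟩
    exact hWle (hZW q)
  · obtain ⟨m, hm⟩ := hact g
    obtain ⟨q, hq⟩ := hx i
    rw [hq, hm]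
    exact hZW _
  · obtain ⟨m, hm⟩ := hact g
    have hm2 : m.2 = 0 := by
      have := hg _ (hPL₆ 0)
      rw [hgP g m hm, zero_add] at this
      exact hP.injective this
    have hm1 : m.1 = 0 := by
      have := hg _ hV0
      rw [hgV g m hm, zero_add] at this
      obtain ⟨a, j⟩ := m
      fin_cases a
      · rfl
      · exact absurd this.symm hV01
    have hm0 : m = 0 := Prod.ext hm1 hm2
    obtain ⟨q, hq⟩ := hx i
    rw [hq, hm, hm0, add_zero]

theorem sup_adjoin_of_eleven_ne_zero
    (hΩ : (5 : Ω) = 0 ∨ ∃ ε : AddChar (ZMod 5) Ω, ε.IsPrimitive ∧ (∀ i, ε i ∈ L) ∧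
      ∀ g : Γ, ∃ c ≠ 0, ∀ i, g • ε i = ε (c * i))
    {ε : AddChar (ZMod 11) Ω} (hε : ε.IsPrimitive) (h11 : (11 : Ω) ≠ 0) (hεL : ∀ i, ε i ∈ L)
    (hεact : ∀ g : Γ, ∃ c ≠ 0, ∀ i, g • ε i = ε (c * i)) (h : FixedGenBy Γ L n)
    (hL : ∀ g : Γ, ∀ a ∈ L, g • a ∈ L) {X : ZMod 11 → Ω} (hX : AlgebraicIndependent k X)
    (hact : ∀ g : Γ, ∃ a ≠ 0, ∃ b, ∀ j, g • X j = X (a * j + b)) (γ : Γ)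
    (hγL : ∀ a ∈ L, γ • a = a) {b : ZMod 11} (hb : b ≠ 0) (hγ : ∀ j, γ • X j = X (j + b)) :
    FixedGenBy Γ (L ⊔ adjoin k (Set.range X)) (n + 11) := by
  obtain ⟨z, θ, hθ, hz, hzθ, hθz, hgen⟩ := exists_monomial_resolvents_eleven k Γ hε h11 hX
  have hS : ∀ g : Γ, g • ∑ j, X j = ∑ j, X j := by
    intro g
    obtain ⟨a, ha, b, hb⟩ := hact g
    rw [smul_sum]
    exact Fintype.sum_bijective (fun l => a * l + b)
      ((AddGroup.addRight_bijective b).comp (mulLeft_bijective₀ a ha)) _ _ hb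
  have hzind : AlgebraicIndependent k z := by
    suffices AlgebraicIndependent k (fun o : Option (ZMod 10) => o.elim (∑ j, X j) z) from
      this.comp some (Option.some_injective _)
    refine hX.of_forall_isAlgebraic_adjoin (by simp) fun j => ?_
    set M := adjoin k (Set.range fun o : Option (ZMod 10) => o.elim (∑ j, X j) z) with hM
    have hMalg : ∀ a ∈ M, a ∈ (algebraicClosure M Ω).restrictScalars k := fun a ha =>
      (algebraicClosure M Ω).algebraMap_mem ⟨a, ha⟩
    have hzM : ∀ i, z i ∈ M := fun i => subset_adjoin k _ ⟨some i, rfl⟩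
    refine mem_algebraicClosure_iff.mp (hgen ((algebraicClosure M Ω).restrictScalars k)
      (fun i => mem_algebraicClosure_iff.mpr (ε.isAlgebraic_apply M i))
      (hMalg _ (subset_adjoin k _ ⟨none, rfl⟩)) (fun i => hMalg _ (hzM i)) ?_ j)
    have : θ ^ 11 ∈ M := adjoin_le_iff.mpr (Set.range_subset_iff.mpr hzM) hθz
    exact mem_algebraicClosure_iff.mpr
      ((isAlgebraic_algebraMap (⟨_, this⟩ : M)).of_pow (by norm_num))
  let φ : ZMod 10 ≃+* ZMod 2 × ZMod 5 := ZMod.chineseRemainder (m := 2) (n := 5) (by norm_num)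
  have hzact : ∀ g : Γ, ∃ m, ∀ i, g • z i = z (i + m) := by
    intro g
    obtain ⟨a, ha, b, hb⟩ := hact g
    obtain ⟨c, hc, hεc⟩ := hεact g
    exact hz g a b c ha hc hb hεc
  have h10 := h.sup_adjoin_zmod_two_prod_zmod_five (Z := z ∘ φ.symm) hΩ hL
    (hzind.comp _ φ.symm.injective) fun g => by
      obtain ⟨m, hm⟩ := hzact g
      exact ⟨φ m, fun q => by simp [hm]⟩
  rw [φ.symm.surjective.range_comp] at h10
  set L₁ := L ⊔ adjoin k (Set.range z) with hL₁
  have hzL₁ : ∀ i, z i ∈ L₁ := fun i => (le_sup_right : _ ≤ L₁) (subset_adjoin k _ ⟨i, rfl⟩)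
  have hstab : ∀ g : Γ, ∀ a ∈ L₁, g • a ∈ L₁ := by
    intro g
    refine smul_mem_sup_adjoin g (fun a ha => (le_sup_left : _ ≤ L₁) (hL g a ha)) ?_
    rintro _ ⟨i, rfl⟩
    obtain ⟨m, hm⟩ := hzact g
    exact (hm i).symm ▸ hzL₁ _
  have hS' : ∀ (g : Γ) i, g • ![∑ j, X j] i = ![∑ j, X j] i := by
    intro g i
    fin_cases i
    exact hS g
  have h11 := h10.sup_adjoin hstab ![∑ j, X j]
    (fun g i => (hS' g i).symm ▸ Submodule.subset_span (Set.mem_insert_of_mem _ ⟨i, rfl⟩))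
    (fun g _ => hS' g)
  set L₂ := L₁ ⊔ adjoin k (Set.range ![∑ j, X j]) with hL₂
  have hL₁₂ : ∀ a ∈ L₁, a ∈ L₂ := fun a ha => (le_sup_left : _ ≤ L₂) ha
  have hεL₂ : ∀ i, ε i ∈ L₂ := fun i => hL₁₂ _ ((le_sup_left : _ ≤ L₁) (hεL i))
  have hγ' := hzθ γ b hγ fun i => hγL _ (hεL i)
  have h12 := h11.sup_kummer (by norm_num) (hε.isPrimitiveRoot (neg_ne_zero.mpr hb)) (hεL₂ _) hθ
    (hL₁₂ _ ((le_sup_right : _ ≤ L₁) hθz)) γ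
    (smul_eq_of_mem_sup_adjoin γ (smul_eq_of_mem_sup_adjoin γ hγL
      (Set.forall_mem_range.mpr hγ'.1)) (Set.forall_mem_range.mpr (hS' γ))) hγ'.2
  refine h12.anti (sup_le ((le_sup_left.trans le_sup_left).trans le_sup_left)
    (adjoin_le_iff.mpr ?_))
  rintro _ ⟨j, rfl⟩
  have hle : ∀ a ∈ L₂, a ∈ L₂ ⊔ adjoin k {θ} := fun a ha => (le_sup_left : L₂ ≤ _) ha
  exact hgen _ (fun i => hle _ (hεL₂ i))
    (hle _ ((le_sup_right : _ ≤ L₂) (subset_adjoin k _ ⟨0, rfl⟩)))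
    (fun i => hle _ (hL₁₂ _ (hzL₁ i))) ((le_sup_right : _ ≤ L₂ ⊔ _) (mem_adjoin_simple_self k θ)) j

end FixedGenBy

namespace FixedGenBy

variable {k Ω Γ : Type*} [Field k] [Field Ω] [Algebra k Ω] [Group Γ] [MulSemiringAction Γ Ω]
  [Finite Γ] [SMulCommClass Γ k Ω] {L : IntermediateField k Ω} {n : ℕ}

/-- If `Γ` acts on `t` through a character with values in the units of the prime field,
adjoining `t` costs a single generator. -/
theorem sup_adjoin_character (p : ℕ) [Fact p.Prime] [Algebra (ZMod p) Ω]
    (h : FixedGenBy Γ L n) (hL : ∀ g : Γ, ∀ a ∈ L, g • a = a) {f : Ω} (hf : f ≠ 0)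
    (hact : ∀ g : Γ, ∃ c : (ZMod p)ˣ, g • f = algebraMap (ZMod p) Ω c * f) :
    FixedGenBy Γ (L ⊔ adjoin k {f}) (n + 1) := by
  let ι := algebraMap (ZMod p) Ω
  have hι : ∀ (g : Γ) j, g • ι j = ι j := by
    intro g j
    obtain ⟨j, rfl⟩ := ZMod.natCast_zmod_surjective j
    rw [map_natCast]
    exact map_natCast (MulSemiringAction.toRingHom Γ Ω g) j
  let H : Subgroup (ZMod p)ˣ :=
    { carrier := {c | ∃ g : Γ, g • f = ι c * f}
      one_mem' := ⟨1, by simp⟩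
      mul_mem' := by
        rintro c d ⟨g, hg⟩ ⟨g', hg'⟩
        exact ⟨g * g', by rw [mul_smul, hg', smul_mul', hι, hg, Units.val_mul, map_mul]; ring⟩
      inv_mem' := by
        rintro c ⟨g, hg⟩
        refine ⟨g⁻¹, ?_⟩
        rw [inv_smul_eq_iff, smul_mul', hι, hg, ← mul_assoc, ← map_mul, Units.inv_mul, map_one,
          one_mul] }
  have : Fintype H := Fintype.ofFinite H
  have hd : 0 < Nat.card H := Nat.card_pos
  have hfix : ∀ (g : Γ) i, g • ![f ^ Nat.card H] i = ![f ^ Nat.card H] i := by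
    intro g i
    obtain ⟨c, hc⟩ := hact g
    have hcH : c ^ Nat.card H = 1 :=
      congrArg Subtype.val (pow_card_eq_one' (x := (⟨c, g, hc⟩ : H)))
    fin_cases i
    change g • f ^ Nat.card H = f ^ Nat.card H
    rw [smul_pow', hc, mul_pow, ← map_pow, ← Units.val_pow_eq_pow_val, hcH, Units.val_one, map_one,
      one_mul]
  have h1 := h.sup_adjoin (fun g a ha => (hL g a ha).symm ▸ ha) ![f ^ Nat.card H]
    (fun g i => (hfix g i).symm ▸ Submodule.subset_span (Set.mem_insert_of_mem _ ⟨i, rfl⟩))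
    (fun g _ => hfix g)
  set L₁ := L ⊔ adjoin k (Set.range ![f ^ Nat.card H]) with hL₁
  have hfL₁ : f ^ Nat.card H ∈ L₁ := (le_sup_right : _ ≤ L₁) (subset_adjoin k _ ⟨0, rfl⟩)
  choose γ hγ using fun c : H => c.2
  refine (h1.sup_simple (ι := H) (Polynomial.monic_X_pow_sub_C (⟨_, hfL₁⟩ : L₁) hd.ne') ?_ γ
    (fun c => smul_eq_of_mem_sup_adjoin _ (hL _) (Set.forall_mem_range.mpr (hfix _))) ?_ ?_).anti
    (sup_le_sup_right le_sup_left _)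
  · simp
  · intro c d hcd
    simp only [hγ] at hcd
    exact Subtype.ext (Units.ext (ι.injective (mul_right_cancel₀ hf hcd)))
  · simp [Nat.card_eq_fintype_card]

theorem sup_adjoin_of_charP_eleven [CharP Ω 11] (h : FixedGenBy Γ L n)
    (hL : ∀ g : Γ, ∀ a ∈ L, g • a = a) {X : ZMod 11 → Ω} (hX : AlgebraicIndependent k X)
    (hact : ∀ g : Γ, ∃ a ≠ 0, ∃ b, ∀ j, g • X j = X (a * j + b)) (γ : Γ)
    {b : ZMod 11} (hb : b ≠ 0) (hγ : ∀ j, γ • X j = X (j + b)) :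
    FixedGenBy Γ (L ⊔ adjoin k (Set.range X)) (n + 11) := by
  let _ : Algebra (ZMod 11) Ω := ZMod.algebra Ω 11
  set ι := algebraMap (ZMod 11) Ω with hιdef
  have hι : Function.Injective ι := ι.injective
  set A := ∑ j, X j with hA
  set B := ∑ j, ι j * X j with hB
  have hA0 : A ≠ 0 := hX.sum_ne_zero
  have hιg : ∀ (g : Γ) j, g • ι j = ι j := by
    intro g j
    obtain ⟨j, rfl⟩ := ZMod.natCast_zmod_surjective j
    rw [map_natCast]
    exact map_natCast (MulSemiringAction.toRingHom Γ Ω g) j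
  have hbij : ∀ a b : ZMod 11, a ≠ 0 → Function.Bijective fun j => a * j + b := fun a b ha =>
    (AddGroup.addRight_bijective b).comp (mulLeft_bijective₀ a ha)
  have hgA : ∀ g : Γ, g • A = A := by
    intro g
    obtain ⟨a, ha, b, hm⟩ := hact g
    rw [hA, smul_sum]
    exact Fintype.sum_bijective _ (hbij a b ha) _ _ hm
  have hgB : ∀ (g : Γ) a b, a ≠ 0 → (∀ j, g • X j = X (a * j + b)) →
      ι a * g • B = B - ι b * A := by
    intro g a b ha hm
    rw [hB, smul_sum, eq_sub_iff_add_eq, hA, mul_sum, mul_sum,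
      ← (hbij a b ha).sum_comp (fun j => ι b * X j), ← sum_add_distrib]
    refine Fintype.sum_bijective _ (hbij a b ha) _ _ fun j => ?_
    rw [smul_mul', hιg, hm, map_add, map_mul]
    ring
  set t := B / A with ht
  have hgt : ∀ (g : Γ) a b, a ≠ 0 → (∀ j, g • X j = X (a * j + b)) →
      ι a * g • t = t - ι b := by
    intro g a b ha hm
    have : g • (B / A) = g • B / g • A := map_div₀ (MulSemiringAction.toRingHom Γ Ω g) B A
    rw [ht, this, hgA, ← mul_div_assoc, hgB g a b ha hm, sub_div, mul_div_cancel_right₀ _ hA0]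
  have hγt : γ • t = t - ι b := by
    simpa using hgt γ 1 b one_ne_zero (by simpa using hγ)
  have htι : ∀ c, t ≠ ι c := by
    intro c hc
    rw [hc, hιg, eq_comm, sub_eq_self, map_eq_zero_iff ι hι] at hγt
    exact hb hγt
  have hι11 : ∀ c, ι c ^ 11 = ι c := fun c => by rw [← map_pow, ZMod.pow_card]
  have hgf : ∀ g : Γ, ∃ c : (ZMod 11)ˣ, g • (t ^ 11 - t) = ι c * (t ^ 11 - t) := by
    intro g
    obtain ⟨a, ha, b, hm⟩ := hact g
    have h1 := hgt g a b ha hm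
    have h2 : ι a * g • (t ^ 11 - t) = t ^ 11 - t := by
      rw [smul_sub, smul_pow', mul_sub]
      nth_rewrite 1 [← hι11]
      rw [← mul_pow, h1, sub_pow_char, hι11]
      ring
    refine ⟨(Units.mk0 a ha)⁻¹, ?_⟩
    rw [← h2, Units.val_inv_eq_inv_val, Units.val_mk0, ← mul_assoc, ← map_mul, inv_mul_cancel₀ ha,
      map_one, one_mul, h2]
  have hf0 : t ^ 11 - t ≠ 0 := by
    intro hf
    rw [sub_eq_zero, ← Subfield.mem_bot_iff_pow_eq_self, ← SetLike.mem_coe] at hf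
    obtain ⟨c, hc⟩ := (_root_.mem_bot_iff_intCast 11 Ω).mp hf
    exact htι c (by rw [map_intCast, hc])
  have h1 := h.sup_adjoin (fun g a ha => (hL g a ha).symm ▸ ha) ![A]
    (fun g i => Submodule.subset_span (Set.mem_insert_of_mem _
      ⟨i, by fin_cases i; exact (hgA g).symm⟩))
    (fun g _ i => by fin_cases i; exact hgA g)
  have hL₁ : ∀ g : Γ, ∀ a ∈ L ⊔ adjoin k (Set.range ![A]), g • a = a := fun g =>
    smul_eq_of_mem_sup_adjoin g (hL g) (by rintro _ ⟨i, rfl⟩; fin_cases i; exact hgA g)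
  have hAL₁ : A ∈ L ⊔ adjoin k (Set.range ![A]) :=
    (le_sup_right : adjoin k (Set.range ![A]) ≤ _) (subset_adjoin k _ ⟨0, rfl⟩)
  have hLL₁ : L ≤ L ⊔ adjoin k (Set.range ![A]) := le_sup_left
  generalize L ⊔ adjoin k (Set.range ![A]) = L₁ at h1 hL₁ hAL₁ hLL₁
  have h2 := h1.sup_adjoin_character 11 hL₁ hf0 hgf
  set L₂ := L₁ ⊔ adjoin k {t ^ 11 - t} with hL₂
  have htL₂ : t ^ 11 - t ∈ L₂ := (le_sup_right : _ ≤ L₂) (mem_adjoin_simple_self k _)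
  have hιL : ∀ (M : IntermediateField k Ω) j, ι j ∈ M := by
    intro M j
    obtain ⟨j, rfl⟩ := ZMod.natCast_zmod_surjective j
    rw [map_natCast]
    exact _root_.natCast_mem M j
  have hstab₂ : ∀ g : Γ, ∀ a ∈ L₂, g • a ∈ L₂ := by
    intro g
    refine smul_mem_sup_adjoin g (fun a ha => (hL₁ g a ha).symm ▸ (le_sup_left : _ ≤ L₂) ha) ?_
    rintro _ rfl
    obtain ⟨c, hc⟩ := hgf g
    exact hc ▸ mul_mem (hιL L₂ _) htL₂
  have hγL₂ : ∀ a ∈ L₂, γ • a = a := by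
    refine smul_eq_of_mem_sup_adjoin γ (hL₁ γ) ?_
    rintro _ rfl
    rw [smul_sub, smul_pow', hγt, sub_pow_char, hι11]
    ring
  have h3 := h2.sup_artinSchreier 11 (neg_mem (hιL _ b))
    (neg_ne_zero.mpr ((map_ne_zero_iff ι hι).mpr hb)) htL₂ γ hγL₂ (by rw [hγt, sub_eq_add_neg])
  set L₃ := L₂ ⊔ adjoin k {t} with hL₃
  have htL₃ : t ∈ L₃ := (le_sup_right : _ ≤ L₃) (mem_adjoin_simple_self k t)
  have hAL₃ : A ∈ L₃ := (le_sup_left : _ ≤ L₃) ((le_sup_left : _ ≤ L₂) hAL₁)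
  have hBL₃ : B ∈ L₃ := by
    rw [← div_mul_cancel₀ B hA0]
    exact mul_mem htL₃ hAL₃
  have hstab : ∀ g : Γ, ∀ a ∈ L₃, g • a ∈ L₃ := by
    intro g
    refine smul_mem_sup_adjoin g (fun a ha => (le_sup_left : _ ≤ L₃) (hstab₂ g a ha)) ?_
    rintro _ rfl
    obtain ⟨a, ha, b, hm⟩ := hact g
    have : g • t = ι a⁻¹ * (t - ι b) := by
      rw [← hgt g a b ha hm, ← mul_assoc, ← map_mul, inv_mul_cancel₀ ha, map_one, one_mul]
    rw [this]
    exact mul_mem (hιL L₃ _) (sub_mem htL₃ (hιL L₃ _))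
  let x : Fin 9 → Ω := fun i => X (i.val + 2)
  set V := Submodule.span L₃ (insert 1 (Set.range x)) with hV
  have hLV : ∀ a ∈ L₃, ∀ v ∈ V, a * v ∈ V := fun a ha v hv => V.smul_mem ⟨a, ha⟩ hv
  have hLV' : ∀ a ∈ L₃, a ∈ V := fun a ha =>
    mul_one a ▸ hLV a ha 1 (Submodule.subset_span (Set.mem_insert 1 _))
  have hxV : ∀ j, j ≠ 0 → j ≠ 1 → X j ∈ V := by
    intro j h0 h1
    have : ∀ j : ZMod 11, j ≠ 0 → j ≠ 1 → ∃ i : Fin 9, (i.val + 2 : ZMod 11) = j := by decide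
    obtain ⟨i, rfl⟩ := this j h0 h1
    exact Submodule.subset_span (Set.mem_insert_of_mem _ ⟨i, rfl⟩)
  have hX1 : X 1 ∈ V := by
    have : B = X 1 + ∑ j ∈ univ.erase 1, ι j * X j := by
      rw [hB, ← add_sum_erase _ _ (mem_univ 1), map_one, one_mul]
    rw [eq_sub_of_add_eq this.symm]
    refine sub_mem (hLV' _ hBL₃) (sum_mem fun j hj => ?_)
    obtain rfl | h0 := eq_or_ne j 0
    · simp
    · exact hLV _ (hιL L₃ j) _ (hxV j h0 (ne_of_mem_erase hj))
  have hX0 : X 0 ∈ V := by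
    have : A = X 0 + ∑ j ∈ univ.erase 0, X j := by
      rw [hA, ← add_sum_erase _ _ (mem_univ 0)]
    rw [eq_sub_of_add_eq this.symm]
    refine sub_mem (hLV' _ hAL₃) (sum_mem fun j hj => ?_)
    obtain rfl | h1 := eq_or_ne j 1
    · exact hX1
    · exact hxV j (ne_of_mem_erase hj) h1
  have hXV : ∀ j, X j ∈ V := by
    intro j
    obtain rfl | h0 := eq_or_ne j 0
    · exact hX0
    obtain rfl | h1 := eq_or_ne j 1
    exacts [hX1, hxV j h0 h1]
  have h4 := h3.sup_adjoin hstab x (fun g i => ?_) (fun g hg i => ?_)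
  · refine h4.anti (sup_le ((hLL₁.trans (le_sup_left.trans le_sup_left)).trans le_sup_left)
      (adjoin_le_iff.mpr ?_))
    have hVle :
        V ≤ (extendScalars (le_sup_left : L₃ ≤ L₃ ⊔ adjoin k (Set.range x))).toSubmodule := by
      rw [hV, Submodule.span_le]
      rintro _ (rfl | ⟨i, rfl⟩)
      · exact one_mem (L₃ ⊔ adjoin k (Set.range x))
      · exact (le_sup_right : _ ≤ L₃ ⊔ adjoin k (Set.range x)) (subset_adjoin k _ ⟨i, rfl⟩)
    rintro _ ⟨j, rfl⟩
    exact hVle (hXV j)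
  · obtain ⟨a, ha, b, hm⟩ := hact g
    exact (hm _).symm ▸ hXV _
  · obtain ⟨a, ha, b, hm⟩ := hact g
    have h1 := hgt g a b ha hm
    rw [hg t htL₃] at h1
    have ha1 : a = 1 := by
      by_contra ha1
      have h2 : (1 - a) ≠ 0 := sub_ne_zero.mpr (Ne.symm ha1)
      refine htι ((1 - a)⁻¹ * b) ?_
      rw [map_mul, map_inv₀, eq_inv_mul_iff_mul_eq₀ ((map_ne_zero_iff ι hι).mpr h2),
        map_sub, map_one, sub_mul, h1, one_mul]
      ring
    rw [ha1, map_one, one_mul, eq_comm, sub_eq_self, map_eq_zero_iff ι hι] at h1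
    rw [show x i = X (i.val + 2) from rfl, hm, ha1, h1, one_mul, add_zero]

end FixedGenBy

end FixedGenerators

section Descent

open IntermediateField

theorem AlgebraicIndependent.mem_bot_of_isAlgebraic {ι k K : Type*} [Field k] [Field K]
    [Algebra k K] {X : ι → K} (hX : AlgebraicIndependent k X) {v : K}
    (hv : v ∈ adjoin k (Set.range X)) (halg : IsAlgebraic k v) :
    v ∈ (⊥ : IntermediateField k K) := by
  have hint : IsIntegral k (hX.reprField ⟨v, hv⟩) :=
    IsIntegral.map _ (isIntegral_iff.mpr halg.isIntegral)
  obtain ⟨p, hp⟩ := IsIntegrallyClosed.isIntegral_iff.mp (hint.tower_top (A := MvPolynomial ι k))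
  have hpint : IsIntegral k p :=
    (isIntegral_algebraMap_iff (IsFractionRing.injective (MvPolynomial ι k) _)).mp (hp ▸ hint)
  have hC : ∃ r, p = MvPolynomial.C r := by
    obtain rfl | h0 := eq_or_ne p 0
    · exact ⟨0, (map_zero _).symm⟩
    · obtain ⟨r, -, hr⟩ := MvPolynomial.isUnit_iff_eq_C_of_isReduced.mp (hpint.isUnit h0)
      exact ⟨r, hr⟩
  obtain ⟨r, rfl⟩ := hC
  refine mem_bot.mpr ⟨r, ?_⟩
  have h1 : hX.reprField (algebraMap k _ r) = hX.reprField ⟨v, hv⟩ := by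
    rw [AlgHom.commutes, ← hp, ← MvPolynomial.algebraMap_eq, ← IsScalarTower.algebraMap_apply]
  exact congrArg Subtype.val (hX.reprField.injective h1)

theorem AddChar.IsPrimitive.exists_smul_eq {p : ℕ} [Fact p.Prime] {Γ Ω : Type*} [Group Γ]
    [Field Ω] [MulSemiringAction Γ Ω] {ε : AddChar (ZMod p) Ω} (hε : ε.IsPrimitive) (g : Γ) :
    ∃ c ≠ 0, ∀ i, g • ε i = ε (c * i) := by
  have hprim : IsPrimitiveRoot (ε 1) p := hε.isPrimitiveRoot one_ne_zero
  have hval : ∀ i : ZMod p, ε i = ε 1 ^ i.val := fun i => by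
    rw [← AddChar.map_nsmul_eq_pow, nsmul_one, ZMod.natCast_zmod_val]
  obtain ⟨n, -, hn⟩ := hprim.eq_pow_of_pow_eq_one (ξ := g • ε 1)
    (by rw [← smul_pow', hprim.pow_eq_one, smul_one])
  have hg : ∀ i, g • ε i = ε (n * i) := fun i => by
    rw [hval i, smul_pow', ← hn, ← pow_mul, ← AddChar.map_nsmul_eq_pow, nsmul_one, Nat.cast_mul,
      ZMod.natCast_zmod_val]
  refine ⟨n, fun h0 => ?_, hg⟩
  have : g • ε 1 = 1 := by rw [hg, h0, zero_mul, AddChar.map_zero_eq_one]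
  rw [smul_eq_iff_eq_inv_smul, smul_one] at this
  exact hprim.ne_one (Nat.Prime.one_lt Fact.out) this

theorem pow_smul_eq_self_of_pow_eq_one {p : ℕ} [Fact p.Prime] {Γ Ω : Type*} [Group Γ]
    [Field Ω] [MulSemiringAction Γ Ω] {x : Ω} (hx : x ^ p = 1) (g : Γ) : g ^ (p - 1) • x = x := by
  obtain rfl | h1 := eq_or_ne x 1
  · exact smul_one _
  have hprim : IsPrimitiveRoot x p := IsPrimitiveRoot.iff_orderOf.mpr (orderOf_eq_prime hx h1)
  have hε := AddChar.zmodChar_primitive_of_primitive_root p hprim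
  obtain ⟨c, hc, hg⟩ := hε.exists_smul_eq g
  have hpow : ∀ (n : ℕ) i, g ^ n • AddChar.zmodChar p hx i = AddChar.zmodChar p hx (c ^ n * i) := by
    intro n
    induction n with
    | zero => simp
    | succ n ih =>
      intro i
      rw [pow_succ, mul_smul, hg, ih, pow_succ, mul_assoc]
  have h2 := hpow (p - 1) 1
  rwa [ZMod.pow_card_sub_one_eq_one hc, one_mul, AddChar.zmodChar_apply, ZMod.val_one,
    pow_one] at h2

theorem AlgebraicIndependent.coe_finset_of_isAlgebraic {ι k K : Type*} [Fintype ι] [Field k]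
    [Field K] [Algebra k K] {X : ι → K} (hX : AlgebraicIndependent k X) {s : Finset K}
    (hs : s.card ≤ Fintype.card ι) (halg : Algebra.IsAlgebraic (adjoin k (s : Set K)) K) :
    AlgebraicIndependent k ((↑) : s → K) := by
  refine hX.of_forall_isAlgebraic_adjoin (by simpa using hs) fun i => ?_
  rw [show Set.range ((↑) : s → K) = s from Subtype.range_coe]
  exact halg.isAlgebraic _

theorem FixedGenBy.exists_finset {k F Ω Γ : Type*} [Field k] [Field F] [Field Ω] [Algebra k F]
    [Algebra F Ω] [Algebra k Ω] [IsScalarTower k F Ω] [Group Γ] [MulSemiringAction Γ Ω]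
    {M : IntermediateField k Ω} {n : ℕ} (h : FixedGenBy Γ M n)
    (hfix : ∀ u : Ω, (∀ g : Γ, g • u = u) ↔ u ∈ Set.range (algebraMap F Ω))
    (hM : ∀ u : F, algebraMap F Ω u ∈ M) :
    ∃ s : Finset F, s.card ≤ n ∧ adjoin k (s : Set F) = ⊤ := by
  classical
  obtain ⟨s, hs, hsfix, hgen⟩ := h
  have hinj : Function.Injective (algebraMap F Ω) := (algebraMap F Ω).injective
  refine ⟨s.preimage (algebraMap F Ω) hinj.injOn, ?_, ?_⟩
  · exact (Finset.card_le_card_of_injOn _ (fun a ha => Finset.mem_preimage.mp ha) hinj.injOn).trans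
      hs
  · refine eq_top_iff.mpr fun u _ => ?_
    have hu := hgen _ (hM u) ((hfix _).mpr ⟨u, rfl⟩)
    have himg : (s : Set Ω) = IsScalarTower.toAlgHom k F Ω '' (algebraMap F Ω ⁻¹' s) :=
      (Set.image_preimage_eq_of_subset fun t ht => (hfix t).mp (hsfix t ht)).symm
    rw [himg, ← adjoin_map] at hu
    obtain ⟨v, hv, hvu⟩ := hu
    rw [Finset.coe_preimage]
    exact hinj hvu ▸ hv

theorem exists_finset_adjoin_eq_top_of_charP_eleven {k F K : Type*} [Field k] [Field F] [Field K]
    [Algebra k F] [Algebra F K] [Algebra k K] [IsScalarTower k F K] [FiniteDimensional F K]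
    [IsGalois F K] [CharP K 11] {X : ZMod 11 → K} (hX : AlgebraicIndependent k X)
    (htop : adjoin k (Set.range X) = ⊤)
    (hact : ∀ g : K ≃ₐ[F] K, ∃ a ≠ 0, ∃ b, ∀ j, g (X j) = X (a * j + b))
    {σ : K ≃ₐ[F] K} (hσ : ∀ j, σ (X j) = X (j + 1)) :
    ∃ s : Finset F, s.card ≤ 11 ∧ adjoin k (s : Set F) = ⊤ := by
  have : SMulCommClass (K ≃ₐ[F] K) k K := ⟨fun g c u => g.toLinearMap.map_smul_of_tower c u⟩
  have hbot : ∀ g : K ≃ₐ[F] K, ∀ a ∈ (⊥ : IntermediateField k K), g • a = a := by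
    intro g a ha
    obtain ⟨c, rfl⟩ := mem_bot.mp ha
    exact smul_algebraMap g c
  have h0 : FixedGenBy (K ≃ₐ[F] K) (⊥ : IntermediateField k K) 0 :=
    ⟨∅, le_rfl, by simp, fun u hu _ => by simpa using hu⟩
  have h1 := h0.sup_adjoin_of_charP_eleven hbot hX hact σ one_ne_zero hσ
  rw [bot_sup_eq, htop] at h1
  exact h1.exists_finset (fun u => (IsGalois.mem_range_algebraMap_iff_fixed u).symm)
    fun _ => mem_top

theorem IsCyclotomicExtension.isGalois_of_tower {F K Ω : Type*} [Field F] [Field K] [Field Ω]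
    [Algebra F K] [Algebra K Ω] [Algebra F Ω] [IsScalarTower F K Ω] [FiniteDimensional F K]
    [IsGalois F K] (m : ℕ) [NeZero m] [IsCyclotomicExtension {m} K Ω] : IsGalois F Ω := by
  have := IsCyclotomicExtension.isSeparable {m} K Ω
  have hsep : Algebra.IsSeparable F Ω := Algebra.IsSeparable.trans F K Ω
  obtain ⟨f, hfsep, hf⟩ := IsGalois.is_separable_splitting_field F K
  have hg : Polynomial.IsSplittingField K Ω
      ((Polynomial.X ^ m - 1 : Polynomial F).map (algebraMap F K)) := by
    simpa using IsCyclotomicExtension.isSplittingField_X_pow_sub_one m K Ω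
  have hmul := Polynomial.IsSplittingField.mul (F := F) (K := K) Ω f (Polynomial.X ^ m - 1)
    hfsep.ne_zero (Polynomial.X_pow_sub_C_ne_zero (NeZero.pos m) 1)
  have := Normal.of_isSplittingField (F := F) (E := Ω) (f * (Polynomial.X ^ m - 1))
  exact ⟨⟩

theorem exists_finset_adjoin_eq_top_of_eleven_ne_zero {k F K : Type*} [Field k] [Field F] [Field K]
    [Algebra k F] [Algebra F K] [Algebra k K] [IsScalarTower k F K] [FiniteDimensional F K]
    [IsGalois F K] (h11 : (11 : K) ≠ 0) {X : ZMod 11 → K} (hX : AlgebraicIndependent k X)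
    (htop : adjoin k (Set.range X) = ⊤)
    (hact : ∀ g : K ≃ₐ[F] K, ∃ a ≠ 0, ∃ b, ∀ j, g (X j) = X (a * j + b))
    {σ : K ≃ₐ[F] K} (hσ : ∀ j, σ (X j) = X (j + 1)) :
    ∃ s : Finset F, s.card ≤ 11 ∧ adjoin k (s : Set F) = ⊤ := by
  obtain ⟨m, hm, hm11, hm5⟩ : ∃ m : ℕ, (m : K) ≠ 0 ∧ 11 ∣ m ∧ ((5 : K) = 0 ∨ 5 ∣ m) := by
    by_cases h5 : (5 : K) = 0
    · exact ⟨11, by exact_mod_cast h11, dvd_rfl, Or.inl h5⟩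
    · refine ⟨5 * 11, ?_, by norm_num, Or.inr (by norm_num)⟩
      rw [Nat.cast_mul]
      exact mul_ne_zero (by exact_mod_cast h5) (by exact_mod_cast h11)
  have : NeZero (m : K) := ⟨hm⟩
  have : NeZero m := NeZero.of_neZero_natCast K
  let Ω := CyclotomicField m K
  have : IsScalarTower k K Ω := inferInstance
  have : IsScalarTower F K Ω := inferInstance
  have : IsScalarTower k F Ω := .of_algebraMap_eq fun c => by
    rw [IsScalarTower.algebraMap_apply k K Ω, IsScalarTower.algebraMap_apply F K Ω,
      ← IsScalarTower.algebraMap_apply k F K]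
  have : FiniteDimensional K Ω := IsCyclotomicExtension.finiteDimensional {m} K Ω
  have : FiniteDimensional F Ω := FiniteDimensional.trans F K Ω
  have : IsGalois F Ω := IsCyclotomicExtension.isGalois_of_tower (K := K) m
  have : SMulCommClass (Ω ≃ₐ[F] Ω) k Ω := ⟨fun g c u => g.toLinearMap.map_smul_of_tower c u⟩
  have hζ : IsPrimitiveRoot (IsCyclotomicExtension.zeta m K Ω) m :=
    IsCyclotomicExtension.zeta_spec m K Ω
  have hroot : ∀ (p : ℕ) [Fact p.Prime], p ∣ m → ∃ ε : AddChar (ZMod p) Ω, ε.IsPrimitive := by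
    rintro p _ ⟨q, hq⟩
    exact ⟨_, AddChar.zmodChar_primitive_of_primitive_root p
      (hζ.pow (NeZero.pos m) (mul_comm p q ▸ hq))⟩
  obtain ⟨ε, hε⟩ := hroot 11 hm11
  have h11Ω : (11 : Ω) ≠ 0 := by
    rw [← map_ofNat (algebraMap K Ω)]
    exact (map_ne_zero _).mpr h11
  have hinj : Function.Injective (algebraMap K Ω) := (algebraMap K Ω).injective
  let Y : ZMod 11 → Ω := algebraMap K Ω ∘ X
  have hY : AlgebraicIndependent k Y := hX.map' (f := IsScalarTower.toAlgHom k K Ω) hinj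
  have hYact : ∀ g : Ω ≃ₐ[F] Ω, ∃ a ≠ 0, ∃ b, ∀ j, g • Y j = Y (a * j + b) := by
    intro g
    obtain ⟨a, ha, b, hab⟩ := hact (g.restrictNormal K)
    exact ⟨a, ha, b, fun j => by
      change g (algebraMap K Ω (X j)) = algebraMap K Ω (X (a * j + b))
      rw [← hab, AlgEquiv.restrictNormal_commutes]⟩
  have hτ : ∀ j, σ.liftNormal Ω • Y j = Y (j + 1) := fun j => by
    change σ.liftNormal Ω (algebraMap K Ω (X j)) = algebraMap K Ω (X (j + 1))
    rw [AlgEquiv.liftNormal_commutes, hσ]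
  let S : Set Ω := {x | x ^ 11 = 1} ∪ {x | x ^ 5 = 1}
  have hSact : ∀ g : Ω ≃ₐ[F] Ω, ∀ x ∈ S, g • x ∈ S := by
    rintro g x (hx | hx)
    · exact Or.inl ((smul_pow' g x 11).symm.trans (by rw [hx, smul_one]))
    · exact Or.inr ((smul_pow' g x 5).symm.trans (by rw [hx, smul_one]))
  have hτS : ∀ x ∈ S, σ.liftNormal Ω ^ 20 • x = x := by
    rintro x (hx | hx)
    · rw [show 20 = (11 - 1) * 2 from rfl, pow_mul, pow_two, mul_smul,
        pow_smul_eq_self_of_pow_eq_one hx, pow_smul_eq_self_of_pow_eq_one hx]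
    · rw [show 20 = 5 * (5 - 1) from rfl, pow_mul]
      exact pow_smul_eq_self_of_pow_eq_one hx _
  have hSL : ∀ x ∈ S, x ∈ adjoin k S := fun x hx => subset_adjoin k S hx
  have hmem : ∀ {p : ℕ} [Fact p.Prime] (η : AddChar (ZMod p) Ω) i, η i ^ p = 1 := fun η i => by
    rw [← AddChar.map_nsmul_eq_pow, nsmul_eq_mul, CharP.cast_eq_zero, zero_mul,
      AddChar.map_zero_eq_one]
  have halg : adjoin k S ≤ algebraicClosure k Ω := by
    refine adjoin_le_iff.mpr ?_
    rintro x (hx | hx)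
    · exact mem_algebraicClosure_iff.mpr (IsAlgebraic.of_pow (n := 11) (by norm_num)
        (by rw [hx]; exact isAlgebraic_one))
    · exact mem_algebraicClosure_iff.mpr (IsAlgebraic.of_pow (n := 5) (by norm_num)
        (by rw [hx]; exact isAlgebraic_one))
  have hΩ : (5 : Ω) = 0 ∨ ∃ ε : AddChar (ZMod 5) Ω, ε.IsPrimitive ∧ (∀ i, ε i ∈ adjoin k S) ∧
      ∀ g : Ω ≃ₐ[F] Ω, ∃ c ≠ 0, ∀ i, g • ε i = ε (c * i) := by
    refine hm5.imp (fun h5 => ?_) fun h5 => ?_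
    · rw [← map_ofNat (algebraMap K Ω), h5, map_zero]
    · obtain ⟨η, hη⟩ := hroot 5 h5
      exact ⟨η, hη, fun i => hSL _ (Or.inr (hmem η i)), fun g => hη.exists_smul_eq g⟩
  have hfix : ∀ u : Ω, (∀ g : Ω ≃ₐ[F] Ω, g • u = u) ↔ u ∈ Set.range (algebraMap F Ω) :=
    fun u => (IsGalois.mem_range_algebraMap_iff_fixed u).symm
  have h0 : FixedGenBy (Ω ≃ₐ[F] Ω) (adjoin k S) 0 := by
    refine ⟨∅, le_rfl, by simp, fun u hu hgu => ?_⟩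
    obtain ⟨v, rfl⟩ := (hfix u).mp hgu
    rw [IsScalarTower.algebraMap_apply F K Ω] at hu ⊢
    have hv := (isAlgebraic_algebraMap_iff hinj).mp (mem_algebraicClosure_iff.mp (halg hu))
    obtain ⟨c, hc⟩ := mem_bot.mp (hX.mem_bot_of_isAlgebraic (htop ▸ mem_top) hv)
    rw [← hc, ← IsScalarTower.algebraMap_apply]
    exact IntermediateField.algebraMap_mem _ c
  have hstab : ∀ g : Ω ≃ₐ[F] Ω, ∀ a ∈ adjoin k S, g • a ∈ adjoin k S := by
    intro g a ha
    have := smul_mem_sup_adjoin g (L := ⊥) (s := S) (fun a ha => ?_) (fun x hx => ?_) a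
      (by rwa [bot_sup_eq])
    · rwa [bot_sup_eq] at this
    · obtain ⟨c, rfl⟩ := mem_bot.mp ha
      rw [smul_algebraMap]
      exact IntermediateField.algebraMap_mem _ c
    · exact (le_sup_right : adjoin k S ≤ _) (hSL _ (hSact g x hx))
  have hfixL : ∀ a ∈ adjoin k S, σ.liftNormal Ω ^ 20 • a = a := by
    intro a ha
    refine smul_eq_of_mem_sup_adjoin _ (L := ⊥) (s := S) (fun a ha => ?_) hτS a
      (by rwa [bot_sup_eq])
    obtain ⟨c, rfl⟩ := mem_bot.mp ha
    exact smul_algebraMap _ c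
  have h1 := h0.sup_adjoin_of_eleven_ne_zero hΩ hε h11Ω (fun i => hSL _ (Or.inl (hmem ε i)))
    (fun g => hε.exists_smul_eq g) hstab hY hYact (σ.liftNormal Ω ^ 20) hfixL (b := 20 • 1)
    (by decide) (pow_smul_apply_of_smul_apply hτ 20)
  refine h1.exists_finset hfix fun u => (le_sup_right : adjoin k (Set.range Y) ≤ _) ?_
  have himg : Set.range Y = IsScalarTower.toAlgHom k K Ω '' Set.range X := Set.range_comp _ X
  rw [himg, ← adjoin_map, htop, IsScalarTower.algebraMap_apply F K Ω]
  exact ⟨algebraMap F K u, mem_top, rfl⟩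

end Descent

/-- For any transitive solvable subgroup `G` of `S₁₁` acting on the rational function
field in 11 variables over any field `k` by permuting the variables, the fixed
field is purely transcendental over `k`. -/
theorem fixed_field_transitive_solvable_S11_rational
    (k K : Type*) [Field k] [Field K] [Algebra k K]
    (x : Fin 11 → K) (hx : AlgebraicIndependent k x)
    (hgen : IntermediateField.adjoin k (Set.range x) = ⊤)
    (G : Subgroup (Equiv.Perm (Fin 11)))
    (htrans : ∀ i j : Fin 11, ∃ g ∈ G, g i = j)
    (hsolv : IsSolvable G)
    (ρ : G →* (K ≃ₐ[k] K)) (hρ : ∀ (g : G) (i : Fin 11), ρ g (x i) = x (g.1 i)) :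
    IsRationalExtension k (IntermediateField.fixedField ρ.range) := by
  classical
  obtain ⟨e, ⟨σ, hσG, hσ⟩, haff⟩ := exists_equiv_zmod_affine (p := 11) (by simp) G htrans hsolv
  let X : ZMod 11 → K := x ∘ e
  have hX : AlgebraicIndependent k X := hx.comp e e.injective
  have htop : IntermediateField.adjoin k (Set.range X) = ⊤ := by rw [e.surjective.range_comp, hgen]
  have hfin : Finite ρ.range := Set.finite_range ρ
  let F := IntermediateField.fixedField ρ.range
  have : FiniteDimensional F K :=
    inferInstanceAs (FiniteDimensional (FixedPoints.subfield ρ.range K) K)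
  have : IsGalois F K := IsGalois.of_fixed_field K ρ.range
  have hact : ∀ g : K ≃ₐ[F] K, ∃ a ≠ 0, ∃ b, ∀ j, g (X j) = X (a * j + b) := by
    intro g
    obtain ⟨⟨_, h, rfl⟩, hg⟩ := FixedPoints.toAlgAut_surjective ρ.range K g
    obtain ⟨a, b, hab⟩ := haff h h.2
    refine ⟨a, a.ne_zero, b, fun j => ?_⟩
    have hgj : g (X j) = ρ h (X j) := (DFunLike.congr_fun hg (X j)).symm
    rw [hgj]
    exact (hρ h (e j)).trans (congrArg x (hab j))
  let τ : K ≃ₐ[F] K :=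
    MulSemiringAction.toAlgAut ρ.range (FixedPoints.subfield ρ.range K) K ⟨_, ⟨σ, hσG⟩, rfl⟩
  have hτ : ∀ j, τ (X j) = X (j + 1) := fun j =>
    (hρ ⟨σ, hσG⟩ (e j)).trans (congrArg x (hσ j))
  obtain ⟨s, hs, hgenF⟩ :
      ∃ s : Finset F, s.card ≤ 11 ∧ IntermediateField.adjoin k (s : Set F) = ⊤ := by
    by_cases h11 : (11 : K) = 0
    · have : CharP K 11 :=
        ringChar.of_eq (CharP.ringChar_of_prime_eq_zero (by norm_num) (by simpa using h11))
      exact exists_finset_adjoin_eq_top_of_charP_eleven hX htop hact hτ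
    · exact exists_finset_adjoin_eq_top_of_eleven_ne_zero h11 hX htop hact hτ
  have hadj : IntermediateField.adjoin k (s.image F.val : Set K) = F := by
    rw [Finset.coe_image, ← IntermediateField.adjoin_map, hgenF, ← AlgHom.fieldRange_eq_map,
      IntermediateField.fieldRange_val]
  refine ⟨s.image F.val, hX.coe_finset_of_isAlgebraic (Finset.card_image_le.trans hs) ?_, hadj⟩
  rw [hadj]
  exact Algebra.IsAlgebraic.of_finite F K
end
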